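/- Let G be a non-spherical Pride group based on the complete graph on four vertices with vertex groups X = G_1, Y = G_2, Z = G_3, T = G_4, and suppose that for every triple of distinct vertices the sum of the three Gersten–Stallings angles equals exactly π. Write θ = (G_13;G_1,G_3) = (G_24;G_2,G_4), α = (G_12;G_1,G_2) = (G_34;G_3,G_4), β = (G_23;G_2,G_3) = (G_14;G_1,G_4) with θ ≥ α ≥ β, and suppose (θ, α, β) ≠ (π/2, π/2, 0). Then for any nontrivial elements x ∈ G_1, y ∈ G_2, z ∈ G_3, t ∈ G_4, the image in G of the element u = xyztxyz has infinite order, and the subgroup of G generated by (the images of) t and u is isomorphic to the free product ⟨t⟩ * ⟨u⟩ of the cyclic subgroups generated by t and by u. In particular G contains a non-abelian free subgroup. -/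

import Mathlib

open Monoid

section PrideDefs

variable {A B : Type*} [Group A] [Group B]

/-- The free product length of an element of `A ∗ B`: the least number of
letters (each from `A` or `B`) whose product is `x`.  For a nontrivial element
this is the number of syllables in its normal form. -/
noncomputable def fpLength (x : Coprod A B) : ℕ :=
  sInf {n | ∃ l : List (Coprod A B), l.length = n ∧ l.prod = x ∧
      ∀ w ∈ l, (∃ a : A, Coprod.inl a = w) ∨ (∃ b : B, Coprod.inr b = w)}

/-- An element of `A ∗ B` is cyclically reduced iff its free product length is minimal
in its conjugacy class. -/
def IsCyclicallyReduced (x : Coprod A B) : Prop :=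
  ∀ g : Coprod A B, fpLength x ≤ fpLength (g * x * g⁻¹)

/-- The minimal free product length of a nontrivial element of `N` (junk value `0`
if `N` is trivial). -/
noncomputable def minRelLength (N : Subgroup (Coprod A B)) : ℕ :=
  sInf (fpLength '' {x | x ∈ N ∧ x ≠ 1})

/-- The Gersten–Stallings angle determined by a normal subgroup `N` of `A ∗ B`:
`2π/m` where `m` is the minimal free product length of a nontrivial element of `N`,
and `0` if `N` is trivial. -/
noncomputable def gsAngle (N : Subgroup (Coprod A B)) : ℝ :=
  letI := Classical.propDecidable (∃ x ∈ N, x ≠ 1)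
  if ∃ x ∈ N, x ≠ 1 then 2 * Real.pi / (minRelLength N : ℝ) else 0

variable {I : Type*} (G : I → Type*) [∀ i, Group (G i)]

/-- The canonical homomorphism `G i ∗ G j →* ∗ₖ G k`. -/
def edgeEmb (i j : I) : Coprod (G i) (G j) →* CoprodI G :=
  Coprod.lift CoprodI.of CoprodI.of

/-- The set of all Pride relators inside the free product of the vertex groups. -/
def prideRels (R : ∀ i j : I, Set (Coprod (G i) (G j))) : Set (CoprodI G) :=
  ⋃ (i : I) (j : I), (edgeEmb G i j) '' (R i j)

/-- The Pride group based on the complete graph on `I` with vertex groups `G i` and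
edge relations `R i j`. -/
abbrev PrideGroup (R : ∀ i j : I, Set (Coprod (G i) (G j))) : Type _ :=
  CoprodI G ⧸ Subgroup.normalClosure (prideRels G R)

/-- The conditions on the defining data of a Pride group: no relations on loops,
the relation sets are symmetric in the two vertices of an edge, each relation set is
finite, and each relator is cyclically reduced of free product length at least `2`. -/
def IsPrideData (R : ∀ i j : I, Set (Coprod (G i) (G j))) : Prop :=
  (∀ i, R i i = ∅) ∧
  (∀ i j, (Coprod.swap (G i) (G j)) '' R i j = R j i) ∧
  (∀ i j, (R i j).Finite) ∧
  (∀ i j, ∀ w ∈ R i j, IsCyclicallyReduced w ∧ 2 ≤ fpLength w)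

/-- Non-sphericity: all Gersten-Stallings angles are at most `π/2` and the angle sum
of each triangle is at most `π`. -/
def NonSpherical (R : ∀ i j : I, Set (Coprod (G i) (G j))) : Prop :=
  (∀ i j : I, i ≠ j → gsAngle (Subgroup.normalClosure (R i j)) ≤ Real.pi / 2) ∧
  (∀ i j k : I, i ≠ j → j ≠ k → i ≠ k →
    gsAngle (Subgroup.normalClosure (R i j)) + gsAngle (Subgroup.normalClosure (R j k)) +
      gsAngle (Subgroup.normalClosure (R i k)) ≤ Real.pi)

end PrideDefs

set_option linter.unusedSectionVars false

namespace PrideMap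

section Perm

open Equiv

variable {D : Type*}

/-- `l` lists a cycle of `f` in order. -/
def IsCyc (f : Perm D) (l : List D) : Prop := l.Nodup ∧ l.map f = l.rotate 1

theorem IsCyc.rotate {f : Perm D} {l : List D} (h : IsCyc f l) (n : ℕ) : IsCyc f (l.rotate n) := by
  refine ⟨List.nodup_rotate.2 h.1, ?_⟩
  rw [List.map_rotate, h.2, List.rotate_rotate, List.rotate_rotate, add_comm]

theorem IsCyc.swap_append {f : Perm D} {P Q : List D} (h : IsCyc f (P ++ Q)) :
    IsCyc f (Q ++ P) := by
  have := h.rotate P.length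
  rwa [List.rotate_append_length_eq] at this

theorem isCyc_cons {f : Perm D} {a : D} {A : List D} :
    IsCyc f (a :: A) ↔ (a :: A).Nodup ∧ (a :: A).map f = A ++ [a] := by
  simp [IsCyc]

theorem IsCyc.apply_mem {f : Perm D} {l : List D} (h : IsCyc f l) {x : D} :
    f x ∈ l ↔ x ∈ l := by
  have : f x ∈ l.map f ↔ f x ∈ l.rotate 1 := by rw [h.2]
  rw [List.mem_rotate] at this
  rw [← this]
  simp

theorem IsCyc.mem_of_sameCycle {f : Perm D} {l : List D} (h : IsCyc f l) {x y : D}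
    (hxy : f.SameCycle x y) : x ∈ l ↔ y ∈ l := by
  obtain ⟨n, rfl⟩ := hxy
  induction n using Int.induction_on with
  | zero => simp
  | succ n ih => rw [ih, add_comm, zpow_add, Perm.mul_apply, zpow_one, h.apply_mem]
  | pred n ih =>
    rw [ih, sub_eq_neg_add, zpow_add, Perm.mul_apply, ← h.apply_mem (x := (f ^ (-1 : ℤ)) _)]
    simp

theorem sameCycle_of_map_eq {f : Perm D} {a b : D} {A : List D}
    (h : (a :: A).map f = A ++ [b]) : ∀ x ∈ a :: A, f.SameCycle a x := by
  induction A generalizing a with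
  | nil =>
    intro x hx
    rw [List.mem_singleton.1 hx]
  | cons c A ih =>
    simp only [List.map_cons, List.cons_append, List.cons.injEq] at h
    intro x hx
    rcases List.mem_cons.1 hx with rfl | hx
    · exact Perm.SameCycle.refl _ _
    · have := ih (a := c) (by simpa using h.2) x hx
      rw [← h.1] at this
      exact (Perm.sameCycle_apply_left).1 this

theorem IsCyc.sameCycle {f : Perm D} {l : List D} (h : IsCyc f l) {x y : D}
    (hx : x ∈ l) (hy : y ∈ l) : f.SameCycle x y := by
  cases l with
  | nil => simp at hx
  | cons a A =>
    have := sameCycle_of_map_eq (isCyc_cons.1 h).2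
    exact (this x hx).symm.trans (this y hy)

theorem IsCyc.mem_iff {f : Perm D} {l : List D} (h : IsCyc f l) {x y : D}
    (hx : x ∈ l) : y ∈ l ↔ f.SameCycle x y :=
  ⟨fun hy => h.sameCycle hx hy, fun hxy => (h.mem_of_sameCycle hxy).1 hx⟩

theorem eq_of_map_eq {f : Perm D} : ∀ {A B : List D} {a c : D},
    (a :: A).map f = A ++ [c] → (a :: B).map f = B ++ [c] → c ∉ A → c ∉ B → A = B
  | [], [], _, _, _, _, _, _ => rfl
  | [], b :: B, a, c, h1, h2, _, h => by
    simp at h1 h2 h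
    exact absurd (h1.symm.trans h2.1) h.1
  | b :: B, [], a, c, h2, h1, h, _ => by
    simp at h1 h2 h
    exact absurd (h1.symm.trans h2.1) h.1
  | a' :: A, b :: B, a, c, h1, h2, h3, h4 => by
    simp only [List.map_cons, List.cons_append, List.cons.injEq] at h1 h2
    obtain rfl : a' = b := h1.1.symm.trans h2.1
    rw [eq_of_map_eq (a := a') (A := A) (B := B) (by simpa using h1.2) (by simpa using h2.2)
      (fun h => h3 (by simp [h])) (fun h => h4 (by simp [h]))]

theorem IsCyc.unique {f : Perm D} {a : D} {A B : List D} (h1 : IsCyc f (a :: A))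
    (h2 : IsCyc f (a :: B)) : A = B := by
  rw [isCyc_cons] at h1 h2
  exact eq_of_map_eq h1.2 h2.2 (List.nodup_cons.1 h1.1).1 (List.nodup_cons.1 h2.1).1

section Fin
variable [Finite D]

theorem exists_isCyc (f : Perm D) (a : D) : ∃ A, IsCyc f (a :: A) := by
  classical
  have hp : 0 < Function.minimalPeriod f a :=
    Function.minimalPeriod_pos_of_mem_periodicPts (by
      obtain ⟨n, hn, h⟩ := isOfFinOrder_iff_pow_eq_one.1 (isOfFinOrder_of_finite f)
      exact ⟨n, hn, by rw [Function.IsPeriodicPt, Function.IsFixedPt, Perm.iterate_eq_pow, h]; rfl⟩)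
  obtain ⟨n, hn⟩ := Nat.exists_eq_succ_of_ne_zero hp.ne'
  refine ⟨List.iterate f (f a) n, isCyc_cons.2 ⟨?_, ?_⟩⟩
  · have : a :: List.iterate f (f a) n = List.iterate f a (n + 1) := rfl
    rw [this, List.nodup_iff_injective_getElem]
    intro i j hij
    simp only [List.getElem_iterate] at hij
    have hi := i.2
    have hj := j.2
    simp only [List.length_iterate] at hi hj
    exact Fin.ext (Function.iterate_injOn_Iio_minimalPeriod
      (by simp [hn]; omega) (by simp [hn]; omega) hij)
  · have : a :: List.iterate f (f a) n = List.iterate f a (n + 1) := rfl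
    rw [this]
    apply List.ext_getElem
    · simp
    · intro i h1 h2
      simp only [List.getElem_map, List.getElem_iterate]
      rcases lt_or_ge i n with h | h
      · rw [List.getElem_append_left (by simpa using h)]
        simp only [List.getElem_iterate]
        rw [← Function.iterate_succ_apply' f, Function.iterate_succ_apply f]
      · have : i = n := by simp at h1; omega
        subst this
        rw [List.getElem_append_right (by simp)]
        simp only [List.length_iterate, Nat.sub_self, List.getElem_cons_zero]
        rw [← Function.iterate_succ_apply' f, ← hn]
        exact Function.iterate_minimalPeriod

/-- The cycle of `f` through `a`, listed from `a`. -/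
noncomputable def cyc (f : Perm D) (a : D) : List D := a :: (exists_isCyc f a).choose

theorem isCyc_cyc (f : Perm D) (a : D) : IsCyc f (cyc f a) := (exists_isCyc f a).choose_spec

theorem IsCyc.cyc_eq {f : Perm D} {a : D} {A : List D} (h : IsCyc f (a :: A)) :
    cyc f a = a :: A := by
  rw [cyc, (show IsCyc f (a :: _) from isCyc_cyc f a).unique h]

theorem self_mem_cyc (f : Perm D) (a : D) : a ∈ cyc f a := by simp [cyc]

theorem mem_cyc {f : Perm D} {a b : D} : b ∈ cyc f a ↔ f.SameCycle a b :=
  (isCyc_cyc f a).mem_iff (self_mem_cyc f a)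

theorem exists_cyc_eq_cons (f : Perm D) (a : D) : ∃ A, cyc f a = a :: A := ⟨_, rfl⟩

/-- Two elements of one cycle cut it into two arcs. -/
theorem exists_cyc_eq_append {f : Perm D} {a b : D} (hab : a ≠ b) (h : f.SameCycle a b) :
    ∃ P Q, cyc f a = a :: P ++ b :: Q ∧ cyc f b = b :: Q ++ a :: P := by
  obtain ⟨A, hA⟩ := exists_cyc_eq_cons f a
  have hb : b ∈ A := by
    have := mem_cyc.2 h
    rw [hA] at this
    simpa [hab.symm] using this
  obtain ⟨P, Q, rfl⟩ := List.append_of_mem hb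
  refine ⟨P, Q, by simp [hA], ?_⟩
  have h1 : IsCyc f ((a :: P) ++ (b :: Q)) := by
    have := isCyc_cyc f a
    rw [hA] at this
    simpa using this
  simpa using h1.swap_append.cyc_eq

theorem cyc_eq_singleton {f : Perm D} {a : D} (h : f a = a) : cyc f a = [a] :=
  IsCyc.cyc_eq (isCyc_cons.2 (by simp [h]))

end Fin

variable [DecidableEq D]

theorem map_swap_mul_of_not_mem {f : Perm D} {a b : D} {l : List D}
    (ha : a ∉ l.map f) (hb : b ∉ l.map f) : l.map (swap a b * f) = l.map f := by
  apply List.map_congr_left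
  intro x hx
  rw [Perm.mul_apply, swap_apply_of_ne_of_ne]
  · rintro rfl; exact ha (List.mem_map_of_mem hx)
  · rintro rfl; exact hb (List.mem_map_of_mem hx)

theorem IsCyc.swap_mul_of_not_mem {f : Perm D} {a b : D} {l : List D} (h : IsCyc f l)
    (ha : a ∉ l) (hb : b ∉ l) : IsCyc (swap a b * f) l := by
  refine ⟨h.1, ?_⟩
  rw [map_swap_mul_of_not_mem, h.2] <;> rw [h.2, List.mem_rotate] <;> assumption

theorem map_swap_mul_arc {f : Perm D} {a b : D} {P : List D} (haP : a ∉ P) (hbP : b ∉ P)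
    (h : (a :: P).map f = P ++ [b]) : (a :: P).map (swap a b * f) = P ++ [a] := by
  have : (a :: P).map (swap a b * f) = ((a :: P).map f).map (swap a b) := by simp
  rw [this, h, List.map_append]
  congr 1
  · conv_rhs => rw [← List.map_id P]
    apply List.map_congr_left
    intro x hx
    rw [swap_apply_of_ne_of_ne]
    · rfl
    · rintro rfl; exact haP hx
    · rintro rfl; exact hbP hx
  · simp

theorem IsCyc.split_left {f : Perm D} {a b : D} {P Q : List D}
    (h : IsCyc f (a :: P ++ b :: Q)) : IsCyc (swap a b * f) (a :: P) := by
  rw [List.cons_append, isCyc_cons] at h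
  obtain ⟨hn, hm⟩ := h
  have hn' := hn
  simp only [List.nodup_cons, List.nodup_append, List.mem_append, List.mem_cons, not_or] at hn
  refine isCyc_cons.2 ⟨by simp [hn], ?_⟩
  apply map_swap_mul_arc hn.1.1
  · intro hb; exact hn.2.2.2 b hb b (by simp) rfl
  · have h2 : (a :: P).map f ++ (b :: Q).map f = (P ++ [b]) ++ (Q ++ [a]) := by
      rw [← List.map_append, List.cons_append, hm]; simp
    exact (List.append_inj h2 (by simp)).1

theorem IsCyc.split_right {f : Perm D} {a b : D} {P Q : List D}
    (h : IsCyc f (a :: P ++ b :: Q)) : IsCyc (swap a b * f) (b :: Q) := by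
  rw [swap_comm]
  exact h.swap_append.split_left

theorem IsCyc.merge {f : Perm D} {a b : D} {P Q : List D} (h1 : IsCyc f (a :: P))
    (h2 : IsCyc f (b :: Q)) (hd : (a :: P).Disjoint (b :: Q)) :
    IsCyc (swap a b * f) (a :: P ++ b :: Q) := by
  rw [isCyc_cons] at h1 h2
  have hab : a ∉ b :: Q := hd (by simp)
  have hba : b ∉ a :: P := fun h => hd h (by simp)
  rw [List.cons_append]
  refine isCyc_cons.2 ⟨?_, ?_⟩
  · rw [← List.cons_append]; exact List.nodup_append'.2 ⟨h1.1, h2.1, hd⟩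
  · simp only [List.nodup_cons, List.mem_cons, not_or] at h1 h2 hab hba
    have e1 : (a :: P).map (swap b a * (swap a b * f)) = P ++ [a] := by
      rw [← mul_assoc, swap_comm b a, swap_mul_self, one_mul]; exact h1.2
    have key : ∀ (l m : List D) (x y : D), l.map f = m ++ [x] → x ∉ m → y ∉ m →
        l.map (swap x y * f) = m ++ [y] := by
      intro l m x y h hx hy
      have : l.map (swap x y * f) = (l.map f).map (swap x y) := by simp
      rw [this, h, List.map_append]
      congr 1
      · conv_rhs => rw [← List.map_id m]
        apply List.map_congr_left
        intro z hz
        rw [swap_apply_of_ne_of_ne]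
        · rfl
        · rintro rfl; exact hx hz
        · rintro rfl; exact hy hz
      · simp
    have k1 := key _ _ a b h1.2 h1.1.1 hba.2
    have k2 := key _ _ b a h2.2 h2.1.1 hab.2
    rw [swap_comm b a] at k2
    rw [← List.cons_append, List.map_append, k1, k2]
    simp

section Finite
variable [Finite D]

theorem split_spec {f : Perm D} {a b : D} (hab : a ≠ b) (h : f.SameCycle a b) :
    ∃ P Q, cyc f a = a :: P ++ b :: Q ∧ cyc f b = b :: Q ++ a :: P ∧
      cyc (swap a b * f) a = a :: P ∧ cyc (swap a b * f) b = b :: Q := by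
  obtain ⟨P, Q, h1, h2⟩ := exists_cyc_eq_append hab h
  have h3 : IsCyc f (a :: P ++ b :: Q) := h1 ▸ isCyc_cyc f a
  exact ⟨P, Q, h1, h2, h3.split_left.cyc_eq, h3.split_right.cyc_eq⟩

theorem merge_spec {f : Perm D} {a b : D} (h : ¬ f.SameCycle a b) :
    cyc (swap a b * f) a = cyc f a ++ cyc f b := by
  obtain ⟨P, hP⟩ := exists_cyc_eq_cons f a
  obtain ⟨Q, hQ⟩ := exists_cyc_eq_cons f b
  have h1 : IsCyc f (a :: P) := hP ▸ isCyc_cyc f a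
  have h2 : IsCyc f (b :: Q) := hQ ▸ isCyc_cyc f b
  rw [hP, hQ]
  refine IsCyc.cyc_eq (h1.merge h2 ?_)
  intro x hx hx'
  rw [← hP, mem_cyc] at hx
  rw [← hQ, mem_cyc] at hx'
  exact h (hx.trans hx'.symm)

theorem cyc_swap_mul_of_not {f : Perm D} {a b x : D} (ha : ¬ f.SameCycle x a)
    (hb : ¬ f.SameCycle x b) : cyc (swap a b * f) x = cyc f x := by
  obtain ⟨A, hA⟩ := exists_cyc_eq_cons f x
  have h : IsCyc f (x :: A) := hA ▸ isCyc_cyc f x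
  rw [hA]
  refine IsCyc.cyc_eq (h.swap_mul_of_not_mem ?_ ?_) <;> rw [← hA, mem_cyc] <;> assumption

theorem not_sameCycle_split {f : Perm D} {a b : D} (hab : a ≠ b) (h : f.SameCycle a b) :
    ¬ (swap a b * f).SameCycle a b := by
  obtain ⟨P, Q, h1, _, h3, _⟩ := split_spec hab h
  rw [← mem_cyc, h3]
  have := (isCyc_cyc f a).1
  rw [h1, List.nodup_append] at this
  intro hb
  exact this.2.2 b hb b (by simp) rfl

theorem sameCycle_merge {f : Perm D} {a b : D} (h : ¬ f.SameCycle a b) :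
    (swap a b * f).SameCycle a b := by
  rw [← mem_cyc, merge_spec h]
  simp [self_mem_cyc]

end Finite
end Perm

section Count

open Equiv

variable {D : Type*}

theorem perm_apply_inv (σ : Perm D) (x : D) : σ (σ⁻¹ x) = x := by simp

/-- The setoid obtained from `s` by identifying the classes of `a` and `b`. -/
def glue (s : Setoid D) (a b : D) : Setoid D where
  r x y := s x y ∨ (s x a ∧ s b y) ∨ (s x b ∧ s a y)
  iseqv := by
    have hr := s.refl
    have hs : ∀ {x y}, s x y → s y x := s.symm
    have ht : ∀ {x y z}, s x y → s y z → s x z := s.trans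
    refine ⟨fun x => Or.inl (hr x), ?_, ?_⟩
    · rintro x y (h | ⟨h, h'⟩ | ⟨h, h'⟩)
      · exact Or.inl (hs h)
      · exact Or.inr (Or.inr ⟨hs h', hs h⟩)
      · exact Or.inr (Or.inl ⟨hs h', hs h⟩)
    · rintro x y z (h | ⟨h, h'⟩ | ⟨h, h'⟩) (k | ⟨k, k'⟩ | ⟨k, k'⟩)
      · exact Or.inl (ht h k)
      · exact Or.inr (Or.inl ⟨ht h k, k'⟩)
      · exact Or.inr (Or.inr ⟨ht h k, k'⟩)
      · exact Or.inr (Or.inl ⟨h, ht h' k⟩)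
      · exact Or.inr (Or.inl ⟨h, k'⟩)
      · exact Or.inl (ht h k')
      · exact Or.inr (Or.inr ⟨h, ht h' k⟩)
      · exact Or.inl (ht h k')
      · exact Or.inr (Or.inr ⟨h, k'⟩)

theorem glue_le {s t : Setoid D} {a b : D} : glue s a b ≤ t ↔ s ≤ t ∧ t a b := by
  constructor
  · intro h
    exact ⟨fun x y hxy => h (Or.inl hxy), h (Or.inr (Or.inl ⟨s.refl a, s.refl b⟩))⟩
  · rintro ⟨h, hab⟩ x y (h1 | ⟨h1, h2⟩ | ⟨h1, h2⟩)
    · exact h h1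
    · exact t.trans (t.trans (h h1) hab) (h h2)
    · exact t.trans (t.trans (h h1) (t.symm hab)) (h h2)

theorem glue_sup (s t : Setoid D) (a b : D) : glue s a b ⊔ t = glue (s ⊔ t) a b := by
  apply le_antisymm
  · have := (glue_le (s := s ⊔ t) (a := a) (b := b)).1 le_rfl
    exact sup_le (glue_le.2 ⟨le_sup_left.trans this.1, this.2⟩) (le_sup_right.trans this.1)
  · have := (glue_le (s := s) (a := a) (b := b)).1 le_rfl
    exact glue_le.2 ⟨sup_le_sup_right this.1 t,
      (le_sup_left : glue s a b ≤ glue s a b ⊔ t) this.2⟩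

theorem glue_eq_self {s : Setoid D} {a b : D} (h : s a b) : glue s a b = s :=
  le_antisymm (glue_le.2 ⟨le_rfl, h⟩) (glue_le.1 le_rfl).1

/-- The number of classes of a setoid. -/
noncomputable def cnt (s : Setoid D) : ℕ := Nat.card (Quotient s)

theorem cnt_glue [Finite D] {s : Setoid D} {a b : D} (h : ¬ s a b) :
    cnt (glue s a b) + 1 = cnt s := by
  classical
  have hb : ∀ x, s b x → ¬ s x a := fun x hx hxa => h (s.symm (s.trans hx hxa))
  let f : {q : Quotient s // q ≠ ⟦b⟧} → Quotient (glue s a b) := fun q =>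
    Quotient.map' (s₂ := glue s a b) id (fun x y hxy => Or.inl hxy) q.1
  have hf : Function.Bijective f := by
    constructor
    · rintro ⟨q, hq⟩ ⟨q', hq'⟩ hqq
      induction q using Quotient.inductionOn with | _ x
      induction q' using Quotient.inductionOn with | _ y
      have hx : ¬ s x b := fun h => hq (Quotient.sound h)
      have hy : ¬ s y b := fun h => hq' (Quotient.sound h)
      have : glue s a b x y := Quotient.exact hqq
      rcases this with h1 | ⟨_, h1⟩ | ⟨h1, _⟩
      · exact Subtype.ext (Quotient.sound h1)
      · exact absurd (s.symm h1) hy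
      · exact absurd h1 hx
    · intro q
      induction q using Quotient.inductionOn with | _ x
      by_cases hx : s x b
      · exact ⟨⟨⟦a⟧, fun e => h (Quotient.exact e)⟩,
          Quotient.sound (Or.inr (Or.inl ⟨s.refl a, s.symm hx⟩))⟩
      · exact ⟨⟨⟦x⟧, fun e => hx (Quotient.exact e)⟩, rfl⟩
  rw [cnt, cnt, ← Nat.card_congr (Equiv.ofBijective f hf)]
  have := Fintype.ofFinite (Quotient s)
  rw [Nat.card_eq_fintype_card, Nat.card_eq_fintype_card]
  have := Fintype.card_subtype_compl (fun q : Quotient s => q = ⟦b⟧)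
  rw [Fintype.card_subtype_eq] at this
  have h0 : 0 < Fintype.card (Quotient s) := Fintype.card_pos_iff.2 ⟨⟦b⟧⟩
  have e : Fintype.card {q : Quotient s // q ≠ ⟦b⟧} = Fintype.card {q : Quotient s // ¬ q = ⟦b⟧} :=
    rfl
  omega

/-- The setoid of cycles of a permutation. -/
abbrev orb (f : Perm D) : Setoid D := Perm.SameCycle.setoid f

theorem orb_apply {f : Perm D} {x y : D} : orb f x y ↔ f.SameCycle x y := Iff.rfl

theorem orb_le {f : Perm D} {t : Setoid D} (h : ∀ x, t x (f x)) : orb f ≤ t := by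
  rintro x y ⟨n, rfl⟩
  induction n using Int.induction_on with
  | zero => exact t.refl x
  | succ n ih =>
    refine t.trans ih ?_
    rw [add_comm, zpow_add, Perm.mul_apply, zpow_one]
    exact h _
  | pred n ih =>
    refine t.trans ih (t.symm ?_)
    have := h ((f ^ (-(n : ℤ) - 1)) x)
    rwa [← Perm.mul_apply, ← zpow_one_add, show (1 : ℤ) + (-n - 1) = -n by ring] at this

theorem orb_inv (f : Perm D) : orb f⁻¹ = orb f := by
  ext x y
  exact Perm.sameCycle_inv

theorem orb_one_apply {x y : D} : orb (1 : Perm D) x y ↔ x = y := by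
  simp [orb_apply]

/-- The setoid of components of the map given by two permutations. -/
def comp (φ σ : Perm D) : Setoid D := orb φ ⊔ orb σ

theorem comp_comm (φ σ : Perm D) : comp φ σ = comp σ φ := sup_comm _ _

theorem comp_of_left {φ σ : Perm D} {x y : D} (h : φ.SameCycle x y) : comp φ σ x y :=
  (le_sup_left : orb φ ≤ orb φ ⊔ orb σ) h

theorem comp_of_right {φ σ : Perm D} {x y : D} (h : σ.SameCycle x y) : comp φ σ x y :=
  (le_sup_right : orb σ ≤ orb φ ⊔ orb σ) h

theorem comp_le {φ σ : Perm D} {t : Setoid D} (h : ∀ x, t x (φ x)) (h' : ∀ x, t x (σ x)) :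
    comp φ σ ≤ t := sup_le (orb_le h) (orb_le h')

theorem comp_apply_left (φ σ : Perm D) (x : D) : comp φ σ x (φ x) :=
  comp_of_left (Perm.sameCycle_apply_right.2 (Perm.SameCycle.refl _ _))

theorem comp_apply_right (φ σ : Perm D) (x : D) : comp φ σ x (σ x) :=
  comp_of_right (Perm.sameCycle_apply_right.2 (Perm.SameCycle.refl _ _))

theorem orb_face_le (φ σ : Perm D) : orb (σ⁻¹ * φ) ≤ comp φ σ := by
  refine orb_le fun x => ?_
  have h := comp_apply_right φ σ (σ⁻¹ (φ x))
  rw [perm_apply_inv] at h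
  exact (comp φ σ).trans (comp_apply_left φ σ x) ((comp φ σ).symm h)

variable [Finite D] [DecidableEq D]

theorem orb_merge {f : Perm D} {a b : D} (h : ¬ f.SameCycle a b) :
    orb (swap a b * f) = glue (orb f) a b := by
  have hab := sameCycle_merge h
  have hm : ∀ y, (swap a b * f).SameCycle a y ↔ f.SameCycle a y ∨ f.SameCycle b y := by
    intro y
    rw [← mem_cyc, merge_spec h, List.mem_append, mem_cyc, mem_cyc]
  have hm' : ∀ y, (swap a b * f).SameCycle b y ↔ f.SameCycle a y ∨ f.SameCycle b y := by
    intro y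
    rw [← hm]
    exact ⟨hab.trans, hab.symm.trans⟩
  apply le_antisymm
  · refine orb_le fun x => ?_
    by_cases hxa : f x = a
    · refine Or.inr (Or.inl ⟨?_, ?_⟩)
      · exact hxa ▸ Perm.sameCycle_apply_right.2 (Perm.SameCycle.refl f x)
      · simp [hxa]
    by_cases hxb : f x = b
    · refine Or.inr (Or.inr ⟨?_, ?_⟩)
      · exact hxb ▸ Perm.sameCycle_apply_right.2 (Perm.SameCycle.refl f x)
      · simp [hxb]
    · rw [Perm.mul_apply, swap_apply_of_ne_of_ne hxa hxb]
      exact Or.inl (Perm.sameCycle_apply_right.2 (Perm.SameCycle.refl f x))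
  · refine glue_le.2 ⟨?_, hab⟩
    intro x y hxy
    by_cases hxa : f.SameCycle a x
    · exact ((hm x).2 (Or.inl hxa)).symm.trans ((hm y).2 (Or.inl (hxa.trans hxy)))
    by_cases hxb : f.SameCycle b x
    · exact ((hm' x).2 (Or.inr hxb)).symm.trans ((hm' y).2 (Or.inr (hxb.trans hxy)))
    · rw [orb_apply, ← mem_cyc, cyc_swap_mul_of_not (fun h => hxa h.symm) (fun h => hxb h.symm),
        mem_cyc]
      exact hxy

theorem orb_split {f : Perm D} {a b : D} (hab : a ≠ b) (h : f.SameCycle a b) :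
    orb f = glue (orb (swap a b * f)) a b := by
  rw [← orb_merge (not_sameCycle_split hab h), ← mul_assoc, swap_mul_self, one_mul]

theorem cnt_merge {f : Perm D} {a b : D} (h : ¬ f.SameCycle a b) :
    cnt (orb (swap a b * f)) + 1 = cnt (orb f) := by
  rw [orb_merge h, cnt_glue h]

theorem cnt_split {f : Perm D} {a b : D} (hab : a ≠ b) (h : f.SameCycle a b) :
    cnt (orb f) + 1 = cnt (orb (swap a b * f)) := by
  rw [orb_split hab h, cnt_glue (not_sameCycle_split hab h)]

theorem comp_merge {φ σ : Perm D} {a b : D} (h : ¬ φ.SameCycle a b) :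
    comp (swap a b * φ) σ = glue (comp φ σ) a b := by
  rw [comp, orb_merge h, glue_sup, comp]

theorem comp_split {φ σ : Perm D} {a b : D} (hab : a ≠ b) (h : φ.SameCycle a b) :
    comp φ σ = glue (comp (swap a b * φ) σ) a b := by
  rw [comp, orb_split hab h, glue_sup, comp]

theorem face_swap (φ σ : Perm D) (a b : D) :
    σ⁻¹ * (swap a b * φ) = swap (σ⁻¹ a) (σ⁻¹ b) * (σ⁻¹ * φ) := by
  rw [← mul_assoc, Equiv.mul_swap_eq_swap_mul, mul_assoc]

/-- Twice the number of components plus the number of darts, minus the number of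
nodes, vertices and faces; nonnegative, and zero for planar maps. -/
theorem cnt_add_le (φ σ : Perm D) :
    cnt (orb φ) + cnt (orb σ) + cnt (orb (σ⁻¹ * φ)) ≤ Nat.card D + 2 * cnt (comp φ σ) := by
  generalize hn : {x | φ x ≠ x}.ncard = n
  induction n using Nat.strong_induction_on generalizing φ with
  | _ n ih
  by_cases hfix : ∀ x, φ x = x
  · obtain rfl : φ = 1 := Perm.ext hfix
    have e1 : comp 1 σ = orb σ := by
      refine le_antisymm (comp_le (fun x => (orb σ).refl x) fun x => ?_) le_sup_right
      exact Perm.sameCycle_apply_right.2 (Perm.SameCycle.refl _ _)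
    have e2 : cnt (orb (1 : Perm D)) = Nat.card D := by
      refine (Nat.card_congr (Equiv.ofBijective (Quotient.mk (orb (1 : Perm D))) ⟨?_, ?_⟩)).symm
      · intro x y h
        exact orb_one_apply.1 (Quotient.exact h)
      · exact Quotient.mk_surjective
    rw [e1, e2, mul_one, orb_inv]
    omega
  · push Not at hfix
    obtain ⟨x, hx⟩ := hfix
    set φ' := swap x (φ x) * φ with hφ'
    have hsc : φ.SameCycle x (φ x) := Perm.sameCycle_apply_right.2 (Perm.SameCycle.refl _ _)
    have hx' : φ' x = x := by simp [hφ']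
    have hlt : {y | φ' y ≠ y}.ncard < n := by
      rw [← hn]
      apply Set.ncard_lt_ncard _ (Set.toFinite _)
      refine ⟨?_, ?_⟩
      · intro y hy hy'
        apply hy
        rw [hφ', Perm.mul_apply, hy', swap_apply_of_ne_of_ne]
        · rintro rfl; exact hx hy'
        · intro e; rw [e] at hy'; exact hx (φ.injective hy')
      · intro h; exact h hx hx'
    have key := ih _ hlt φ' rfl
    have c1 := cnt_split hx.symm hsc
    have c2 := comp_split (σ := σ) hx.symm hsc
    rw [← hφ'] at c1 c2
    have c3 : σ⁻¹ * φ = swap (σ⁻¹ x) (σ⁻¹ (φ x)) * (σ⁻¹ * φ') := by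
      rw [← face_swap, hφ', ← mul_assoc (swap _ _), swap_mul_self, one_mul]
    by_cases hE : comp φ' σ x (φ x)
    · rw [glue_eq_self hE] at c2
      rw [c2]
      by_cases ht : (σ⁻¹ * φ').SameCycle (σ⁻¹ x) (σ⁻¹ (φ x))
      · have := cnt_split (by simpa using hx.symm) ht
        rw [← c3] at this
        omega
      · have := cnt_merge ht
        rw [← c3] at this
        omega
    · have c4 := cnt_glue hE
      rw [← c2] at c4
      have ht : ¬ (σ⁻¹ * φ').SameCycle (σ⁻¹ x) (σ⁻¹ (φ x)) := by
        intro ht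
        apply hE
        have e := orb_face_le φ' σ ht
        have e1 := comp_apply_right φ' σ (σ⁻¹ x)
        have e2 := comp_apply_right φ' σ (σ⁻¹ (φ x))
        rw [perm_apply_inv] at e1 e2
        exact (comp φ' σ).trans ((comp φ' σ).symm e1) ((comp φ' σ).trans e e2)
      have := cnt_merge ht
      rw [← c3] at this
      omega

/-- The map given by two permutations (with faces the cycles of `σ⁻¹ * φ`) is planar. -/
def Planar (φ σ : Perm D) : Prop :=
  cnt (orb φ) + cnt (orb σ) + cnt (orb (σ⁻¹ * φ)) = Nat.card D + 2 * cnt (comp φ σ)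

theorem Planar.symm {φ σ : Perm D} (h : Planar φ σ) : Planar σ φ := by
  have : φ⁻¹ * σ = (σ⁻¹ * φ)⁻¹ := by simp
  rw [Planar, this, orb_inv, comp_comm, ← h]
  ring

theorem comp_of_face {φ σ : Perm D} {a b : D}
    (h : (σ⁻¹ * φ).SameCycle (σ⁻¹ a) (σ⁻¹ b)) : comp φ σ a b := by
  have e := orb_face_le φ σ h
  have e1 := comp_apply_right φ σ (σ⁻¹ a)
  have e2 := comp_apply_right φ σ (σ⁻¹ b)
  rw [perm_apply_inv] at e1 e2
  exact (comp φ σ).trans ((comp φ σ).symm e1) ((comp φ σ).trans e e2)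

theorem Planar.split {φ σ : Perm D} (h : Planar φ σ) {a b : D} (hab : a ≠ b)
    (hs : φ.SameCycle a b) : Planar (swap a b * φ) σ ∧
      ((σ⁻¹ * φ).SameCycle (σ⁻¹ a) (σ⁻¹ b) → ¬ comp (swap a b * φ) σ a b) := by
  have c1 := cnt_split hab hs
  have c2 := comp_split (σ := σ) hab hs
  have c3 := face_swap φ σ a b
  have key := cnt_add_le (swap a b * φ) σ
  unfold Planar at h ⊢
  have hab' : σ⁻¹ a ≠ σ⁻¹ b := by simpa using hab
  by_cases hE : comp (swap a b * φ) σ a b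
  · rw [glue_eq_self hE] at c2
    by_cases ht : (σ⁻¹ * φ).SameCycle (σ⁻¹ a) (σ⁻¹ b)
    · have := cnt_split hab' ht
      rw [← c3] at this
      rw [c2] at h
      omega
    · have := cnt_merge ht
      rw [← c3] at this
      rw [c2] at h
      exact ⟨by omega, fun h => absurd h ht⟩
  · have c4 := cnt_glue hE
    rw [← c2] at c4
    by_cases ht : (σ⁻¹ * φ).SameCycle (σ⁻¹ a) (σ⁻¹ b)
    · have := cnt_split hab' ht
      rw [← c3] at this
      exact ⟨by omega, fun _ => hE⟩
    · have ht' := sameCycle_merge ht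
      rw [← c3] at ht'
      exact absurd (comp_of_face ht') hE

theorem Planar.merge_face {φ σ : Perm D} (h : Planar φ σ) {a b : D} (hs : ¬ φ.SameCycle a b)
    (ht : (σ⁻¹ * φ).SameCycle (σ⁻¹ a) (σ⁻¹ b)) : Planar (swap a b * φ) σ := by
  have c1 := cnt_merge hs
  have c2 := comp_merge (σ := σ) hs
  rw [glue_eq_self (comp_of_face ht)] at c2
  have hab' : σ⁻¹ a ≠ σ⁻¹ b := by
    intro e
    rw [EmbeddingLike.apply_eq_iff_eq] at e
    exact hs (e ▸ Perm.SameCycle.refl _ _)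
  have := cnt_split hab' ht
  rw [← face_swap] at this
  unfold Planar at h ⊢
  rw [c2]
  omega

theorem Planar.merge_comp {φ σ : Perm D} (h : Planar φ σ) {a b : D} (hE : ¬ comp φ σ a b) :
    Planar (swap a b * φ) σ := by
  have hs : ¬ φ.SameCycle a b := fun h => hE (comp_of_left h)
  have c1 := cnt_merge hs
  have c2 := comp_merge (σ := σ) hs
  have c4 := cnt_glue hE
  have ht : ¬ (σ⁻¹ * φ).SameCycle (σ⁻¹ a) (σ⁻¹ b) := fun ht => hE (comp_of_face ht)
  have := cnt_merge ht
  rw [← face_swap] at this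
  unfold Planar at h ⊢
  rw [c2]
  omega

theorem Planar.isolate {φ σ : Perm D} (h : Planar φ σ) (x : D) :
    Planar (swap x (φ x) * φ) σ := by
  by_cases hx : φ x = x
  · rw [hx, swap_self, ← Perm.one_def, one_mul]; exact h
  · exact (h.split (Ne.symm hx)
      (Perm.sameCycle_apply_right.2 (Perm.SameCycle.refl _ _))).1

end Count

section Curvature

open Equiv

variable {D : Type*} [Fintype D] [DecidableEq D]

theorem length_cyc_pos (f : Perm D) (x : D) : 0 < (cyc f x).length := by
  obtain ⟨A, hA⟩ := exists_cyc_eq_cons f x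
  simp [hA]

theorem cyc_perm {f : Perm D} {x y : D} (h : f.SameCycle x y) : (cyc f x).Perm (cyc f y) := by
  rw [List.perm_ext_iff_of_nodup (isCyc_cyc f x).1 (isCyc_cyc f y).1]
  intro z
  rw [mem_cyc, mem_cyc]
  exact ⟨h.symm.trans, h.trans⟩

theorem sum_cyc_eq (f : Perm D) (x : D) (g : D → ℚ) [DecidablePred fun y => f.SameCycle x y] :
    ((cyc f x).map g).sum = ∑ y with f.SameCycle x y, g y := by
  rw [← List.sum_toFinset _ (isCyc_cyc f x).1]
  apply Finset.sum_congr _ fun _ _ => rfl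
  ext y
  simp [mem_cyc]

theorem sum_eq_sum_avg (f : Perm D) (O : Finset D) (hO : ∀ x y, f.SameCycle x y → x ∈ O → y ∈ O)
    (g : D → ℚ) :
    ∑ x ∈ O, g x = ∑ x ∈ O, ((cyc f x).map g).sum / (cyc f x).length := by
  classical
  have h1 : ∀ x ∈ O, ((cyc f x).map g).sum / (cyc f x).length =
      ∑ y ∈ O, if f.SameCycle x y then g y / (cyc f y).length else 0 := by
    intro x hx
    rw [sum_cyc_eq, Finset.sum_div, ← Finset.sum_filter]
    have e : Finset.filter (fun y => f.SameCycle x y) O =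
        Finset.filter (fun y => f.SameCycle x y) Finset.univ := by
      ext y
      simp only [Finset.mem_filter, Finset.mem_univ, true_and, and_iff_right_iff_imp]
      exact fun h => hO x y h hx
    rw [e]
    refine Finset.sum_congr rfl fun y hy => ?_
    rw [(cyc_perm (Finset.mem_filter.1 hy).2).length_eq]
  rw [Finset.sum_congr rfl h1, Finset.sum_comm]
  refine Finset.sum_congr rfl fun y hy => ?_
  have h2 : ∀ x ∈ O, (if f.SameCycle x y then g y / ((cyc f y).length : ℚ) else 0) =
      if f.SameCycle y x then g y / ((cyc f y).length : ℚ) else 0 := by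
    intro x _
    simp only [Perm.sameCycle_comm]
  rw [Finset.sum_congr rfl h2, ← Finset.sum_filter, Finset.sum_const]
  have e : Finset.filter (fun x => f.SameCycle y x) O = (cyc f y).toFinset := by
    ext x
    simp only [Finset.mem_filter, List.mem_toFinset, mem_cyc, and_iff_right_iff_imp]
    exact fun h => hO y x h hy
  rw [e, List.toFinset_card_of_nodup (isCyc_cyc f y).1, nsmul_eq_mul]
  have : ((cyc f y).length : ℚ) ≠ 0 := by exact_mod_cast (length_cyc_pos f y).ne'
  field_simp

theorem sum_le_sum_of_cyc (f : Perm D) (O : Finset D)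
    (hO : ∀ x y, f.SameCycle x y → x ∈ O → y ∈ O) (g h : D → ℚ)
    (H : ∀ x ∈ O, ((cyc f x).map g).sum ≤ ((cyc f x).map h).sum) :
    ∑ x ∈ O, g x ≤ ∑ x ∈ O, h x := by
  rw [sum_eq_sum_avg f O hO g, sum_eq_sum_avg f O hO h]
  refine Finset.sum_le_sum fun x hx => ?_
  gcongr
  exact H x hx

theorem sum_cyc_weight (f : Perm D) (x : D) (c : ℚ) (g : D → ℚ) :
    ((cyc f x).map fun y => c / (cyc f y).length + g y).sum = c + ((cyc f x).map g).sum := by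
  have : (cyc f x).map (fun y => c / ((cyc f y).length : ℚ)) =
      (cyc f x).map (fun _ => c / ((cyc f x).length : ℚ)) := by
    apply List.map_congr_left
    intro y hy
    rw [(cyc_perm (mem_cyc.1 hy)).length_eq]
  rw [List.sum_map_add, this, List.map_const', List.sum_replicate, nsmul_eq_mul]
  have : ((cyc f x).length : ℚ) ≠ 0 := by exact_mod_cast (length_cyc_pos f x).ne'
  field_simp

theorem cnt_orb_eq (f : Perm D) : (cnt (orb f) : ℚ) = ∑ x, 1 / ((cyc f x).length : ℚ) := by
  classical
  have := Fintype.ofFinite (Quotient (orb f))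
  rw [cnt, Nat.card_eq_fintype_card, ← Finset.card_univ, Finset.cast_card,
    ← Finset.sum_fiberwise (g := fun x => (Quotient.mk (orb f) x))]
  refine Finset.sum_congr rfl fun c _ => ?_
  obtain ⟨x, rfl⟩ := Quotient.mk_surjective c
  have e : ∀ y, (Quotient.mk (orb f) y = Quotient.mk (orb f) x) ↔ f.SameCycle x y := by
    intro y
    rw [Quotient.eq, Perm.sameCycle_comm]
    rfl
  have := sum_cyc_weight f x 1 (fun _ => 0)
  simp only [add_zero, List.map_const', List.sum_replicate, smul_zero] at this
  simp only [e]
  rw [← sum_cyc_eq, this]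

/-- Isolating all darts outside one component keeps the map planar. -/
theorem exists_planar_isolated (x₀ : D) {φ σ : Perm D} (h : Planar φ σ) :
    ∃ φ' σ' : Perm D, Planar φ' σ' ∧ (∀ x, comp φ σ x₀ x → φ' x = φ x ∧ σ' x = σ x) ∧
      ∀ x, ¬ comp φ σ x₀ x → φ' x = x ∧ σ' x = x := by
  let O : D → Prop := comp φ σ x₀
  have aux : ∀ (n : ℕ) (φ σ : Perm D), Planar φ σ → (∀ x, O (φ x) ↔ O x) →
      {x | ¬ O x ∧ φ x ≠ x}.ncard = n →
      ∃ φ' : Perm D, Planar φ' σ ∧ (∀ x, O x → φ' x = φ x) ∧ ∀ x, ¬ O x → φ' x = x := by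
    intro n
    induction n using Nat.strong_induction_on with
    | _ n ih
    intro φ σ h hO hn
    by_cases hfix : ∀ x, ¬ O x → φ x = x
    · exact ⟨φ, h, fun _ _ => rfl, hfix⟩
    push Not at hfix
    obtain ⟨x, hxO, hx⟩ := hfix
    have hO' : ∀ y, O y → (swap x (φ x) * φ) y = φ y := by
      intro y hy
      rw [Perm.mul_apply, swap_apply_of_ne_of_ne]
      · intro e; exact hxO (e ▸ (hO y).2 hy)
      · intro e; exact hxO ((hO x).1 (e ▸ (hO y).2 hy))
    obtain ⟨φ', h1, h2, h3⟩ := ih _ (by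
      rw [← hn]
      apply Set.ncard_lt_ncard _ (Set.toFinite _)
      refine ⟨?_, ?_⟩
      · rintro y ⟨hy, hy'⟩
        refine ⟨hy, fun e => hy' ?_⟩
        rw [Perm.mul_apply, e, swap_apply_of_ne_of_ne]
        · rintro rfl; exact hx e
        · intro e'; rw [e'] at e; exact hx (φ.injective e)
      · intro hs
        exact (hs (show _ from ⟨hxO, hx⟩)).2 (by simp)) (swap x (φ x) * φ) σ (h.isolate x) (by
        intro y
        by_cases hy : O y
        · rw [hO' y hy, hO]
        · simp only [hy, iff_false, Perm.mul_apply]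
          have hy2 : ¬ O (φ y) := fun h => hy ((hO y).1 h)
          have hx2 : ¬ O (φ x) := fun h => hxO ((hO x).1 h)
          rw [swap_apply_def]
          split_ifs <;> assumption) rfl
    exact ⟨φ', h1, fun y hy => (h2 y hy).trans (hO' y hy), h3⟩
  have closedφ : ∀ x, O (φ x) ↔ O x := fun x =>
    ⟨fun h => (comp φ σ).trans h ((comp φ σ).symm (comp_apply_left φ σ x)),
      fun h => (comp φ σ).trans h (comp_apply_left φ σ x)⟩
  have closedσ : ∀ x, O (σ x) ↔ O x := fun x =>
    ⟨fun h => (comp φ σ).trans h ((comp φ σ).symm (comp_apply_right φ σ x)),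
      fun h => (comp φ σ).trans h (comp_apply_right φ σ x)⟩
  obtain ⟨φ', h1, h2, h3⟩ := aux _ φ σ h closedφ rfl
  obtain ⟨σ', k1, k2, k3⟩ := aux _ σ φ' h1.symm closedσ rfl
  exact ⟨φ', σ', k1.symm, fun x hx => ⟨h2 x hx, k2 x hx⟩, fun x hx => ⟨h3 x hx, k3 x hx⟩⟩

theorem isCyc_congr {f g : Perm D} {l : List D} (h : IsCyc f l) (hg : ∀ x ∈ l, g x = f x) :
    IsCyc g l := ⟨h.1, by rw [← h.2]; exact List.map_congr_left hg⟩

theorem cyc_congr {f g : Perm D} {x : D} (h : ∀ y, f.SameCycle x y → g y = f y) :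
    cyc g x = cyc f x := by
  obtain ⟨A, hA⟩ := exists_cyc_eq_cons f x
  rw [hA]
  refine IsCyc.cyc_eq (isCyc_congr (hA ▸ isCyc_cyc f x) fun y hy => h y ?_)
  rwa [← mem_cyc, hA]

theorem sameCycle_of_comp_apply {φ σ : Perm D} {x y : D} (h : comp φ σ x y) (hx : φ x = x)
    (hx' : σ x = x) : x = y := by
  let t : Setoid D :=
    { r := fun u v => u = x ↔ v = x
      iseqv := ⟨fun _ => Iff.rfl, fun h => h.symm, fun h h' => h.trans h'⟩ }
  have ht : comp φ σ ≤ t := comp_le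
    (fun u => ⟨fun e => by rw [e, hx], fun e => φ.injective (e.trans hx.symm)⟩)
    (fun u => ⟨fun e => by rw [e, hx'], fun e => σ.injective (e.trans hx'.symm)⟩)
  exact ((ht h).1 rfl).symm

/-- The Gauss–Bonnet inequality for one component of a planar map, with an arbitrary
weight `q` moved between nodes and faces. -/
theorem Planar.gauss_bonnet {φ σ : Perm D} (h : Planar φ σ) (x₀ : D) (q : D → ℚ)
    (O : Finset D) (hO : ∀ x, x ∈ O ↔ comp φ σ x₀ x) :
    4 ≤ ∑ x ∈ O, (2 / ((cyc φ x).length : ℚ) + - q x) +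
      ∑ x ∈ O, (2 / ((cyc σ x).length : ℚ) + -1) +
      ∑ x ∈ O, (2 / ((cyc (σ⁻¹ * φ) x).length : ℚ) + (q x - 1)) := by
  obtain ⟨φ', σ', hp, h1, h2⟩ := exists_planar_isolated x₀ h
  have closed : ∀ {x y}, comp φ σ x y → comp φ σ x₀ x → comp φ σ x₀ y :=
    fun h h' => (comp φ σ).trans h' h
  have cφ : ∀ x ∈ O, cyc φ' x = cyc φ x := fun x hx => cyc_congr fun y hy =>
    (h1 y (closed (comp_of_left hy) ((hO x).1 hx))).1
  have cσ : ∀ x ∈ O, cyc σ' x = cyc σ x := fun x hx => cyc_congr fun y hy =>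
    (h1 y (closed (comp_of_right hy) ((hO x).1 hx))).2
  have cτ : ∀ x ∈ O, cyc (σ'⁻¹ * φ') x = cyc (σ⁻¹ * φ) x := fun x hx => cyc_congr fun y hy => by
    have hy' := closed (orb_face_le φ σ hy) ((hO x).1 hx)
    rw [Perm.mul_apply, Perm.mul_apply, (h1 y hy').1, Perm.inv_eq_iff_eq, (h1 _ _).2]
    · rw [perm_apply_inv]
    · have e1 := closed (comp_apply_left φ σ y) hy'
      refine closed ((comp φ σ).symm ?_) e1
      simpa using comp_apply_right φ σ (σ⁻¹ (φ y))
  have nτ : ∀ x ∉ O, (σ'⁻¹ * φ') x = x := by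
    intro x hx
    rw [hO] at hx
    rw [Perm.mul_apply, (h2 x hx).1, Perm.inv_eq_iff_eq, (h2 x hx).2]
  have hcomp : 1 + Oᶜ.card ≤ cnt (comp φ' σ') := by
    have e : Function.Injective (fun z : Option {x // x ∈ Oᶜ} =>
        (z.elim (Quotient.mk (comp φ' σ') x₀) fun x => Quotient.mk (comp φ' σ') x.1)) := by
      have key : ∀ x, x ∉ O → ∀ y, comp φ' σ' x y → x = y := fun x hx y h =>
        sameCycle_of_comp_apply h (h2 x (fun h => hx ((hO x).2 h))).1
          (h2 x (fun h => hx ((hO x).2 h))).2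
      have hx₀ : x₀ ∈ O := (hO _).2 ((comp φ σ).refl _)
      rintro (_ | ⟨x, hx⟩) (_ | ⟨y, hy⟩) hxy
      · rfl
      · have := key y (by simpa using hy) x₀ (Quotient.exact hxy.symm)
        subst this
        simp [hx₀] at hy
      · have := key x (by simpa using hx) x₀ (Quotient.exact hxy)
        subst this
        simp [hx₀] at hx
      · have := key x (by simpa using hx) y (Quotient.exact hxy)
        subst this
        rfl
    have := Nat.card_le_card_of_injective _ e
    rw [Nat.card_eq_fintype_card, Fintype.card_option, Fintype.card_coe, add_comm] at this
    exact this
  have hp' : (Fintype.card D + 2 * (1 + Oᶜ.card) : ℚ) ≤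
      ((cnt (orb φ') : ℚ) + cnt (orb σ') + cnt (orb (σ'⁻¹ * φ'))) := by
    have := hp
    rw [Planar, Nat.card_eq_fintype_card] at this
    have h' : Fintype.card D + 2 * (1 + Oᶜ.card) ≤
      cnt (orb φ') + cnt (orb σ') + cnt (orb (σ'⁻¹ * φ')) := by omega
    exact_mod_cast h'
  have split : ∀ f f' : Perm D, (∀ x ∈ O, cyc f' x = cyc f x) → (∀ x ∉ O, f' x = x) →
      (cnt (orb f') : ℚ) = ∑ x ∈ O, 1 / ((cyc f x).length : ℚ) + Oᶜ.card := by
    intro f f' e1 e2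
    rw [cnt_orb_eq, ← Finset.sum_add_sum_compl O]
    congr 1
    · exact Finset.sum_congr rfl fun x hx => by rw [e1 x hx]
    · rw [Finset.sum_congr rfl (g := fun _ => (1 : ℚ)), Finset.sum_const, nsmul_one]
      intro x hx
      rw [cyc_eq_singleton (e2 x (by simpa using hx))]
      simp
  rw [split φ φ' cφ fun x hx => (h2 x fun h => hx ((hO x).2 h)).1,
    split σ σ' cσ fun x hx => (h2 x fun h => hx ((hO x).2 h)).2,
    split _ _ cτ nτ, ← Finset.card_add_card_compl O] at hp'
  push_cast at hp'
  have e2 : ∀ f : Perm D, ∑ x ∈ O, 2 / ((cyc f x).length : ℚ) =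
      2 * ∑ x ∈ O, 1 / ((cyc f x).length : ℚ) := by
    intro f
    rw [Finset.mul_sum]
    exact Finset.sum_congr rfl fun x _ => by ring
  simp only [Finset.sum_add_distrib, e2, Finset.sum_neg_distrib, Finset.sum_sub_distrib,
    Finset.sum_const, nsmul_eq_mul, mul_one]
  linarith
end Curvature

section Diagrams

open Equiv

/-- Vertex subgroups `H i` and edge subgroups `K i j` of a group, with weights `q i j`
(angles divided by `π`) bounding the length of the relations in `K i j`. -/
structure Sys (F : Type*) [Group F] where
  H : Fin 4 → Subgroup F
  K : Fin 4 → Fin 4 → Subgroup F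
  q : Fin 4 → Fin 4 → ℚ
  normal : ∀ i j, (K i j).Normal
  symm : ∀ i j, K i j = K j i
  inf : ∀ i j, i ≠ j → ∀ x ∈ H i, x ∈ K i j → x = 1
  q_symm : ∀ i j, q i j = q j i
  q_self : ∀ i, q i i = 0
  q_le : ∀ i j, q i j ≤ 1 / 2
  q_tri : ∀ i j k, i ≠ j → j ≠ k → i ≠ k → q i j + q j k + q k i = 1
  length : ∀ i j, i ≠ j → ∀ l : List (Fin 4 × F), l ≠ [] →
    (∀ x ∈ l, (x.1 = i ∨ x.1 = j) ∧ x.2 ∈ H x.1 ∧ x.2 ≠ 1) →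
    (l.map Prod.fst).IsChain (· ≠ ·) → (l.map Prod.snd).prod ∈ K i j → 2 ≤ l.length * q i j

variable {F : Type*} [Group F] {D : Type*} [Fintype D] [DecidableEq D]

/-- The product of the labels along the cycle of `f` through `d`. -/
noncomputable def word (v : D → F) (f : Perm D) (d : D) : F := ((cyc f d).map v).prod

theorem word_mem_iff (N : Subgroup F) [hN : N.Normal] (v : D → F) {f : Perm D} {a b : D}
    (h : f.SameCycle a b) : word v f a ∈ N ↔ word v f b ∈ N := by
  by_cases hab : a = b
  · rw [hab]
  obtain ⟨P, Q, h1, h2⟩ := exists_cyc_eq_append hab h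
  rw [word, word, h1, h2, List.map_append, List.map_append, List.prod_append, List.prod_append]
  exact hN.mem_comm_iff

theorem word_eq_one_iff (v : D → F) {f : Perm D} {a b : D} (h : f.SameCycle a b) :
    word v f a = 1 ↔ word v f b = 1 := by
  simpa using word_mem_iff (⊥ : Subgroup F) v h

theorem word_congr {v w : D → F} {f g : Perm D} {d : D} (hc : cyc g d = cyc f d)
    (hv : ∀ x, f.SameCycle d x → w x = v x) : word w g d = word v f d := by
  rw [word, word, hc]
  exact congrArg _ (List.map_congr_left fun x hx => hv x (mem_cyc.1 hx))

theorem word_split (v : D → F) {f : Perm D} {a b : D} (hab : a ≠ b) (h : f.SameCycle a b) :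
    word v f a = word v (swap a b * f) a * word v (swap a b * f) b := by
  obtain ⟨P, Q, h1, -, h3, h4⟩ := split_spec hab h
  rw [word, word, word, h1, h3, h4, List.map_append, List.prod_append]

theorem word_merge (v : D → F) {f : Perm D} {a b : D} (h : ¬ f.SameCycle a b) :
    word v (swap a b * f) a = word v f a * word v f b := by
  rw [word, word, word, merge_spec h, List.map_append, List.prod_append]

theorem word_of_fixed (v : D → F) {f : Perm D} {a : D} (h : f a = a) : word v f a = v a := by
  simp [word, cyc_eq_singleton h]

theorem isolate_apply (f : Perm D) (a : D) : (swap a (f a) * f) a = a := by simp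

theorem sameCycle_apply (f : Perm D) (a : D) : f.SameCycle a (f a) :=
  Perm.sameCycle_apply_right.2 (Perm.SameCycle.refl _ _)

theorem word_isolate (v : D → F) {f : Perm D} {a : D} (h : f a ≠ a) :
    word v f a = v a * word v (swap a (f a) * f) (f a) := by
  rw [word_split v h.symm (sameCycle_apply f a), word_of_fixed v (isolate_apply f a)]

theorem sameCycle_of_isolate {f : Perm D} {a x y : D}
    (h : (swap a (f a) * f).SameCycle x y) : f.SameCycle x y := by
  by_cases ha : f a = a
  · rwa [ha, swap_self, ← Perm.one_def, one_mul] at h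
  · have := orb_split (Ne.symm ha) (sameCycle_apply f a)
    rw [← orb_apply, this]
    exact Or.inl h

theorem eq_of_sameCycle_fixed {f : Perm D} {a x : D} (ha : f a = a) (h : f.SameCycle a x) :
    a = x := by
  rw [← mem_cyc, cyc_eq_singleton ha] at h
  exact (List.mem_singleton.1 h).symm

theorem isolate_sameCycle {f : Perm D} {a x y : D} (h : f.SameCycle x y) (hx : x ≠ a)
    (hy : y ≠ a) : (swap a (f a) * f).SameCycle x y := by
  by_cases ha : f a = a
  · rwa [ha, swap_self, ← Perm.one_def, one_mul]
  · have e := orb_split (Ne.symm ha) (sameCycle_apply f a)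
    rw [← orb_apply, e] at h
    rcases h with h | ⟨h, -⟩ | ⟨-, h⟩
    · exact h
    · exact absurd (eq_of_sameCycle_fixed (isolate_apply f a) h.symm).symm hx
    · exact absurd (eq_of_sameCycle_fixed (isolate_apply f a) h).symm hy

theorem cyc_isolate_of_not {f : Perm D} {a x : D} (h : ¬ f.SameCycle x a) :
    cyc (swap a (f a) * f) x = cyc f x :=
  cyc_swap_mul_of_not h fun h' => h (Perm.sameCycle_apply_right.1 h')

/-- A labelled planar map: `D` is the set of letters, the cycles of `φ` are the nodes
(relations), the cycles of `σ` are the vertices (relations of the vertex groups). -/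
structure Diag (S : Sys F) (ty : D → Fin 4) where
  φ : Perm D
  σ : Perm D
  val : D → F
  planar : Planar φ σ
  ty_σ : ∀ d, ty (σ d) = ty d
  mem : ∀ d, val d ∈ S.H (ty d)
  vert : ∀ d, word val σ d = 1

variable {S : Sys F} {ty : D → Fin 4}

namespace Diag

/-- All letters of the node of `d` have type `i` or `j`. -/
def Typed (M : Diag S ty) (d : D) (i j : Fin 4) : Prop :=
  ∀ x, M.φ.SameCycle d x → ty x = i ∨ ty x = j

/-- The node of `d` reads an element of `K i j`. -/
def Good (M : Diag S ty) (d : D) (i j : Fin 4) : Prop := word M.val M.φ d ∈ S.K i j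

/-- The node of `d` reads a relation of an edge group. -/
def NodeGood (M : Diag S ty) (d : D) : Prop := ∃ i j, i ≠ j ∧ M.Typed d i j ∧ M.Good d i j

/-- All nodes in the component of `d₀`, except possibly that of `d₀` itself, are good. -/
def BadFree (M : Diag S ty) (d₀ : D) : Prop :=
  ∀ d, comp M.φ M.σ d₀ d → ¬ M.φ.SameCycle d₀ d → M.NodeGood d

/-- The number of letters in the component of `d₀`. -/
noncomputable def size (M : Diag S ty) (d₀ : D) : ℕ := {x | comp M.φ M.σ d₀ x}.ncard

theorem size_lt {M M' : Diag S ty} {d₀ d₁ x : D} (hle : comp M'.φ M'.σ ≤ comp M.φ M.σ)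
    (h1 : comp M.φ M.σ d₀ d₁) (hx : comp M.φ M.σ d₀ x) (hx' : ¬ comp M'.φ M'.σ d₁ x) :
    M'.size d₁ < M.size d₀ := by
  apply Set.ncard_lt_ncard _ (Set.toFinite _)
  refine ⟨fun y hy => ?_, fun h => hx' (h hx)⟩
  exact (comp M.φ M.σ).trans h1 (hle hy)

theorem typed_congr {M : Diag S ty} {d d' : D} {i j : Fin 4} (h : M.φ.SameCycle d d') :
    M.Typed d i j ↔ M.Typed d' i j :=
  ⟨fun hT x hx => hT x (h.trans hx), fun hT x hx => hT x (h.symm.trans hx)⟩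

theorem good_congr {M : Diag S ty} {d d' : D} {i j : Fin 4} (h : M.φ.SameCycle d d') :
    M.Good d i j ↔ M.Good d' i j := by
  have := S.normal i j
  exact word_mem_iff _ _ h

theorem nodeGood_congr {M : Diag S ty} {d d' : D} (h : M.φ.SameCycle d d') :
    M.NodeGood d ↔ M.NodeGood d' := by
  simp only [NodeGood, typed_congr h, good_congr h]

theorem typed_of_eq {M M' : Diag S ty} {d : D} {i j : Fin 4} (hc : cyc M'.φ d = cyc M.φ d)
    (h : M.Typed d i j) : M'.Typed d i j := by
  intro x hx
  rw [← mem_cyc, hc, mem_cyc] at hx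
  exact h x hx

theorem nodeGood_of_eq {M M' : Diag S ty} {d : D} (hc : cyc M'.φ d = cyc M.φ d)
    (hv : ∀ x, M.φ.SameCycle d x → M'.val x = M.val x) (h : M.NodeGood d) : M'.NodeGood d := by
  obtain ⟨i, j, hij, hT, hG⟩ := h
  refine ⟨i, j, hij, typed_of_eq hc hT, ?_⟩
  rw [Good, word_congr hc hv]
  exact hG

/-- The inductive hypothesis: in components of fewer than `n` letters, a typed node is good
as soon as all others are. -/
def Hyp (S : Sys F) (ty : D → Fin 4) (n : ℕ) : Prop :=
  ∀ (M : Diag S ty) (d₀ : D) (i j : Fin 4), M.size d₀ < n → i ≠ j → M.BadFree d₀ →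
    M.Typed d₀ i j → M.Good d₀ i j

/-- There is a smaller diagram with the same special node. -/
def Smaller (M : Diag S ty) (d₀ : D) : Prop :=
  ∃ M' : Diag S ty, M'.size d₀ < M.size d₀ ∧ M'.BadFree d₀ ∧ cyc M'.φ d₀ = cyc M.φ d₀ ∧
    ∀ x, M.φ.SameCycle d₀ x → M'.val x = M.val x

/-- What a reduction at `l` achieves. -/
def Reduces (M : Diag S ty) (d₀ l : D) : Prop :=
  (¬ M.φ.SameCycle d₀ l → M.Smaller d₀) ∧
    (M.φ.SameCycle d₀ l → ∀ i j, i ≠ j → M.Typed d₀ i j → M.Good d₀ i j)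

theorem Smaller.good {M : Diag S ty} {d₀ : D} (h : M.Smaller d₀) (hyp : Hyp S ty (M.size d₀))
    {i j : Fin 4} (hij : i ≠ j) (hT : M.Typed d₀ i j) : M.Good d₀ i j := by
  obtain ⟨M', h1, h2, h3, h4⟩ := h
  have := hyp M' d₀ i j h1 hij h2 (typed_of_eq h3 hT)
  rwa [Good, word_congr h3 h4] at this

theorem Smaller.reduces {M : Diag S ty} {d₀ : D} (h : M.Smaller d₀)
    (hyp : Hyp S ty (M.size d₀)) (l : D) : M.Reduces d₀ l :=
  ⟨fun _ => h, fun _ _ _ hij hT => h.good hyp hij hT⟩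

/-- Deleting a letter with trivial label. -/
noncomputable def erase (M : Diag S ty) (l : D) (hl : M.val l = 1) : Diag S ty where
  φ := swap l (M.φ l) * M.φ
  σ := swap l (M.σ l) * M.σ
  val := M.val
  planar := ((M.planar.isolate l).symm.isolate l).symm
  ty_σ d := by
    rw [Perm.mul_apply, swap_apply_def]
    split_ifs with h1 h2
    · rw [M.ty_σ, ← M.ty_σ d, h1]
    · rw [M.σ.injective h2]
    · exact M.ty_σ d
  mem := M.mem
  vert d := by
    by_cases hd : d = l
    · rw [hd, word_of_fixed _ (isolate_apply _ _), hl]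
    by_cases h : M.σ.SameCycle d l
    · by_cases hf : M.σ l = l
      · exact absurd (eq_of_sameCycle_fixed hf h.symm).symm hd
      · have e := M.vert l
        rw [word_isolate _ hf, hl, one_mul] at e
        rw [← e, e]
        rw [← word_eq_one_iff _ (isolate_sameCycle (f := M.σ) (a := l) _ hf hd)]
        · exact e
        · exact (h.trans (sameCycle_apply _ _)).symm
    · rw [word_congr (cyc_isolate_of_not h) fun _ _ => rfl]
      exact M.vert d

theorem comp_erase_le (M : Diag S ty) (l : D) (hl : M.val l = 1) :
    comp (M.erase l hl).φ (M.erase l hl).σ ≤ comp M.φ M.σ :=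
  sup_le (fun _ _ h => comp_of_left (sameCycle_of_isolate h))
    (fun _ _ h => comp_of_right (sameCycle_of_isolate h))

theorem eq_of_comp_erase {M : Diag S ty} {l : D} {hl : M.val l = 1} {x : D}
    (h : comp (M.erase l hl).φ (M.erase l hl).σ l x) : l = x :=
  sameCycle_of_comp_apply h (isolate_apply _ _) (isolate_apply _ _)

theorem good_of_erase {M : Diag S ty} {l : D} {hl : M.val l = 1} {d : D} (hd : d ≠ l)
    {i j : Fin 4} : (M.erase l hl).Good d i j ↔ M.Good d i j := by
  by_cases h : M.φ.SameCycle d l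
  · have hf : M.φ l ≠ l := fun hf => hd (eq_of_sameCycle_fixed hf h.symm).symm
    have h' : (M.erase l hl).φ.SameCycle d (M.φ l) :=
      isolate_sameCycle (h.trans (sameCycle_apply _ _)) hd hf
    rw [good_congr h', good_congr h, Good, Good, word_isolate _ hf, hl, one_mul]
    rfl
  · rw [Good, Good, word_congr (v := M.val) (f := M.φ)]
    · exact cyc_isolate_of_not h
    · exact fun _ _ => rfl

theorem typed_erase {M : Diag S ty} {l : D} {hl : M.val l = 1} {d : D} {i j : Fin 4}
    (h : M.Typed d i j) : (M.erase l hl).Typed d i j :=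
  fun x hx => h x (sameCycle_of_isolate hx)

theorem badFree_erase {M : Diag S ty} {l : D} {hl : M.val l = 1} {d₀ d₁ : D}
    (h : M.BadFree d₀) (h1 : d₁ ≠ l) (h01 : M.φ.SameCycle d₀ d₁) :
    (M.erase l hl).BadFree d₁ := by
  intro d hd hnd
  have hdl : d ≠ l := by
    rintro rfl
    exact h1 (eq_of_comp_erase ((comp _ _).symm hd)).symm
  have hns : ¬ M.φ.SameCycle d₀ d := fun hs =>
    hnd (isolate_sameCycle (h01.symm.trans hs) h1 hdl)
  obtain ⟨i, j, hij, hT, hG⟩ :=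
    h d ((comp _ _).trans (comp_of_left h01) (comp_erase_le M l hl hd)) hns
  exact ⟨i, j, hij, typed_erase hT, (good_of_erase hdl).2 hG⟩

theorem reduces_of_val_eq_one {M : Diag S ty} {d₀ l : D} (hyp : Hyp S ty (M.size d₀))
    (hB : M.BadFree d₀) (hl : M.val l = 1) (hc : comp M.φ M.σ d₀ l) : M.Reduces d₀ l := by
  constructor
  · intro hn
    have hne : d₀ ≠ l := by rintro rfl; exact hn (Perm.SameCycle.refl _ _)
    refine ⟨M.erase l hl, ?_, badFree_erase hB hne (Perm.SameCycle.refl _ _),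
      cyc_isolate_of_not hn, fun _ _ => rfl⟩
    exact size_lt (comp_erase_le M l hl) ((comp _ _).refl _) hc
      fun h => hne (eq_of_comp_erase ((comp _ _).symm h)).symm
  · intro hs i j hij hT
    rw [good_congr hs]
    by_cases hf : M.φ l = l
    · rw [Good, word_of_fixed _ hf, hl]
      exact one_mem _
    · rw [good_congr (sameCycle_apply _ l), ← good_of_erase (hl := hl) hf]
      have hs' := hs.trans (sameCycle_apply M.φ l)
      refine hyp _ _ _ _ ?_ hij (badFree_erase hB hf hs')
        (typed_erase ((typed_congr hs').1 hT))
      exact size_lt (comp_erase_le M l hl) (comp_of_left hs') hc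
        fun h => hf (eq_of_comp_erase ((comp _ _).symm h)).symm

end Diag
end Diagrams

section Reductions

open Equiv

variable {F : Type*} [Group F] {D : Type*} [Fintype D] [DecidableEq D]

theorem cyc_eq_cons_cons {f : Perm D} {l : D} (h : f l ≠ l) :
    ∃ Q, cyc f l = l :: f l :: Q ∧ l ∉ Q ∧ f l ∉ Q := by
  obtain ⟨A, hA⟩ := exists_cyc_eq_cons f l
  have hc : IsCyc f (l :: A) := hA ▸ isCyc_cyc f l
  rw [isCyc_cons] at hc
  obtain ⟨hn, hm⟩ := hc
  cases A with
  | nil => simp at hm; exact absurd hm h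
  | cons b Q =>
    simp only [List.map_cons, List.cons_append, List.cons.injEq] at hm
    rw [hm.1]
    refine ⟨Q, hA, ?_, ?_⟩ <;> simp_all

/-- Moving the label of `f l` to `l`. -/
def shift (v : D → F) (l l' : D) : D → F :=
  Function.update (Function.update v l (v l * v l')) l' 1

theorem shift_of_ne {v : D → F} {l l' x : D} (h : x ≠ l) (h' : x ≠ l') : shift v l l' x = v x := by
  simp [shift, h, h']

theorem word_shift (v : D → F) {f : Perm D} {l : D} (h : f l ≠ l) (d : D) :
    (f.SameCycle d l → ∀ (N : Subgroup F) [N.Normal],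
      word (shift v l (f l)) f d ∈ N ↔ word v f d ∈ N) ∧
    (¬ f.SameCycle d l → word (shift v l (f l)) f d = word v f d) := by
  constructor
  · intro hd N _
    have : word (shift v l (f l)) f l = word v f l := by
      obtain ⟨Q, hQ, h1, h2⟩ := cyc_eq_cons_cons h
      have e : Q.map (shift v l (f l)) = Q.map v := List.map_congr_left fun x hx =>
        shift_of_ne (by rintro rfl; exact h1 hx) (by rintro rfl; exact h2 hx)
      rw [word, word, hQ]
      have e1 : shift v l (f l) l = v l * v (f l) := by
        rw [shift, Function.update_of_ne h.symm, Function.update_self]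
      have e2 : shift v l (f l) (f l) = 1 := Function.update_self ..
      simp only [List.map_cons, List.prod_cons, e, e1, e2, one_mul, mul_assoc]
    rw [word_mem_iff N _ hd, this, word_mem_iff N _ hd]
  · intro hd
    refine word_congr rfl fun x hx => shift_of_ne ?_ ?_
    · rintro rfl; exact hd hx
    · rintro rfl; exact hd (Perm.sameCycle_apply_right.1 hx)

variable {S : Sys F} {ty : D → Fin 4}

namespace Diag

/-- Fusing two letters that are consecutive both at their node and at their vertex. -/
noncomputable def fuse (M : Diag S ty) (l : D) (h : M.φ l = M.σ l) (hne : M.φ l ≠ l) :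
    Diag S ty where
  φ := M.φ
  σ := M.σ
  val := shift M.val l (M.φ l)
  planar := M.planar
  ty_σ := M.ty_σ
  mem d := by
    by_cases h1 : d = M.φ l
    · subst h1; simp only [shift, Function.update_self]; exact one_mem _
    by_cases h2 : d = l
    · subst h2
      simp only [shift, Function.update_of_ne h1, Function.update_self]
      refine mul_mem (M.mem _) ?_
      have := M.mem (M.φ d)
      rwa [h, M.ty_σ, ← h] at this
    · rw [shift_of_ne h2 h1]; exact M.mem d
  vert d := by
    have := word_shift M.val (h ▸ hne : M.σ l ≠ l) d
    rw [← h] at this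
    by_cases hd : M.σ.SameCycle d l
    · have := (this.1 hd ⊥)
      rw [Subgroup.mem_bot, Subgroup.mem_bot] at this
      exact this.2 (M.vert d)
    · rw [this.2 hd]; exact M.vert d

theorem fuse_good {M : Diag S ty} {l : D} {h : M.φ l = M.σ l} {hne : M.φ l ≠ l} {d : D}
    {i j : Fin 4} : (M.fuse l h hne).Good d i j ↔ M.Good d i j := by
  have := S.normal i j
  by_cases hd : M.φ.SameCycle d l
  · exact (word_shift M.val hne d).1 hd _
  · rw [Good, Good, ← (word_shift M.val hne d).2 hd]
    rfl

theorem reduces_of_fuse {M : Diag S ty} {d₀ l : D} (hyp : Hyp S ty (M.size d₀))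
    (hB : M.BadFree d₀) (h : M.φ l = M.σ l) (hne : M.φ l ≠ l) (hc : comp M.φ M.σ d₀ l) :
    M.Reduces d₀ l := by
  have hB' : (M.fuse l h hne).BadFree d₀ := by
    intro d hd hnd
    obtain ⟨i, j, hij, hT, hG⟩ := hB d hd hnd
    exact ⟨i, j, hij, hT, fuse_good.2 hG⟩
  have key := reduces_of_val_eq_one (M := M.fuse l h hne) (l := M.φ l) hyp hB'
    (by simp [fuse, shift]) ((comp _ _).trans hc (comp_apply_left _ _ _))
  constructor
  · intro hn
    obtain ⟨M', h1, h2, h3, h4⟩ := key.1 fun h' => hn (Perm.sameCycle_apply_right.1 h')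
    refine ⟨M', h1, h2, h3, fun x hx => ?_⟩
    rw [h4 x hx]
    refine shift_of_ne ?_ ?_
    · rintro rfl; exact hn hx
    · rintro rfl; exact hn (Perm.sameCycle_apply_right.1 hx)
  · intro hs i j hij hT
    exact fuse_good.1 (key.2 (Perm.sameCycle_apply_right.2 hs) i j hij hT)

theorem typed_self {M : Diag S ty} {d : D} {i j : Fin 4} (h : M.Typed d i j) :
    ty d = i ∨ ty d = j := h d (Perm.SameCycle.refl _ _)

theorem eq_one_of_mem {i j k : Fin 4} (hij : i ≠ j) (hk : k = i ∨ k = j) {x : F}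
    (hx : x ∈ S.H k) (hx' : x ∈ S.K i j) : x = 1 := by
  rcases hk with rfl | rfl
  · exact S.inf _ _ hij x hx hx'
  · exact S.inf _ _ hij.symm x hx (S.symm _ _ ▸ hx')

theorem ty_eq_of_sameCycle (M : Diag S ty) {x y : D} (h : M.σ.SameCycle x y) : ty x = ty y := by
  let t : Setoid D := Setoid.ker ty
  have : orb M.σ ≤ t := orb_le fun x => (M.ty_σ x).symm
  exact this h

theorem list_prod_mem {N : Subgroup F} {v : D → F} {l : List D} (h : ∀ x ∈ l, v x ∈ N) :
    (l.map v).prod ∈ N :=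
  Subgroup.list_prod_mem _ (by simpa using h)

/-- Multiplying the labels of `a` and `b` on the left. -/
def relabel (v : D → F) (a b : D) (g h : F) : D → F :=
  Function.update (Function.update v a (g * v a)) b (h * v b)

theorem word_relabel_left {v : D → F} {f : Perm D} {a b : D} {g h : F} (hab : ¬ f.SameCycle a b) :
    word (relabel v a b g h) f a = g * word v f a := by
  obtain ⟨A, hA⟩ := exists_cyc_eq_cons f a
  have hn := (isCyc_cyc f a).1
  rw [← mem_cyc, hA] at hab
  rw [hA] at hn
  simp only [List.nodup_cons, List.mem_cons, not_or] at hn hab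
  have e : A.map (relabel v a b g h) = A.map v := List.map_congr_left fun x hx => by
    rw [relabel, Function.update_of_ne, Function.update_of_ne]
    · rintro rfl; exact hn.1 hx
    · rintro rfl; exact hab.2 hx
  rw [word, word, hA]
  have e1 : relabel v a b g h a = g * v a := by
    rw [relabel, Function.update_of_ne (Ne.symm hab.1), Function.update_self]
  simp only [List.map_cons, List.prod_cons, e, e1, mul_assoc]

theorem word_relabel_right {v : D → F} {f : Perm D} {a b : D} {g h : F}
    (hab : ¬ f.SameCycle a b) : word (relabel v a b g h) f b = h * word v f b := by
  have hne : a ≠ b := by rintro rfl; exact hab (Perm.SameCycle.refl _ _)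
  have : relabel v a b g h = relabel v b a h g := by
    unfold relabel
    rw [Function.update_comm hne.symm]
  rw [this, word_relabel_left fun h => hab h.symm]

theorem word_relabel_of_not {v : D → F} {f : Perm D} {a b d : D} {g h : F}
    (ha : ¬ f.SameCycle d a) (hb : ¬ f.SameCycle d b) :
    word (relabel v a b g h) f d = word v f d := by
  refine word_congr rfl fun x hx => ?_
  rw [relabel, Function.update_of_ne, Function.update_of_ne]
  · rintro rfl; exact ha hx
  · rintro rfl; exact hb hx

theorem comp_pinch {φ σ : Perm D} {a b : D} (hab : a ≠ b) (hs : σ.SameCycle a b) :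
    comp φ σ = glue (comp φ (swap a b * σ)) a b := by
  rw [comp_comm, comp_split hab hs, comp_comm]

theorem word_split_left {f : Perm D} {a b d : D} (hab : a ≠ b)
    (hs : f.SameCycle a b) (hd : f.SameCycle d a) :
    (swap a b * f).SameCycle d a ∨ (swap a b * f).SameCycle d b := by
  rw [← orb_apply, orb_split hab hs] at hd
  rcases hd with hd | ⟨hd, -⟩ | ⟨hd, -⟩
  · exact Or.inl hd
  · exact Or.inl hd
  · exact Or.inr hd

theorem sameCycle_of_split {f : Perm D} {a b x y : D} (hab : a ≠ b) (hs : f.SameCycle a b)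
    (h : (swap a b * f).SameCycle x y) : f.SameCycle x y := by
  rw [← orb_apply, orb_split hab hs]
  exact Or.inl h

theorem smaller_of_pinch_aux {M : Diag S ty} {d₀ a b : D} (hyp : Hyp S ty (M.size d₀))
    (hB : M.BadFree d₀) (hab : a ≠ b) (hs : M.σ.SameCycle a b)
    (hn : ¬ comp M.φ (swap a b * M.σ) a b) (hc : comp M.φ (swap a b * M.σ) d₀ a) :
    M.Smaller d₀ := by
  have hcomp := comp_pinch (φ := M.φ) hab hs
  have hle : comp M.φ (swap a b * M.σ) ≤ comp M.φ M.σ := by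
    rw [hcomp]; exact (glue_le.1 le_rfl).1
  have hn' := not_sameCycle_split hab hs
  have hp : Planar M.φ (swap a b * M.σ) := (M.planar.symm.split hab hs).1.symm
  have hty : ∀ d, ty ((swap a b * M.σ) d) = ty d := by
    intro d
    rw [← M.ty_eq_of_sameCycle (sameCycle_of_split hab hs (sameCycle_apply (swap a b * M.σ) d))]
  have hdb : ¬ comp M.φ (swap a b * M.σ) d₀ b := fun h =>
    hn ((comp _ _).trans ((comp _ _).symm hc) h)
  have hcb : comp M.φ M.σ d₀ b := (comp _ _).trans (hle hc) (comp_of_right hs)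
  have hwmem : ∀ d, word M.val (swap a b * M.σ) d ∈ S.H (ty d) := by
    intro d
    refine list_prod_mem fun x hx => ?_
    rw [M.ty_eq_of_sameCycle (sameCycle_of_split hab hs (mem_cyc.1 hx))]
    exact M.mem x
  have hprod := word_split M.val hab hs
  rw [M.vert a] at hprod
  let M₁ : Diag S ty :=
    { φ := M.φ
      σ := swap a b * M.σ
      val := relabel M.val a b (word M.val (swap a b * M.σ) a)⁻¹
        (word M.val (swap a b * M.σ) b)⁻¹
      planar := hp
      ty_σ := hty
      mem := by
        intro d
        by_cases h1 : d = b
        · subst h1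
          simp only [relabel, Function.update_self]
          exact mul_mem (inv_mem (hwmem _)) (M.mem _)
        by_cases h2 : d = a
        · subst h2
          simp only [relabel, Function.update_self, Function.update_of_ne h1]
          exact mul_mem (inv_mem (hwmem _)) (M.mem _)
        · simp only [relabel, Function.update_of_ne h1, Function.update_of_ne h2]
          exact M.mem d
      vert := by
        intro d
        by_cases h1 : (swap a b * M.σ).SameCycle d a
        · rw [word_eq_one_iff _ h1, word_relabel_left hn', inv_mul_cancel]
        by_cases h2 : (swap a b * M.σ).SameCycle d b
        · rw [word_eq_one_iff _ h2, word_relabel_right hn', inv_mul_cancel]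
        · rw [word_relabel_of_not h1 h2]
          have h1' : ¬ M.σ.SameCycle d a := fun h => by
            rcases word_split_left hab hs h with h | h
            · exact h1 h
            · exact h2 h
          rw [word_congr (cyc_swap_mul_of_not h1' fun h => h1' (h.trans hs.symm)) fun _ _ => rfl]
          exact M.vert d }
  obtain ⟨i, j, hij, hT, hG⟩ := hB b hcb fun h => hdb (comp_of_left h)
  have hnab : ¬ M.φ.SameCycle a b := fun h => hn (comp_of_left h)
  have hB₁ : M₁.BadFree b := by
    intro d hd hnd
    have hda : ¬ M.φ.SameCycle d a := fun h =>
      hn ((comp _ _).symm ((comp _ _).trans hd (comp_of_left h)))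
    obtain ⟨i, j, hij, hT, hG⟩ := hB d ((comp _ _).trans hcb (hle hd)) fun h =>
      hdb ((comp _ _).trans (comp_of_left h) ((comp _ _).symm hd))
    refine ⟨i, j, hij, hT, ?_⟩
    have : word M₁.val M₁.φ d = word M.val M.φ d :=
      word_relabel_of_not hda fun h => hnd h.symm
    rw [Good, this]
    exact hG
  have hG₁ := hyp M₁ b i j (size_lt hle hcb ((comp _ _).refl _) fun h => hdb ((comp _ _).symm h))
    hij hB₁ hT
  have e : word M₁.val M₁.φ b = (word M.val (swap a b * M.σ) b)⁻¹ * word M.val M.φ b :=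
    word_relabel_right hnab
  rw [Good, e] at hG₁
  rw [Good] at hG
  have hb1 : word M.val (swap a b * M.σ) b = 1 := by
    refine eq_one_of_mem hij (typed_self hT) (hwmem b) ?_
    have := mul_mem hG₁ (inv_mem hG)
    rw [mul_inv_cancel_right] at this
    exact inv_mem_iff.1 this
  have ha1 : word M.val (swap a b * M.σ) a = 1 := by
    rw [hb1, mul_one] at hprod
    exact hprod.symm
  let M₂ : Diag S ty :=
    { φ := M.φ
      σ := swap a b * M.σ
      val := M.val
      planar := hp
      ty_σ := hty
      mem := M.mem
      vert := by
        intro d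
        by_cases h1 : (swap a b * M.σ).SameCycle d a
        · rw [word_eq_one_iff _ h1, ha1]
        by_cases h2 : (swap a b * M.σ).SameCycle d b
        · rw [word_eq_one_iff _ h2, hb1]
        · have h1' : ¬ M.σ.SameCycle d a := fun h => by
            rcases word_split_left hab hs h with h | h
            · exact h1 h
            · exact h2 h
          rw [word_congr (cyc_swap_mul_of_not h1' fun h => h1' (h.trans hs.symm)) fun _ _ => rfl]
          exact M.vert d }
  refine ⟨M₂, size_lt hle ((comp _ _).refl _) hcb hdb, ?_, rfl, fun _ _ => rfl⟩
  intro d hd hnd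
  exact hB d (hle hd) hnd

/-- A vertex at which two parts of the diagram are pinched can be cut. -/
theorem smaller_of_pinch {M : Diag S ty} {d₀ a b : D} (hyp : Hyp S ty (M.size d₀))
    (hB : M.BadFree d₀) (hab : a ≠ b) (hs : M.σ.SameCycle a b)
    (hn : ¬ comp M.φ (swap a b * M.σ) a b) (hc : comp M.φ M.σ d₀ a) : M.Smaller d₀ := by
  rw [comp_pinch hab hs] at hc
  rcases hc with hc | ⟨hc, -⟩ | ⟨hc, -⟩
  · exact smaller_of_pinch_aux hyp hB hab hs hn hc
  · exact smaller_of_pinch_aux hyp hB hab hs hn hc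
  · rw [swap_comm] at hn hc
    exact smaller_of_pinch_aux hyp hB hab.symm hs.symm (fun h => hn ((comp _ _).symm h)) hc

theorem reduces_of_ty_eq {M : Diag S ty} {d₀ l : D} (hyp : Hyp S ty (M.size d₀))
    (hB : M.BadFree d₀) (hne : M.φ l ≠ l) (ht : ty (M.φ l) = ty l) (hc : comp M.φ M.σ d₀ l) :
    M.Reduces d₀ l := by
  by_cases h1 : M.φ l = M.σ l
  · exact reduces_of_fuse hyp hB h1 hne hc
  have hf : (M.φ⁻¹ * M.σ).SameCycle (M.φ⁻¹ (M.σ l)) (M.φ⁻¹ (M.φ l)) := by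
    have := sameCycle_apply (M.φ⁻¹ * M.σ) l
    rw [Perm.mul_apply] at this
    simpa using this.symm
  have hcσ : comp M.φ M.σ d₀ (M.σ l) := (comp _ _).trans hc (comp_apply_right _ _ _)
  by_cases h2 : M.σ.SameCycle (M.σ l) (M.φ l)
  · refine (smaller_of_pinch hyp hB (Ne.symm h1) h2 ?_ hcσ).reduces hyp l
    rw [comp_comm]
    exact (M.planar.symm.split (Ne.symm h1) h2).2 hf
  · have hcomp : comp M.φ (swap (M.σ l) (M.φ l) * M.σ) = comp M.φ M.σ := by
      rw [comp_comm, comp_merge h2, glue_eq_self, comp_comm]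
      rw [comp_comm]
      exact (comp _ _).trans ((comp _ _).symm (comp_apply_right _ _ _)) (comp_apply_left _ _ _)
    let M₁ : Diag S ty :=
      { φ := M.φ
        σ := swap (M.σ l) (M.φ l) * M.σ
        val := M.val
        planar := (M.planar.symm.merge_face h2 hf).symm
        ty_σ := by
          intro d
          rw [Perm.mul_apply, swap_apply_def]
          split_ifs with k1 k2
          · rw [ht, M.σ.injective k1]
          · rw [M.ty_σ, ← M.ty_σ d, k2, ht]
          · exact M.ty_σ d
        mem := M.mem
        vert := by
          have key : word M.val (swap (M.σ l) (M.φ l) * M.σ) (M.σ l) = 1 := by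
            rw [word_merge _ h2, M.vert, M.vert, one_mul]
          intro d
          by_cases k1 : (swap (M.σ l) (M.φ l) * M.σ).SameCycle d (M.σ l)
          · rw [word_eq_one_iff _ k1, key]
          · have k : ∀ x, M.σ.SameCycle d x →
                (x = M.σ l ∨ x = M.φ l) → False := by
              rintro x hx hx'
              have h3 : glue (orb M.σ) (M.σ l) (M.φ l) d (M.σ l) := by
                rcases hx' with rfl | rfl
                · exact Or.inl hx
                · exact Or.inr (Or.inr ⟨hx, Perm.SameCycle.refl _ _⟩)
              rw [← orb_merge h2] at h3
              exact k1 h3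
            rw [word_congr (cyc_swap_mul_of_not (fun h => k _ h (Or.inl rfl))
              fun h => k _ h (Or.inr rfl)) fun _ _ => rfl]
            exact M.vert d }
    have hsz : M₁.size d₀ = M.size d₀ := by
      change {x | comp M.φ (swap (M.σ l) (M.φ l) * M.σ) d₀ x}.ncard = _
      rw [hcomp, size]
    have hl : M₁.φ l = M₁.σ l := by
      change M.φ l = (swap (M.σ l) (M.φ l) * M.σ) l
      rw [Perm.mul_apply, swap_apply_left]
    have hB₁ : M₁.BadFree d₀ := fun d hd hnd => hB d (hcomp ▸ hd) hnd
    have := reduces_of_fuse (M := M₁) (hsz ▸ hyp) hB₁ hl hne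
      (hcomp.symm ▸ hc)
    refine ⟨fun hn => ?_, this.2⟩
    obtain ⟨M', k1, k2, k3, k4⟩ := this.1 hn
    exact ⟨M', hsz ▸ k1, k2, k3, k4⟩

end Diag
end Reductions

section Reductions

open Equiv

variable {F : Type*} [Group F] {D : Type*} [Fintype D] [DecidableEq D]
variable {S : Sys F} {ty : D → Fin 4}

theorem Sys.K_eq {i j p p' : Fin 4} (hp : p = i ∨ p = j) (hp' : p' = i ∨ p' = j)
    (hne : p ≠ p') : S.K i j = S.K p p' := by
  rcases hp with rfl | rfl <;> rcases hp' with rfl | rfl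
  · exact absurd rfl hne
  · rfl
  · exact S.symm _ _
  · exact absurd rfl hne

namespace Diag

/-- Changing the nodes of a diagram. -/
def withφ (M : Diag S ty) (φ : Perm D) (h : Planar φ M.σ) : Diag S ty :=
  { M with φ := φ, planar := h }

theorem word_split_mem {v : D → F} {f : Perm D} {a b : D} (hab : a ≠ b) (h : f.SameCycle a b)
    {N : Subgroup F} [N.Normal] (h1 : word v (swap a b * f) a ∈ N)
    (h2 : word v (swap a b * f) b ∈ N) {d : D} (hd : f.SameCycle d a) : word v f d ∈ N := by
  rw [word_mem_iff N v hd, word_split v hab h]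
  exact mul_mem h1 h2

theorem good_of_node_pinch {M : Diag S ty} {d₀ a b : D} (hyp : Hyp S ty (M.size d₀))
    (hB : M.BadFree d₀) (hab : a ≠ b) (hs : M.φ.SameCycle a b)
    (hn : ¬ comp (swap a b * M.φ) M.σ a b) (hd : M.φ.SameCycle d₀ a) {i j : Fin 4}
    (hij : i ≠ j) (hT : M.Typed d₀ i j) : word M.val (swap a b * M.φ) a ∈ S.K i j := by
  have hle : comp (swap a b * M.φ) M.σ ≤ comp M.φ M.σ := by
    rw [comp_split hab hs]; exact (glue_le.1 le_rfl).1
  refine hyp (M.withφ _ (M.planar.split hab hs).1) a i j ?_ hij ?_ ?_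
  · exact size_lt hle (comp_of_left hd) (comp_of_left (hd.trans hs)) hn
  · intro d hda hna
    have h1 : ¬ M.φ.SameCycle d a := fun h => by
      rcases word_split_left hab hs h with h | h
      · exact hna h.symm
      · exact hn ((comp _ _).trans hda (comp_of_left h))
    refine nodeGood_of_eq (M := M) (cyc_swap_mul_of_not h1 fun h => h1 (h.trans hs.symm))
      (fun _ _ => rfl) (hB d ((comp _ _).trans (comp_of_left hd) (hle hda)) ?_)
    exact fun h => h1 (h.symm.trans hd)
  · exact fun x hx => hT x (hd.trans (sameCycle_of_split hab hs hx))

theorem smaller_of_node_pinch {M : Diag S ty} {d₀ a b : D} (hyp : Hyp S ty (M.size d₀))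
    (hB : M.BadFree d₀) (hab : a ≠ b) (hs : M.φ.SameCycle a b)
    (hn : ¬ comp (swap a b * M.φ) M.σ a b) (hd : ¬ M.φ.SameCycle d₀ a)
    (hc : comp (swap a b * M.φ) M.σ d₀ a) : M.Smaller d₀ := by
  have hle : comp (swap a b * M.φ) M.σ ≤ comp M.φ M.σ := by
    rw [comp_split hab hs]; exact (glue_le.1 le_rfl).1
  have hcyc : ∀ {d}, ¬ M.φ.SameCycle d a → cyc (swap a b * M.φ) d = cyc M.φ d := fun h1 =>
    cyc_swap_mul_of_not h1 fun h => h1 (h.trans hs.symm)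
  have hdb : ¬ comp (swap a b * M.φ) M.σ d₀ b := fun h =>
    hn ((comp _ _).trans ((comp _ _).symm hc) h)
  obtain ⟨i, j, hij, hT, hG⟩ := hB a (hle hc) hd
  have := S.normal i j
  let M₁ := M.withφ _ (M.planar.split hab hs).1
  have hcb : comp M.φ M.σ d₀ b := (comp _ _).trans (hle hc) (comp_of_left hs)
  have hb : word M.val (swap a b * M.φ) b ∈ S.K i j := by
    refine hyp M₁ b i j ?_ hij ?_ ?_
    · exact size_lt hle hcb ((comp _ _).refl _) fun h => hdb ((comp _ _).symm h)
    · intro d hbd hna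
      have h1 : ¬ M.φ.SameCycle d a := fun h => by
        rcases word_split_left hab hs h with h | h
        · exact hn ((comp _ _).symm ((comp _ _).trans hbd (comp_of_left h)))
        · exact hna h.symm
      refine nodeGood_of_eq (M := M) (hcyc h1)
        (fun _ _ => rfl) (hB d ((comp _ _).trans hcb (hle hbd)) ?_)
      intro h
      rw [← mem_cyc, ← hcyc hd, mem_cyc] at h
      exact hdb ((comp _ _).trans (comp_of_left h) ((comp _ _).symm hbd))
    · exact fun x hx => hT x (hs.trans (sameCycle_of_split hab hs hx))
  have ha : word M.val (swap a b * M.φ) a ∈ S.K i j := by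
    rw [Good, word_split _ hab hs] at hG
    exact (Subgroup.mul_mem_cancel_right _ hb).1 hG
  refine ⟨M₁, size_lt hle ((comp _ _).refl _) hcb hdb, ?_, hcyc hd, fun _ _ => rfl⟩
  intro d hd' hnd
  by_cases h1 : M.φ.SameCycle d a
  · rcases word_split_left hab hs h1 with h | h
    · refine (nodeGood_congr (M := M₁) h).2 ⟨i, j, hij, ?_, ha⟩
      exact fun x hx => hT x (sameCycle_of_split hab hs hx)
    · exact absurd ((comp _ _).trans hd' (comp_of_left h)) hdb
  · refine nodeGood_of_eq (M := M) (hcyc h1) (fun _ _ => rfl) (hB d (hle hd') fun h => hnd ?_)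
    change (swap a b * M.φ).SameCycle d₀ d
    rwa [← mem_cyc, hcyc hd, mem_cyc]

/-- A node at which two parts of the diagram are pinched can be cut. -/
theorem reduces_of_node_pinch {M : Diag S ty} {d₀ a b : D} (hyp : Hyp S ty (M.size d₀))
    (hB : M.BadFree d₀) (hab : a ≠ b) (hs : M.φ.SameCycle a b)
    (hn : ¬ comp (swap a b * M.φ) M.σ a b) (hc : comp M.φ M.σ d₀ a) : M.Reduces d₀ a := by
  have hn' : ¬ comp (swap b a * M.φ) M.σ b a := fun h => hn (by
    rw [swap_comm]; exact (comp _ _).symm h)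
  constructor
  · intro hd
    rw [comp_split hab hs] at hc
    rcases hc with hc | ⟨hc, -⟩ | ⟨hc, -⟩
    · exact smaller_of_node_pinch hyp hB hab hs hn hd hc
    · exact smaller_of_node_pinch hyp hB hab hs hn hd hc
    · rw [swap_comm] at hc
      exact smaller_of_node_pinch hyp hB hab.symm hs.symm hn' (fun h => hd (h.trans hs.symm)) hc
  · intro hd i j hij hT
    have := S.normal i j
    refine word_split_mem hab hs (good_of_node_pinch hyp hB hab hs hn hd hij hT) ?_ hd
    rw [swap_comm]
    exact good_of_node_pinch hyp hB hab.symm hs.symm hn' (hd.trans hs) hij hT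

theorem NodeGood.of_types {M : Diag S ty} {d p p' : D} (h : M.NodeGood d)
    (hp : M.φ.SameCycle d p) (hp' : M.φ.SameCycle d p') (hne : ty p ≠ ty p') :
    M.Typed d (ty p) (ty p') ∧ M.Good d (ty p) (ty p') := by
  obtain ⟨i, j, hij, hT, hG⟩ := h
  refine ⟨fun x hx => ?_, ?_⟩
  · have h1 := hT x hx
    have h2 := hT p hp
    have h3 := hT p' hp'
    grind
  · rw [Good, ← S.K_eq (hT p hp) (hT p' hp') hne]
    exact hG

/-- Two nodes sharing two consecutive vertices are merged. -/
theorem reduces_of_bigon {M : Diag S ty} {d₀ l l' : D} (hyp : Hyp S ty (M.size d₀))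
    (hB : M.BadFree d₀) (hll : l ≠ l') (h1 : M.φ l = M.σ l') (h2 : M.φ l' = M.σ l)
    (ht : ty (M.φ l) ≠ ty l) (hσ : M.σ l ≠ l) (hc : comp M.φ M.σ d₀ l) :
    (¬ M.φ.SameCycle d₀ l → ¬ M.φ.SameCycle d₀ l' → M.Smaller d₀) ∧
    (M.φ.SameCycle d₀ l → ∀ i j, i ≠ j → M.Typed d₀ i j → M.Good d₀ i j) := by
  have hne : M.φ l ≠ M.φ l' := M.φ.injective.ne hll
  have hface : (M.σ⁻¹ * M.φ).SameCycle (M.σ⁻¹ (M.φ l)) (M.σ⁻¹ (M.φ l')) := by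
    have := sameCycle_apply (M.σ⁻¹ * M.φ) l
    rw [Perm.mul_apply] at this
    rw [h2]
    simpa using this.symm
  have hsl := sameCycle_apply M.φ l
  have hsl' := sameCycle_apply M.φ l'
  by_cases hs : M.φ.SameCycle (M.φ l) (M.φ l')
  · have := reduces_of_node_pinch hyp hB hne hs ((M.planar.split hne hs).2 hface)
      ((comp _ _).trans hc (comp_apply_left _ _ _))
    exact ⟨fun h _ => this.1 fun h' => h (h'.trans hsl.symm), fun h => this.2 (h.trans hsl)⟩
  have hcl : comp M.φ M.σ d₀ (M.φ l) := (comp _ _).trans hc (comp_apply_left _ _ _)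
  have hcomp : comp (swap (M.φ l) (M.φ l') * M.φ) M.σ = comp M.φ M.σ := by
    rw [comp_merge hs, glue_eq_self]
    rw [h2]
    exact (comp _ _).trans ((comp _ _).symm (comp_apply_left _ _ _)) (comp_apply_right _ _ _)
  have hcl' : comp M.φ M.σ d₀ l' := by
    refine (comp _ _).trans hcl ?_
    rw [h1]
    exact (comp _ _).symm (comp_apply_right _ _ _)
  let M₁ := M.withφ _ (M.planar.merge_face hs hface)
  have hsz : M₁.size d₀ = M.size d₀ := by
    change {x | comp (swap (M.φ l) (M.φ l') * M.φ) M.σ d₀ x}.ncard = _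
    rw [hcomp, size]
  have hM : ∀ x y, M₁.φ.SameCycle x y ↔ glue (orb M.φ) (M.φ l) (M.φ l') x y := by
    intro x y
    rw [← orb_merge hs]
    rfl
  have tyl' : ty l' = ty (M.φ l) := by rw [h1, M.ty_σ]
  have tyφl' : ty (M.φ l') = ty l := by rw [h2, M.ty_σ]
  have hfl : M₁.φ l = M₁.σ l := by
    change (swap (M.φ l) (M.φ l') * M.φ) l = M.σ l
    rw [Perm.mul_apply, swap_apply_left, h2]
  have hww : word M.val M₁.φ (M.φ l) = word M.val M.φ (M.φ l) * word M.val M.φ (M.φ l') :=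
    word_merge _ hs
  have hnotin : ∀ {d}, ¬ M.φ.SameCycle d l → ¬ M.φ.SameCycle d l' →
      cyc M₁.φ d = cyc M.φ d := fun ha hb =>
    cyc_swap_mul_of_not (fun h => ha (h.trans hsl.symm)) fun h => hb (h.trans hsl'.symm)
  have hin : ∀ {d}, M₁.φ.SameCycle d l → M.φ.SameCycle d l ∨ M.φ.SameCycle d l' := by
    intro d hd
    rcases (hM _ _).1 hd with h | ⟨h, -⟩ | ⟨h, -⟩
    · exact Or.inl h
    · exact Or.inl (Perm.SameCycle.trans h hsl.symm)
    · exact Or.inr (Perm.SameCycle.trans h hsl'.symm)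
  have hin' : ∀ {d}, M.φ.SameCycle d l ∨ M.φ.SameCycle d l' → M₁.φ.SameCycle d l := by
    rintro d (h | h)
    · exact (hM _ _).2 (Or.inl h)
    · exact (hM _ _).2 (Or.inr (Or.inr ⟨h.trans hsl', hsl.symm⟩))
  have hle : ∀ {x y}, M.φ.SameCycle x y → M₁.φ.SameCycle x y := fun h => (hM _ _).2 (Or.inl h)
  have hB₁ : M.NodeGood l ∨ M.φ.SameCycle d₀ l → M.NodeGood l' ∨ M.φ.SameCycle d₀ l' →
      M₁.BadFree d₀ := by
    intro hl hl' d hd hnd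
    have hd' : comp M.φ M.σ d₀ d := by
      rw [← hcomp]; exact hd
    by_cases hdl : M₁.φ.SameCycle d l
    · have k1 : ¬ M.φ.SameCycle d₀ l := fun h => hnd ((hin' (Or.inl h)).trans hdl.symm)
      have k2 : ¬ M.φ.SameCycle d₀ l' := fun h => hnd ((hin' (Or.inr h)).trans hdl.symm)
      have g1 := (hl.resolve_right k1).of_types (Perm.SameCycle.refl _ _) hsl ht.symm
      have g2 := (hl'.resolve_right k2).of_types hsl' (Perm.SameCycle.refl _ _)
        (by rw [tyl', tyφl']; exact ht.symm)
      rw [tyl', tyφl'] at g2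
      refine (nodeGood_congr hdl).2 ⟨ty l, ty (M.φ l), ht.symm, ?_, ?_⟩
      · intro x hx
        rcases hin hx.symm with h | h
        · exact g1.1 x h.symm
        · exact g2.1 x h.symm
      · rw [good_congr (hle hsl)]
        change word M.val M₁.φ _ ∈ _
        rw [hww]
        exact mul_mem ((good_congr hsl).1 g1.2) ((good_congr hsl').1 g2.2)
    · have k1 : ¬ M.φ.SameCycle d l := fun h => hdl (hin' (Or.inl h))
      have k2 : ¬ M.φ.SameCycle d l' := fun h => hdl (hin' (Or.inr h))
      exact nodeGood_of_eq (M := M) (hnotin k1 k2) (fun _ _ => rfl)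
        (hB d hd' fun h => hnd (hle h))
  have hred := fun hB₁ => reduces_of_fuse (M := M₁) (d₀ := d₀) (hsz ▸ hyp) hB₁ hfl
    (by rw [hfl]; exact hσ) (by
      change comp (swap (M.φ l) (M.φ l') * M.φ) M.σ d₀ l
      rw [hcomp]; exact hc)
  constructor
  · intro k1 k2
    obtain ⟨M', e1, e2, e3, e4⟩ := (hred (hB₁ (Or.inl (hB l hc k1)) (Or.inl (hB l' hcl' k2)))).1
      fun h => (hin h).elim k1 k2
    exact ⟨M', hsz ▸ e1, e2, e3.trans (hnotin k1 k2), fun x hx => e4 x (hle hx)⟩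
  · intro k1 i j hij hT
    have k2 : ¬ M.φ.SameCycle d₀ l' := fun h =>
      hs (hsl.symm.trans (k1.symm.trans (h.trans hsl')))
    have hl' := hB l' hcl' k2
    have g2 := hl'.of_types hsl' (Perm.SameCycle.refl _ _)
        (by rw [tyl', tyφl']; exact ht.symm)
    rw [tyl', tyφl'] at g2
    have hk := S.K_eq (hT l k1) (hT _ (k1.trans hsl)) ht.symm
    have hgood := (hred (hB₁ (Or.inr k1) (Or.inl hl'))).2 (hin' (Or.inl k1)) i j hij (by
      intro x hx
      have a1 := hT l k1
      have a2 := hT _ (k1.trans hsl)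
      rcases hin (hx.symm.trans (hin' (Or.inl k1))) with h | h
      · exact hT x (k1.trans h.symm)
      · have := g2.1 x h.symm
        grind)
    have := S.normal i j
    rw [good_congr (hle (k1.trans hsl))] at hgood
    change word M.val M₁.φ _ ∈ _ at hgood
    rw [hww] at hgood
    rw [good_congr (k1.trans hsl)]
    refine (Subgroup.mul_mem_cancel_right _ ?_).1 hgood
    rw [hk]
    exact (good_congr hsl').1 g2.2

end Diag
end Reductions

section Asphericity

open Equiv

variable {F : Type*} [Group F] {D : Type*} [Fintype D] [DecidableEq D]

theorem isChain_of_map_eq {f : D → D} {R : D → D → Prop} :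
    ∀ {l : List D} {b : D}, l.map f = l.tail ++ [b] → (∀ x ∈ l, R x (f x)) → l.IsChain R
  | [], _, _, _ => List.IsChain.nil
  | [a], _, _, _ => List.isChain_singleton _
  | a :: c :: l, b, h, hR => by
    simp only [List.map_cons, List.tail_cons, List.cons_append, List.cons.injEq] at h
    refine List.isChain_cons_cons.2 ⟨h.1 ▸ hR a (by simp), ?_⟩
    exact isChain_of_map_eq (b := b) (by simpa using h.2) fun x hx =>
      hR x (List.mem_cons_of_mem _ hx)

theorem isChain_cyc {f : Perm D} {d : D} {R : D → D → Prop}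
    (hR : ∀ x, f.SameCycle d x → R x (f x)) : (cyc f d).IsChain R := by
  obtain ⟨A, hA⟩ := exists_cyc_eq_cons f d
  have hc : IsCyc f (d :: A) := hA ▸ isCyc_cyc f d
  rw [hA]
  refine isChain_of_map_eq (b := d) (isCyc_cons.1 hc).2 fun x hx => hR x ?_
  rwa [← mem_cyc, hA]

theorem length_cyc_eq_one {f : Perm D} {x : D} (h : (cyc f x).length = 1) : f x = x := by
  obtain ⟨A, hA⟩ := exists_cyc_eq_cons f x
  have hc : IsCyc f (x :: A) := hA ▸ isCyc_cyc f x
  rw [hA] at h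
  match A, h with
  | [], _ => simpa using (isCyc_cons.1 hc).2

theorem length_cyc_eq_two {f : Perm D} {x : D} (h : (cyc f x).length = 2) :
    cyc f x = [x, f x] ∧ f x ≠ x ∧ f (f x) = x := by
  obtain ⟨A, hA⟩ := exists_cyc_eq_cons f x
  have hc : IsCyc f (x :: A) := hA ▸ isCyc_cyc f x
  rw [hA] at h
  match A, h with
  | [b], _ =>
    have h1 := isCyc_cons.1 hc
    simp only [List.map_cons, List.map_nil, List.cons_append, List.nil_append, List.cons.injEq,
      and_true, List.nodup_cons, List.mem_singleton] at h1
    rw [hA, h1.2.1]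
    exact ⟨rfl, fun h => h1.1.1 h.symm, h1.2.2⟩

theorem length_cyc_eq_three {f : Perm D} {x : D} (h : (cyc f x).length = 3) :
    cyc f x = [x, f x, f (f x)] ∧ f (f (f x)) = x := by
  obtain ⟨A, hA⟩ := exists_cyc_eq_cons f x
  have hc : IsCyc f (x :: A) := hA ▸ isCyc_cyc f x
  rw [hA] at h
  match A, h with
  | [b, c], _ =>
    have h1 := (isCyc_cons.1 hc).2
    simp only [List.map_cons, List.map_nil, List.cons_append, List.nil_append, List.cons.injEq,
      and_true] at h1
    rw [hA, h1.1, h1.2.1]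
    exact ⟨rfl, h1.2.2⟩

variable {S : Sys F} {ty : D → Fin 4}

theorem Sys.q_nonneg (S : Sys F) (i j : Fin 4) : 0 ≤ S.q i j := by
  by_cases hij : i = j
  · rw [hij, S.q_self]
  obtain ⟨k, hk⟩ : ∃ k, j ≠ k ∧ i ≠ k := by revert i j; decide
  have h1 := S.q_tri i j k hij hk.1 hk.2
  have h2 := S.q_le j k
  have h3 := S.q_le k i
  linarith

theorem Sys.q_three (S : Sys F) (i j k : Fin 4) : S.q i j + S.q j k + S.q k i ≤ 1 := by
  have a1 := S.q_le i j
  have a2 := S.q_le j k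
  have a3 := S.q_le k i
  by_cases hij : i = j
  · subst hij; rw [S.q_self]; linarith
  by_cases hjk : j = k
  · subst hjk; rw [S.q_self]; linarith
  by_cases hik : i = k
  · subst hik; rw [S.q_self]; linarith
  exact (S.q_tri i j k hij hjk hik).le

namespace Diag

/-- The angle between a letter and the next letter of its node. -/
def angle (M : Diag S ty) (x : D) : ℚ := S.q (ty x) (ty (M.φ x))

theorem ty_face (M : Diag S ty) (x : D) : ty ((M.σ⁻¹ * M.φ) x) = ty (M.φ x) := by
  rw [← M.ty_σ, Perm.mul_apply, perm_apply_inv]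

theorem angle_eq (M : Diag S ty) (x : D) : M.angle x = S.q (ty x) (ty ((M.σ⁻¹ * M.φ) x)) := by
  rw [M.ty_face x, angle]

theorem sum_angle_le_half (M : Diag S ty) (l : List D) :
    (l.map M.angle).sum ≤ l.length / 2 := by
  induction l with
  | nil => simp
  | cons a l ih =>
    have := S.q_le (ty a) (ty (M.φ a))
    simp only [List.map_cons, List.sum_cons, List.length_cons, angle] at ih ⊢
    push_cast
    linarith

theorem sum_angle_face_le (M : Diag S ty) {x : D} (h : 3 ≤ (cyc (M.σ⁻¹ * M.φ) x).length) :
    ((cyc (M.σ⁻¹ * M.φ) x).map M.angle).sum ≤ (cyc (M.σ⁻¹ * M.φ) x).length - 2 := by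
  rcases h.eq_or_lt with h | h
  · obtain ⟨h1, h2⟩ := length_cyc_eq_three h.symm
    set τ := M.σ⁻¹ * M.φ with hτ
    rw [h1]
    have := S.q_three (ty x) (ty (τ x)) (ty (τ (τ x)))
    simp only [List.map_cons, List.map_nil, List.sum_cons, List.sum_nil, List.length_cons,
      List.length_nil, angle_eq, ← hτ, h2]
    push_cast
    linarith
  · have := M.sum_angle_le_half (cyc (M.σ⁻¹ * M.φ) x)
    have h' : (4 : ℚ) ≤ (cyc (M.σ⁻¹ * M.φ) x).length := by exact_mod_cast h
    linarith

theorem NodeGood.two_le_sum_angle {M : Diag S ty} {d : D} (h : M.NodeGood d)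
    (hval : ∀ x, M.φ.SameCycle d x → M.val x ≠ 1)
    (hty : ∀ x, M.φ.SameCycle d x → ty (M.φ x) ≠ ty x) :
    2 ≤ ((cyc M.φ d).map M.angle).sum := by
  obtain ⟨i, j, hij, hT, hG⟩ := h
  have key := S.length i j hij ((cyc M.φ d).map fun x => (ty x, M.val x))
    (by simpa using List.ne_nil_of_length_pos (length_cyc_pos M.φ d))
    (by
      simp only [List.mem_map, forall_exists_index, and_imp]
      rintro _ x hx rfl
      exact ⟨hT x (mem_cyc.1 hx), M.mem x, hval x (mem_cyc.1 hx)⟩)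
    (by
      rw [List.map_map, List.isChain_map]
      exact isChain_cyc fun x hx => (hty x hx).symm)
    (by rw [List.map_map]; exact hG)
  refine key.trans (le_of_eq ?_)
  rw [List.length_map]
  have : (cyc M.φ d).map M.angle = (cyc M.φ d).map fun _ => S.q i j := by
    refine List.map_congr_left fun x hx => ?_
    have hx := mem_cyc.1 hx
    have h1 := hT x hx
    have h2 := hT (M.φ x) (hx.trans (sameCycle_apply _ _))
    have h3 := hty x hx
    rw [angle]
    rcases h1 with h1 | h1 <;> rcases h2 with h2 | h2
    · exact absurd (h2.trans h1.symm) h3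
    · rw [h1, h2]
    · rw [h1, h2, S.q_symm]
    · exact absurd (h2.trans h1.symm) h3
  rw [this]
  simp

theorem NodeGood.apply_ne {M : Diag S ty} {d : D} (h : M.NodeGood d) (hval : M.val d ≠ 1) :
    M.φ d ≠ d := by
  intro hf
  obtain ⟨i, j, hij, hT, hG⟩ := h
  rw [Good, word_of_fixed _ hf] at hG
  exact hval (eq_one_of_mem hij (typed_self hT) (M.mem d) hG)

theorem apply_vertex_ne {M : Diag S ty} {d : D} (hval : M.val d ≠ 1) : M.σ d ≠ d := by
  intro hf
  have := M.vert d
  rw [word_of_fixed _ hf] at this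
  exact hval this

theorem sum_vertex_nonpos {M : Diag S ty} {d : D} (hval : M.val d ≠ 1) :
    2 / ((cyc M.σ d).length : ℚ) + -1 ≤ 0 := by
  have h1 := length_cyc_pos M.σ d
  have h2 : (cyc M.σ d).length ≠ 1 := fun h => apply_vertex_ne hval (length_cyc_eq_one h)
  have h3 : (2 : ℚ) ≤ (cyc M.σ d).length := by exact_mod_cast (by omega : 2 ≤ (cyc M.σ d).length)
  have : 2 / ((cyc M.σ d).length : ℚ) ≤ 1 := by
    rw [div_le_one (by linarith)]; exact h3
  linarith

theorem face_fixed {M : Diag S ty} {d : D} (h : (M.σ⁻¹ * M.φ) d = d) : M.φ d = M.σ d := by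
  rw [Perm.mul_apply] at h
  rw [← perm_apply_inv M.σ (M.φ d), h]

theorem sum_special (f : Perm D) (d : D) (O : Finset D) (hO : ∀ x, f.SameCycle d x → x ∈ O)
    [DecidablePred (f.SameCycle d)] (w : D → ℚ) :
    ∑ x ∈ O, (if f.SameCycle d x then 2 / ((cyc f x).length : ℚ) + w x else 0) =
      2 + ∑ x ∈ O, if f.SameCycle d x then w x else 0 := by
  have e : Finset.filter (fun x => f.SameCycle d x) O = (cyc f d).toFinset := by
    ext x
    simp only [Finset.mem_filter, List.mem_toFinset, mem_cyc, and_iff_right_iff_imp]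
    exact hO x
  rw [← Finset.sum_filter, ← Finset.sum_filter, e, List.sum_toFinset _ (isCyc_cyc f d).1,
    List.sum_toFinset _ (isCyc_cyc f d).1, sum_cyc_weight]

theorem sum_map_sub_one (l : List D) (w : D → ℚ) :
    (l.map fun x => w x - 1).sum = (l.map w).sum - l.length := by
  induction l with
  | nil => simp
  | cons a l ih => simp only [List.map_cons, List.sum_cons, ih, List.length_cons]; push_cast; ring

theorem sum_map_neg (l : List D) (w : D → ℚ) :
    (l.map fun x => - w x).sum = - (l.map w).sum := by
  induction l with
  | nil => simp
  | cons a l ih => simp only [List.map_cons, List.sum_cons, ih]; ring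

theorem contradiction_of_reduced {M : Diag S ty} {d₀ : D}
    (hB : M.BadFree d₀)
    (hval : ∀ x, comp M.φ M.σ d₀ x → M.val x ≠ 1)
    (hty : ∀ x, comp M.φ M.σ d₀ x → M.φ x ≠ x → ty (M.φ x) ≠ ty x)
    (hface : ∀ x, comp M.φ M.σ d₀ x → (cyc (M.σ⁻¹ * M.φ) x).length = 1 → False)
    (hbig : ∀ x, comp M.φ M.σ d₀ x → (cyc (M.σ⁻¹ * M.φ) x).length = 2 → False) : False := by
  classical
  let O : Finset D := Finset.univ.filter fun x => comp M.φ M.σ d₀ x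
  have hO : ∀ x, x ∈ O ↔ comp M.φ M.σ d₀ x := by simp [O]
  have hcl : ∀ x y, comp M.φ M.σ x y → x ∈ O → y ∈ O := fun x y h hx =>
    (hO y).2 ((comp _ _).trans ((hO x).1 hx) h)
  have gb := M.planar.gauss_bonnet d₀ M.angle O hO
  have hv : ∑ x ∈ O, (2 / ((cyc M.σ x).length : ℚ) + -1) ≤ 0 :=
    Finset.sum_nonpos fun x hx => sum_vertex_nonpos (hval x ((hO x).1 hx))
  have hf : ∑ x ∈ O, (2 / ((cyc (M.σ⁻¹ * M.φ) x).length : ℚ) + (M.angle x - 1)) ≤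
      ∑ x ∈ O, (0 : ℚ) := by
    refine sum_le_sum_of_cyc (M.σ⁻¹ * M.φ) O
      (fun x y h => hcl x y (orb_face_le _ _ h)) _ _ fun x hx => ?_
    rw [sum_cyc_weight (g := fun y => M.angle y - 1)]
    have h0 := length_cyc_pos (M.σ⁻¹ * M.φ) x
    have h1 := hface x ((hO x).1 hx)
    have h2 := hbig x ((hO x).1 hx)
    have h3 := M.sum_angle_face_le (x := x) (by
      by_contra h
      have : (cyc (M.σ⁻¹ * M.φ) x).length = 1 ∨ (cyc (M.σ⁻¹ * M.φ) x).length = 2 := by omega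
      exact this.elim h1 h2)
    rw [sum_map_sub_one]
    simp only [List.map_const', List.sum_replicate, smul_zero]
    linarith
  have hn : ∑ x ∈ O, (2 / ((cyc M.φ x).length : ℚ) + - M.angle x) ≤
      ∑ x ∈ O, if M.φ.SameCycle d₀ x then 2 / ((cyc M.φ x).length : ℚ) + 0 else 0 := by
    refine sum_le_sum_of_cyc M.φ O (fun x y h => hcl x y (comp_of_left h)) _ _ fun x hx => ?_
    by_cases hd : M.φ.SameCycle d₀ x
    · refine List.sum_le_sum fun y hy => ?_
      rw [if_pos (hd.trans (mem_cyc.1 hy))]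
      have := S.q_nonneg (ty y) (ty (M.φ y))
      rw [angle]
      linarith
    · have hcx := (hO x).1 hx
      have hcy : ∀ y, M.φ.SameCycle x y → comp M.φ M.σ d₀ y := fun y hy =>
        (comp _ _).trans hcx (comp_of_left hy)
      have hg := hB x hcx hd
      have := hg.two_le_sum_angle (fun y hy => hval y (hcy y hy)) fun y hy => hty y (hcy y hy)
        (((nodeGood_congr hy).1 hg).apply_ne (hval y (hcy y hy)))
      rw [sum_cyc_weight (g := fun y => - M.angle y), sum_map_neg]
      refine le_trans (by linarith) (le_of_eq (Eq.symm (List.sum_eq_zero ?_)))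
      simp only [List.mem_map, forall_exists_index, and_imp]
      rintro _ y hy rfl
      rw [if_neg fun h => hd (h.trans (mem_cyc.1 hy).symm)]
  rw [sum_special M.φ d₀ O (fun x hx => (hO x).2 (comp_of_left hx)) fun _ => 0] at hn
  simp only [ite_self, Finset.sum_const_zero] at hn hf
  linarith

/-- In a planar diagram all of whose nodes but one are relations of edge groups, the remaining
node is a relation as well, provided its letters are of at most two types. -/
theorem hyp_all (S : Sys F) (ty : D → Fin 4) (n : ℕ) : Hyp S ty n := by
  induction n with
  | zero => intro M d₀ i j h; omega
  | succ n ih =>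
    intro M d₀ i j hlt hij hB hT
    have hyp : Hyp S ty (M.size d₀) := fun M' d' i' j' h => ih M' d' i' j' (by omega)
    by_contra hG
    have hS : ¬ M.Smaller d₀ := fun h => hG (h.good hyp hij hT)
    have hR : ∀ l, ¬ M.Reduces d₀ l := by
      intro l hl
      by_cases h : M.φ.SameCycle d₀ l
      · exact hG (hl.2 h i j hij hT)
      · exact hS (hl.1 h)
    have hval : ∀ x, comp M.φ M.σ d₀ x → M.val x ≠ 1 := fun x hx h1 =>
      hR x (reduces_of_val_eq_one hyp hB h1 hx)
    have hty : ∀ x, comp M.φ M.σ d₀ x → M.φ x ≠ x → ty (M.φ x) ≠ ty x := fun x hx hne ht =>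
      hR x (reduces_of_ty_eq hyp hB hne ht hx)
    have hbig : ∀ l l', comp M.φ M.σ d₀ l → l ≠ l' → M.φ l = M.σ l' → M.φ l' = M.σ l →
        M.φ l ≠ l → False := by
      intro l l' hc hne h1 h2 hf
      have hcl' : comp M.φ M.σ d₀ l' := by
        refine (comp _ _).trans ((comp _ _).trans hc (comp_apply_left _ _ _)) ?_
        rw [h1]; exact (comp _ _).symm (comp_apply_right _ _ _)
      have ht := hty l hc hf
      have hσ := apply_vertex_ne (hval l hc)
      have b1 := reduces_of_bigon hyp hB hne h1 h2 ht hσ hc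
      have b2 := reduces_of_bigon hyp hB hne.symm h2 h1
        (by rw [h1, M.ty_σ] at ht; rw [h2, M.ty_σ]; exact ht.symm)
        (apply_vertex_ne (hval l' hcl')) hcl'
      by_cases k1 : M.φ.SameCycle d₀ l
      · exact hG (b1.2 k1 i j hij hT)
      by_cases k2 : M.φ.SameCycle d₀ l'
      · exact hG (b2.2 k2 i j hij hT)
      · exact hS (b1.1 k1 k2)
    refine contradiction_of_reduced hB hval hty ?_ ?_
    · intro x hx h1
      have h := face_fixed (length_cyc_eq_one h1)
      by_cases hne : M.φ x = x
      · exact apply_vertex_ne (hval x hx) (h ▸ hne)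
      · exact hR x (reduces_of_fuse hyp hB h hne hx)
    · intro x hx h2
      obtain ⟨-, h3, h4⟩ := length_cyc_eq_two h2
      set l' := (M.σ⁻¹ * M.φ) x with hl'
      have e1 : M.φ x = M.σ l' := by rw [hl', Perm.mul_apply, perm_apply_inv]
      have e2 : M.φ l' = M.σ x := by
        rw [← h4, Perm.mul_apply, perm_apply_inv]
      have hc' : comp M.φ M.σ d₀ l' := by
        refine (comp _ _).trans ((comp _ _).trans hx (comp_apply_left _ _ _)) ?_
        rw [e1]; exact (comp _ _).symm (comp_apply_right _ _ _)
      by_cases k1 : M.φ x = x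
      · by_cases k2 : M.φ l' = l'
        · by_cases k3 : M.φ.SameCycle d₀ x
          · have k4 : ¬ M.φ.SameCycle d₀ l' := fun h =>
              h3 (eq_of_sameCycle_fixed k1 (k3.symm.trans h)).symm
            exact (hB l' hc' k4).apply_ne (hval l' hc') k2
          · exact (hB x hx k3).apply_ne (hval x hx) k1
        · exact hbig l' x hc' h3 e2 e1 k2
      · exact hbig x l' hx h3.symm e1 e2 k1

end Diag
end Asphericity

section Potential

/-- The types of the letters `t`, `x y z t x y z` and `z⁻¹ y⁻¹ x⁻¹ t⁻¹ z⁻¹ y⁻¹ x⁻¹`. -/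
def posType : Fin 15 → Fin 4 := ![3, 0, 1, 2, 3, 0, 1, 2, 2, 1, 0, 3, 2, 1, 0]

/-- The pairs of letters that may be consecutive in a cyclic word in `t` and `u`. -/
def PosEdge (p r : Fin 15) : Prop :=
  (r.val = p.val + 1 ∧ p ≠ 0 ∧ p ≠ 7) ∨ (p = 0 ∧ (r = 1 ∨ r = 8)) ∨
    (p = 7 ∧ (r = 0 ∨ r = 1)) ∨ (p = 14 ∧ (r = 0 ∨ r = 8))

instance (p r : Fin 15) : Decidable (PosEdge p r) := by
  unfold PosEdge; infer_instance

/-- The three possible systems of angles, in units of half a degree. -/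
def halfDegrees (c : Fin 3) (i j : Fin 4) : ℤ :=
  (![
    ![![0, 120, 120, 120], ![120, 0, 120, 120], ![120, 120, 0, 120], ![120, 120, 120, 0]],
    ![![0, 90, 180, 90], ![90, 0, 90, 180], ![180, 90, 0, 90], ![90, 180, 90, 0]],
    ![![0, 120, 180, 60], ![120, 0, 60, 180], ![180, 60, 0, 120], ![60, 180, 120, 0]]] : Fin 3 → Fin 4 → Fin 4 → ℤ) c i j

/-- A potential on the states of the boundary walk. The first entry of each row belongs to letters
at which the boundary has no inner vertex of degree two. -/
def potential (c : Fin 3) (p : Fin 15) (st : Option (Fin 4)) : ℤ :=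
  (![
    ![![60, 120, 0, 120, 0], ![60, 0, 0, 120, 240], ![60, 120, 0, 30, 120], ![60, 0, 150, 0, 0], ![60, 0, 30, 120, 0],
      ![60, 0, 0, 0, 120], ![60, 120, 0, 0, 0], ![60, 0, 120, 0, 0], ![60, 120, 0, 0, 240], ![60, 30, 0, 120, 120],
      ![60, 0, 150, 0, 0], ![60, 120, 30, 0, 0], ![60, 0, 0, 0, 120], ![60, 0, 0, 120, 0], ![60, 0, 120, 0, 0]],
    ![![90, 90, 0, 90, 0], ![90, 0, 0, 180, 180], ![90, 90, 0, 90, 90], ![90, 0, 180, 0, 0], ![90, 0, 90, 90, 0],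
      ![90, 0, 0, 0, 90], ![90, 90, 0, 0, 0], ![90, 0, 90, 0, 0], ![90, 180, 0, 0, 180], ![90, 90, 0, 90, 90],
      ![90, 0, 180, 0, 0], ![90, 90, 90, 0, 0], ![90, 0, 0, 0, 90], ![90, 0, 0, 90, 0], ![90, 0, 90, 0, 0]],
    ![![120, 90, 120, 120, 0], ![120, 0, 60, 240, 150], ![120, 180, 0, 120, 60], ![120, 120, 180, 0, 30], ![120, 0, 60, 150, 0],
      ![120, 0, 0, 90, 60], ![120, 120, 0, 0, 0], ![120, 60, 60, 0, 0], ![120, 180, 0, 0, 240], ![120, 120, 0, 90, 180],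
      ![120, 0, 240, 0, 60], ![120, 120, 180, 90, 0], ![120, 0, 60, 0, 210], ![120, 60, 0, 120, 150], ![120, 0, 180, 0, 30]]] : Fin 3 → Fin 15 → Fin 5 → ℤ) c p (st.elim 0 Fin.succ)

/-- The pairs of types that occur on the boundary. -/
def Allowed (i j : Fin 4) : Prop := i ≠ j ∧ ¬ (i = 1 ∧ j = 3) ∧ ¬ (i = 3 ∧ j = 1)

instance (i j : Fin 4) : Decidable (Allowed i j) := by
  unfold Allowed; infer_instance

theorem PosEdge.allowed : ∀ {p r : Fin 15}, PosEdge p r → Allowed (posType p) (posType r) := by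
  decide

/-- `HasBound j k st st' w` holds if `w` (in half degrees) is one of the upper bounds for the
contribution of a corner between letters of types `j` and `k` with states `st` and `st'`. -/
inductive HasBound (Q : Fin 4 → Fin 4 → ℚ) (j k : Fin 4) :
    Option (Fin 4) → Option (Fin 4) → ℚ → Prop
  | inner_two : HasBound Q j k (some k) (some j) (Q j k)
  | inner_three (i) : i ≠ j → i ≠ k → HasBound Q j k (some i) (some i) (- Q j k)
  | inner_four (i i') : i ≠ j → i' ≠ k → i ≠ i' → HasBound Q j k (some i) (some i')
      (- Q j k - (720 - (Q i j + Q j k + Q k i' + Q i' i)) / 2)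
  | inner_five (i i') : i ≠ j → i' ≠ k → HasBound Q j k (some i) (some i') (- Q j k - 90)
  | left_two : HasBound Q j k none (some j) (Q j k - 180)
  | left_pen (i) : i ≠ k → HasBound Q j k none (some i) (- Q j k - 180)
  | left_three (i) : i ≠ k → Allowed i j → HasBound Q j k none (some i) (- Q j k)
  | left_four (i m) : i ≠ k → m ≠ i → Allowed m j → HasBound Q j k none (some i)
      (- Q j k - (720 - (Q m j + Q j k + Q k i + Q i m)) / 3)
  | left_five (i) : i ≠ k → HasBound Q j k none (some i) (- Q j k - 72)
  | right_two : HasBound Q j k (some k) none (Q j k - 180)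
  | right_pen (i) : i ≠ j → HasBound Q j k (some i) none (- Q j k - 180)
  | right_three (i) : i ≠ j → Allowed i k → HasBound Q j k (some i) none (- Q j k)
  | right_four (i m) : i ≠ j → m ≠ i → Allowed m k → HasBound Q j k (some i) none
      (- Q j k - (720 - (Q i j + Q j k + Q k m + Q m i)) / 3)
  | right_five (i) : i ≠ j → HasBound Q j k (some i) none (- Q j k - 72)
  | outer : HasBound Q j k none none 0

theorem potential_inner : ∀ (c : Fin 3) (p r : Fin 15), PosEdge p r →
    halfDegrees c (posType p) (posType r) ≤
      potential c r (some (posType p)) - potential c p (some (posType r)) ∧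
    ∀ i, i ≠ posType p →
      (i ≠ posType r → - halfDegrees c (posType p) (posType r) ≤
        potential c r (some i) - potential c p (some i)) ∧
      ∀ i', i' ≠ posType r →
        - halfDegrees c (posType p) (posType r) - 90 ≤
          potential c r (some i') - potential c p (some i) ∧
        (i ≠ i' → - 2 * halfDegrees c (posType p) (posType r) -
          (720 - (halfDegrees c i (posType p) + halfDegrees c (posType p) (posType r) +
            halfDegrees c (posType r) i' + halfDegrees c i' i)) ≤
          2 * (potential c r (some i') - potential c p (some i))) := by
  decide

theorem potential_left : ∀ (c : Fin 3) (p r : Fin 15), PosEdge p r →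
    halfDegrees c (posType p) (posType r) - 180 ≤
      potential c r (some (posType p)) - potential c p none ∧
    ∀ i, i ≠ posType r →
      (Allowed i (posType p) → - halfDegrees c (posType p) (posType r) ≤
        potential c r (some i) - potential c p none) ∧
      - halfDegrees c (posType p) (posType r) - 72 ≤
          potential c r (some i) - potential c p none ∧
      ∀ m, m ≠ i → Allowed m (posType p) →
        - 3 * halfDegrees c (posType p) (posType r) -
          (720 - (halfDegrees c m (posType p) + halfDegrees c (posType p) (posType r) +
            halfDegrees c (posType r) i + halfDegrees c i m)) ≤
          3 * (potential c r (some i) - potential c p none) := by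
  decide

theorem potential_right : ∀ (c : Fin 3) (p r : Fin 15), PosEdge p r →
    halfDegrees c (posType p) (posType r) - 180 ≤
      potential c r none - potential c p (some (posType r)) ∧
    ∀ i, i ≠ posType p →
      (Allowed i (posType r) → - halfDegrees c (posType p) (posType r) ≤
        potential c r none - potential c p (some i)) ∧
      - halfDegrees c (posType p) (posType r) - 72 ≤
          potential c r none - potential c p (some i) ∧
      ∀ m, m ≠ i → Allowed m (posType r) →
        - 3 * halfDegrees c (posType p) (posType r) -
          (720 - (halfDegrees c i (posType p) + halfDegrees c (posType p) (posType r) +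
            halfDegrees c (posType r) m + halfDegrees c m i)) ≤
          3 * (potential c r none - potential c p (some i)) := by
  decide

theorem potential_none : ∀ (c : Fin 3) (p r : Fin 15), potential c r none = potential c p none := by
  decide

theorem HasBound.le {c : Fin 3} {p r : Fin 15} (h : PosEdge p r) {st st' : Option (Fin 4)} {w : ℚ}
    (hw : HasBound (fun i j => (halfDegrees c i j : ℚ)) (posType p) (posType r) st st' w) :
    w ≤ potential c r st' - potential c p st := by
  obtain ⟨a1, a2⟩ := potential_inner c p r h
  obtain ⟨b1, b2⟩ := potential_left c p r h
  obtain ⟨d1, d2⟩ := potential_right c p r h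
  cases hw with
  | inner_two => exact_mod_cast a1
  | inner_three i h1 h2 => exact_mod_cast (a2 i h1).1 h2
  | inner_four i i' h1 h2 h3 =>
    have := ((a2 i h1).2 i' h2).2 h3
    have : ((_ : ℤ) : ℚ) ≤ ((_ : ℤ) : ℚ) := Int.cast_le.2 this
    push_cast at this
    linarith
  | inner_five i i' h1 h2 => exact_mod_cast ((a2 i h1).2 i' h2).1
  | left_two => exact_mod_cast b1
  | left_pen i h1 =>
    have := (b2 i h1).2.1
    have : ((_ : ℤ) : ℚ) ≤ ((_ : ℤ) : ℚ) := Int.cast_le.2 this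
    push_cast at this
    linarith
  | left_three i h1 h2 => exact_mod_cast (b2 i h1).1 h2
  | left_four i m h1 h2 h3 =>
    have := (b2 i h1).2.2 m h2 h3
    have : ((_ : ℤ) : ℚ) ≤ ((_ : ℤ) : ℚ) := Int.cast_le.2 this
    push_cast at this
    linarith
  | left_five i h1 => exact_mod_cast (b2 i h1).2.1
  | right_two => exact_mod_cast d1
  | right_pen i h1 =>
    have := (d2 i h1).2.1
    have : ((_ : ℤ) : ℚ) ≤ ((_ : ℤ) : ℚ) := Int.cast_le.2 this
    push_cast at this
    linarith
  | right_three i h1 h2 => exact_mod_cast (d2 i h1).1 h2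
  | right_four i m h1 h2 h3 =>
    have := (d2 i h1).2.2 m h2 h3
    have : ((_ : ℤ) : ℚ) ≤ ((_ : ℤ) : ℚ) := Int.cast_le.2 this
    push_cast at this
    linarith
  | right_five i h1 => exact_mod_cast (d2 i h1).2.1
  | outer => rw [potential_none c r p, sub_self]

end Potential

section Corners

open Equiv

variable {F : Type*} [Group F] {D : Type*} [Fintype D] [DecidableEq D]

theorem sameCycle_induction {f : Perm D} {P : D → Prop} (h : ∀ x, P x → P (f x)) {x y : D}
    (hxy : f.SameCycle x y) (hx : P x) : P y := by
  have h1 : ∀ n : ℕ, P ((f ^ n) x) := by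
    intro n
    induction n with
    | zero => exact hx
    | succ n ih => rw [pow_succ', Perm.mul_apply]; exact h _ ih
  obtain ⟨n, -, hn⟩ := hxy.exists_pow_eq'
  exact hn ▸ h1 n

theorem length_cyc_eq_four {f : Perm D} {x : D} (h : (cyc f x).length = 4) :
    cyc f x = [x, f x, f (f x), f (f (f x))] ∧ f (f (f (f x))) = x := by
  obtain ⟨A, hA⟩ := exists_cyc_eq_cons f x
  have hc : IsCyc f (x :: A) := hA ▸ isCyc_cyc f x
  rw [hA] at h
  match A, h with
  | [b, c, d], _ =>
    have h1 := (isCyc_cons.1 hc).2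
    simp only [List.map_cons, List.map_nil, List.cons_append, List.nil_append, List.cons.injEq,
      and_true] at h1
    rw [hA, h1.1, h1.2.1, h1.2.2.1]
    exact ⟨rfl, h1.2.2.2⟩

theorem length_cyc_le_two {f : Perm D} {x : D} (h : f (f x) = x) : (cyc f x).length ≤ 2 := by
  have h1 : cyc f x ⊆ [x, f x] := by
    intro y hy
    refine sameCycle_induction (P := fun y => y ∈ [x, f x]) (f := f) ?_ (mem_cyc.1 hy)
      (List.mem_cons_self ..)
    intro z hz
    simp only [List.mem_cons, List.not_mem_nil, or_false] at hz ⊢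
    rcases hz with rfl | rfl
    · exact Or.inr rfl
    · exact Or.inl h
  exact (List.subperm_of_subset (isCyc_cyc f x).1 h1).length_le

theorem length_cyc_eq_five {f : Perm D} {x : D} (h : (cyc f x).length = 5) :
    cyc f x = [x, f x, f (f x), f (f (f x)), f (f (f (f x)))] ∧
      f (f (f (f (f x)))) = x := by
  obtain ⟨A, hA⟩ := exists_cyc_eq_cons f x
  have hc : IsCyc f (x :: A) := hA ▸ isCyc_cyc f x
  rw [hA] at h
  match A, h with
  | [b, c, d, e], _ =>
    have h1 := (isCyc_cons.1 hc).2
    simp only [List.map_cons, List.map_nil, List.cons_append, List.nil_append, List.cons.injEq,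
      and_true] at h1
    rw [hA, h1.1, h1.2.1, h1.2.2.1, h1.2.2.2.1]
    exact ⟨rfl, h1.2.2.2.2⟩

variable {S : Sys F} {ty : D → Fin 4}

set_option synthInstance.maxSize 1000 in
set_option synthInstance.maxHeartbeats 200000 in
theorem five_cases : ∀ a b c d e : Fin 4, a ≠ b → b ≠ c → c ≠ d → d ≠ e → e ≠ a →
    a = c ∨ b = d ∨ c = e ∨ d = a ∨ e = b := by
  decide

theorem Sys.q_five (S : Sys F) {a b c d e : Fin 4} (h1 : a ≠ b) (h2 : b ≠ c) (h3 : c ≠ d)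
    (h4 : d ≠ e) (h5 : e ≠ a) : S.q a b + S.q b c + S.q c d + S.q d e + S.q e a ≤ 2 := by
  have hcase : a = c ∨ b = d ∨ c = e ∨ d = a ∨ e = b := five_cases a b c d e h1 h2 h3 h4 h5
  have l1 := S.q_le a b
  have l2 := S.q_le b c
  have l3 := S.q_le c d
  have l4 := S.q_le d e
  have l5 := S.q_le e a
  rcases hcase with rfl | rfl | rfl | rfl | rfl
  · have := S.q_three a d e; linarith
  · have := S.q_three a b e; linarith
  · have := S.q_three a b c; linarith
  · have := S.q_three d b c; linarith
  · have := S.q_three e c d; linarith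

namespace Diag

/-- The curvature of the face of a corner is the negative of its excess. -/
noncomputable def excess (M : Diag S ty) (x : D) : ℚ :=
  (cyc (M.σ⁻¹ * M.φ) x).length - 2 - ((cyc (M.σ⁻¹ * M.φ) x).map M.angle).sum

theorem excess_nonneg (M : Diag S ty) {x : D} (h : 3 ≤ (cyc (M.σ⁻¹ * M.φ) x).length) :
    0 ≤ M.excess x := by
  have := M.sum_angle_face_le h
  rw [excess]
  linarith

theorem excess_two {M : Diag S ty} {x : D} (h : (cyc (M.σ⁻¹ * M.φ) x).length = 2) :
    M.excess x = -2 * M.angle x := by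
  obtain ⟨h1, -, h2⟩ := length_cyc_eq_two h
  have e : M.angle ((M.σ⁻¹ * M.φ) x) = M.angle x := by
    rw [M.angle_eq, M.angle_eq x, h2, S.q_symm]
  rw [excess, h, h1]
  simp only [List.map_cons, List.map_nil, List.sum_cons, List.sum_nil, e]
  push_cast
  ring

theorem excess_four {M : Diag S ty} {x p : D} (h : (cyc (M.σ⁻¹ * M.φ) x).length = 4)
    (hp : (M.σ⁻¹ * M.φ) p = x) :
    (M.σ⁻¹ * M.φ) ((M.σ⁻¹ * M.φ) ((M.σ⁻¹ * M.φ) x)) = p ∧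
    M.excess x = 2 - (S.q (ty p) (ty x) + S.q (ty x) (ty ((M.σ⁻¹ * M.φ) x)) +
      S.q (ty ((M.σ⁻¹ * M.φ) x)) (ty ((M.σ⁻¹ * M.φ) ((M.σ⁻¹ * M.φ) x))) +
      S.q (ty ((M.σ⁻¹ * M.φ) ((M.σ⁻¹ * M.φ) x))) (ty p)) := by
  obtain ⟨h1, h2⟩ := length_cyc_eq_four h
  have hp' : (M.σ⁻¹ * M.φ) ((M.σ⁻¹ * M.φ) ((M.σ⁻¹ * M.φ) x)) = p :=
    (M.σ⁻¹ * M.φ).injective (h2.trans hp.symm)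
  refine ⟨hp', ?_⟩
  rw [excess, h, h1]
  simp only [List.map_cons, List.map_nil, List.sum_cons, List.sum_nil]
  rw [hp', M.angle_eq x, M.angle_eq, M.angle_eq, M.angle_eq p, hp', hp]
  push_cast
  ring

theorem excess_five {M : Diag S ty} {x : D} (h : 5 ≤ (cyc (M.σ⁻¹ * M.φ) x).length)
    (hty : ∀ y, (M.σ⁻¹ * M.φ).SameCycle x y → ty y ≠ ty ((M.σ⁻¹ * M.φ) y)) :
    (((cyc (M.σ⁻¹ * M.φ) x).length : ℚ) - 2) / 4 ≤ M.excess x ∧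
    (((cyc (M.σ⁻¹ * M.φ) x).length : ℚ) - 1) / 5 ≤ M.excess x := by
  rcases h.eq_or_lt with h | h
  · obtain ⟨h1, h2⟩ := length_cyc_eq_five h.symm
    have hq : ((cyc (M.σ⁻¹ * M.φ) x).map M.angle).sum ≤ 2 := by
      set τ := M.σ⁻¹ * M.φ with hτ
      have s1 := sameCycle_apply τ x
      have s2 := s1.trans (sameCycle_apply τ _)
      have s3 := s2.trans (sameCycle_apply τ _)
      have s4 := s3.trans (sameCycle_apply τ _)
      have := S.q_five (hty _ (Perm.SameCycle.refl _ _)) (hty _ s1) (hty _ s2) (hty _ s3)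
        (by have := hty _ s4; rwa [h2] at this)
      rw [h1]
      simp only [List.map_cons, List.map_nil, List.sum_cons, List.sum_nil, angle_eq, ← hτ, h2]
      linarith
    rw [excess, ← h]
    push_cast
    constructor <;> linarith
  · have h6 : (6 : ℚ) ≤ (cyc (M.σ⁻¹ * M.φ) x).length := by exact_mod_cast h
    have := M.sum_angle_le_half (cyc (M.σ⁻¹ * M.φ) x)
    rw [excess]
    constructor <;> linarith

end Diag

/-- The number of marked letters on the cycle of `x`. -/
noncomputable def marked (out : D → Prop) [DecidablePred out] (f : Perm D) (x : D) : ℕ :=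
  ((cyc f x).filter fun y => decide (out y)).length

section marked

variable {out : D → Prop} [DecidablePred out] {f : Perm D} {x : D}

theorem marked_pos (hx : out x) : 0 < marked out f x := by
  refine List.length_pos_of_mem (a := x) (List.mem_filter.2 ⟨?_, by simpa using hx⟩)
  exact mem_cyc.2 (Perm.SameCycle.refl _ _)

theorem marked_add : marked out f x + ((cyc f x).filter fun y => ! decide (out y)).length =
    (cyc f x).length := by
  rw [marked]
  induction cyc f x with
  | nil => rfl
  | cons a l ih =>
    simp only [List.filter_cons]
    by_cases ha : out a <;> simp [ha] at ih ⊢ <;> omega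

theorem marked_lt {y : D} (h : f.SameCycle x y) (hy : ¬ out y) :
    marked out f x + 1 ≤ (cyc f x).length := by
  have h1 := marked_add (out := out) (f := f) (x := x)
  have h2 : 0 < ((cyc f x).filter fun y => ! decide (out y)).length :=
    List.length_pos_of_mem (a := y) (List.mem_filter.2 ⟨mem_cyc.2 h, by simpa using hy⟩)
  omega

theorem marked_lt_lt {y z : D} (h : f.SameCycle x y) (hy : ¬ out y) (h' : f.SameCycle x z)
    (hz : ¬ out z) (hyz : y ≠ z) : marked out f x + 2 ≤ (cyc f x).length := by
  have h1 := marked_add (out := out) (f := f) (x := x)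
  have h2 : [y, z].length ≤ ((cyc f x).filter fun y => ! decide (out y)).length := by
    refine List.Subperm.length_le (List.subperm_of_subset (by simpa using hyz) ?_)
    intro w hw
    simp only [List.mem_cons, List.not_mem_nil, or_false] at hw
    rcases hw with rfl | rfl
    · exact List.mem_filter.2 ⟨mem_cyc.2 h, by simpa using hy⟩
    · exact List.mem_filter.2 ⟨mem_cyc.2 h', by simpa using hz⟩
  simp only [List.length_cons, List.length_nil] at h2
  omega

theorem marked_congr {y : D} (h : f.SameCycle x y) : marked out f x = marked out f y :=
  ((cyc_perm h).filter _).length_eq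

end marked

namespace Diag

/-- The irreducible diagrams with boundary a cyclic word in `t` and `u`. -/
structure Irred (M : Diag S ty) (out : D → Prop) (C : D → Prop) (pos : D → Fin 15) : Prop where
  out_φ : ∀ x, out (M.φ x) ↔ out x
  sub : ∀ x, out x → C x
  C_φ : ∀ x, C (M.φ x) ↔ C x
  C_σ : ∀ x, C (M.σ x) ↔ C x
  good : ∀ x, C x → ¬ out x → M.NodeGood x
  val_ne : ∀ x, C x → M.val x ≠ 1
  ty_ne : ∀ x, C x → ty x ≠ ty (M.φ x)
  two : ∀ x, C x → (cyc (M.σ⁻¹ * M.φ) x).length = 2 → out x ∨ out ((M.σ⁻¹ * M.φ) x)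
  ty_pos : ∀ x, out x → ty x = posType (pos x)
  edge : ∀ x, out x → PosEdge (pos x) (pos (M.φ x))

open Classical in
/-- The type of the inner node at a boundary vertex of degree two. -/
noncomputable def state (M : Diag S ty) (out : D → Prop) (x : D) : Option (Fin 4) :=
  if (cyc M.σ x).length = 2 ∧ ¬ out (M.σ x) then some (ty (M.φ (M.σ x))) else none

/-- The curvature taken off a boundary vertex of degree at least three. -/
noncomputable def penalty (M : Diag S ty) (out : D → Prop) [DecidablePred out] (x y : D) : ℚ :=
  if 3 ≤ (cyc M.σ x).length ∧ ¬ out y then -1 / 2 else 0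

section corner

variable {M : Diag S ty} {out C : D → Prop} [DecidablePred out] {pos : D → Fin 15}

theorem penalty_nonpos (x y : D) : M.penalty out x y ≤ 0 := by
  rw [penalty]; split_ifs <;> norm_num

theorem Irred.two_le (h : M.Irred out C pos) {x : D} (hx : C x) : 2 ≤ (cyc M.σ x).length := by
  have h1 := length_cyc_pos M.σ x
  have h2 : (cyc M.σ x).length ≠ 1 := fun e =>
    apply_vertex_ne (h.val_ne x hx) (length_cyc_eq_one e)
  omega

theorem Irred.C_face (h : M.Irred out C pos) {x : D} (hx : C x) : C ((M.σ⁻¹ * M.φ) x) := by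
  rw [← h.C_σ, Perm.mul_apply, perm_apply_inv, h.C_φ]
  exact hx

theorem Irred.ty_face_ne (h : M.Irred out C pos) {x : D} (hx : C x) :
    ty x ≠ ty ((M.σ⁻¹ * M.φ) x) := by
  rw [M.ty_face x]; exact h.ty_ne x hx

theorem Irred.C_of_face (h : M.Irred out C pos) {x y : D} (hx : C x)
    (hxy : (M.σ⁻¹ * M.φ).SameCycle x y) : C y :=
  sameCycle_induction (P := C) (f := M.σ⁻¹ * M.φ) (fun _ hz => h.C_face hz) hxy hx

/-- The possible states at the start of a boundary corner whose predecessor in its face is `p`. -/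
theorem Irred.left_cases (h : M.Irred out C pos) {x p : D} (hx : out x)
    (hp : M.φ p = M.σ x) :
    (M.state out x = some (ty p) ∧ ¬ out p) ∨
    (M.state out x = none ∧ ¬ out p ∧ M.penalty out x (M.σ x) = -1 / 2) ∨
    (M.state out x = none ∧ out p ∧ Allowed (ty p) (ty x)) := by
  have hop : out p ↔ out (M.σ x) := by rw [← hp, h.out_φ]
  have h2 := h.two_le (h.sub x hx)
  by_cases ho : out p
  · refine Or.inr (Or.inr ⟨?_, ho, ?_⟩)
    · rw [state, if_neg]
      exact fun h' => h'.2 (hop.1 ho)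
    · have := (h.edge p ho).allowed
      rwa [← h.ty_pos p ho, ← h.ty_pos _ ((h.out_φ p).2 ho), hp, M.ty_σ] at this
  have ho' : ¬ out (M.σ x) := fun h' => ho (hop.2 h')
  by_cases hd : (cyc M.σ x).length = 2
  · refine Or.inl ⟨?_, ho⟩
    rw [state, if_pos ⟨hd, ho'⟩]
    have hC : C (M.σ x) := (h.C_σ x).2 (h.sub x hx)
    have hCp : C p := by rw [← h.C_φ, hp]; exact hC
    have h1 : M.φ.SameCycle (M.σ x) (M.φ (M.σ x)) := sameCycle_apply _ _
    have h2 : M.φ.SameCycle (M.σ x) p := by rw [← hp]; exact (sameCycle_apply _ _).symm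
    have hT := (h.good _ hC ho').of_types (Perm.SameCycle.refl _ _) h1 (h.ty_ne _ hC)
    rcases hT.1 p h2 with e | e
    · exact absurd e (by have := h.ty_ne p hCp; rwa [hp] at this)
    · rw [e]
  · refine Or.inr (Or.inl ⟨?_, ho, ?_⟩)
    · rw [state, if_neg]
      exact fun h' => hd h'.1
    · rw [penalty, if_pos ⟨by omega, ho'⟩]

/-- The possible states at the end of a boundary corner. -/
theorem Irred.right_cases (h : M.Irred out C pos) {x : D} (hx : out x) :
    (M.state out (M.φ x) = some (ty ((M.σ⁻¹ * M.φ) ((M.σ⁻¹ * M.φ) x))) ∧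
      ¬ out ((M.σ⁻¹ * M.φ) x)) ∨
    (M.state out (M.φ x) = none ∧ ¬ out ((M.σ⁻¹ * M.φ) x) ∧
      M.penalty out (M.φ x) ((M.σ⁻¹ * M.φ) x) = -1 / 2) ∨
    (M.state out (M.φ x) = none ∧ out ((M.σ⁻¹ * M.φ) x) ∧
      Allowed (ty ((M.σ⁻¹ * M.φ) ((M.σ⁻¹ * M.φ) x))) (ty (M.φ x))) := by
  have hx' := (h.out_φ x).2 hx
  have hn : M.σ ((M.σ⁻¹ * M.φ) x) = M.φ x := by rw [Perm.mul_apply, perm_apply_inv]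
  have h2 := h.two_le (h.sub _ hx')
  have hd2 : (cyc M.σ (M.φ x)).length = 2 → M.σ (M.φ x) = (M.σ⁻¹ * M.φ) x := fun hd =>
    M.σ.injective ((length_cyc_eq_two hd).2.2.trans hn.symm)
  by_cases ho : out ((M.σ⁻¹ * M.φ) x)
  · refine Or.inr (Or.inr ⟨?_, ho, ?_⟩)
    · rw [state, if_neg]
      rintro ⟨hd, h'⟩
      rw [hd2 hd] at h'
      exact h' ho
    · have := (h.edge _ ho).allowed
      rw [← h.ty_pos _ ho, ← h.ty_pos _ ((h.out_φ _).2 ho), ← M.ty_face, M.ty_face x] at this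
      exact ⟨this.1.symm, fun e => this.2.2 e.symm, fun e => this.2.1 e.symm⟩
  by_cases hd : (cyc M.σ (M.φ x)).length = 2
  · refine Or.inl ⟨?_, ho⟩
    rw [state, if_pos ⟨hd, by rwa [hd2 hd]⟩, hd2 hd, ← M.ty_face]
  · refine Or.inr (Or.inl ⟨?_, ho, ?_⟩)
    · rw [state, if_neg]
      exact fun h' => hd h'.1
    · rw [penalty, if_pos ⟨by omega, ho⟩]

theorem neg_div_le {e b s t : ℚ} (hs : 0 < s) (hst : s ≤ t) (hb : 0 ≤ b) (h : b * t ≤ e) :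
    - e / s ≤ - b := by
  rw [div_le_iff₀ hs]
  have := mul_le_mul_of_nonneg_left hst hb
  linarith

theorem Irred.corner_bound (h : M.Irred out C pos) {x : D} (hx : out x) :
    ∃ w, HasBound (fun i j => 360 * S.q i j) (ty x) (ty (M.φ x)) (M.state out x)
      (M.state out (M.φ x)) w ∧
      360 * (- M.angle x + - M.excess x / marked out (M.σ⁻¹ * M.φ) x +
        M.penalty out x (M.σ x) + M.penalty out (M.φ x) ((M.σ⁻¹ * M.φ) x)) ≤ w := by
  have hC := h.sub x hx
  obtain ⟨p, hp⟩ : ∃ p, M.φ p = M.σ x := ⟨M.φ⁻¹ (M.σ x), perm_apply_inv _ _⟩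
  have hleft := h.left_cases hx hp
  have hright := h.right_cases hx
  have hp' : (M.σ⁻¹ * M.φ) p = x := by
    rw [Perm.mul_apply, hp]; simp
  have hk : ty ((M.σ⁻¹ * M.φ) x) = ty (M.φ x) := M.ty_face x
  have hpen1 := M.penalty_nonpos (out := out) x (M.σ x)
  have hpen2 := M.penalty_nonpos (out := out) (M.φ x) ((M.σ⁻¹ * M.φ) x)
  have hL := length_cyc_pos (M.σ⁻¹ * M.φ) x
  have hL1 : (cyc (M.σ⁻¹ * M.φ) x).length ≠ 1 := fun e =>
    h.ty_face_ne hC (by rw [length_cyc_eq_one e])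
  have hs := marked_pos (f := M.σ⁻¹ * M.φ) hx
  have hex0 := M.excess_nonneg (x := x)
  have hex2 := M.excess_two (x := x)
  have hex4 := M.excess_four (x := x) (p := p)
  have hex5 := M.excess_five (x := x)
  have hq0 : 0 ≤ M.angle x := S.q_nonneg _ _
  have hq1 : M.angle x ≤ 1 / 2 := S.q_le _ _
  have hq : M.angle x = S.q (ty x) (ty (M.φ x)) := rfl
  have hface := fun y => h.ty_face_ne (x := y)
  have hCf := fun y => h.C_of_face (x := x) (y := y) hC
  generalize hτ : M.σ⁻¹ * M.φ = τ at *
  have sn : τ.SameCycle x (τ x) := sameCycle_apply τ x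
  have snn : τ.SameCycle x (τ (τ x)) := sn.trans (sameCycle_apply τ _)
  have sp : τ.SameCycle x p := by
    have := (sameCycle_apply τ p).symm
    rwa [hp'] at this
  have hs' : (0 : ℚ) < marked out τ x := by exact_mod_cast hs
  have n1 : ty p ≠ ty x := by have := hface p (hCf _ sp); rwa [hp'] at this
  have n2 : ty (τ (τ x)) ≠ ty (M.φ x) := by
    have := hface _ (hCf _ sn); rw [hk] at this; exact this.symm
  have m1 : ¬ out (τ x) → (marked out τ x : ℚ) + 1 ≤ (cyc τ x).length := fun ho => by
    exact_mod_cast marked_lt sn ho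
  have m2 : ¬ out p → (marked out τ x : ℚ) + 1 ≤ (cyc τ x).length := fun ho => by
    exact_mod_cast marked_lt sp ho
  obtain hL | hL : (cyc τ x).length = 2 ∨ 3 ≤ (cyc τ x).length := by omega
  · have hpn : p = τ x := τ.injective (hp'.trans (length_cyc_eq_two hL).2.2.symm)
    have e1 : ty p = ty (M.φ x) := by rw [hpn, hk]
    have e2 : ty (τ (τ x)) = ty x := by rw [(length_cyc_eq_two hL).2.2]
    rw [e1] at hleft
    rw [e2] at hright
    rw [hL] at m1
    have hE : ¬ out (τ x) → - M.excess x / marked out τ x = 2 * M.angle x := fun ho => by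
      have : (marked out τ x : ℚ) = 1 := le_antisymm (by have := m1 ho; push_cast at this; linarith)
        (by exact_mod_cast hs)
      rw [this, hex2 hL]; ring
    rcases hleft with ⟨a1, a2⟩ | ⟨a1, a2, a3⟩ | ⟨a1, a2, a3⟩ <;>
    rcases hright with ⟨b1, b2⟩ | ⟨b1, b2, b3⟩ | ⟨b1, b2, b3⟩ <;> rw [a1, b1]
    · exact ⟨_, .inner_two, by rw [hE b2, ← hq]; linarith⟩
    · exact ⟨_, .right_two, by rw [hE b2, ← hq]; linarith⟩
    · exact absurd b2 (hpn ▸ a2)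
    · exact ⟨_, .left_two, by rw [hE b2, ← hq]; linarith⟩
    · exact ⟨_, .outer, by rw [hE b2]; linarith⟩
    · exact absurd b2 (hpn ▸ a2)
    · exact absurd a2 (hpn ▸ b2)
    · exact absurd a2 (hpn ▸ b2)
    · refine ⟨_, .outer, ?_⟩
      have : (marked out τ x : ℚ) = 2 := by
        rw [marked, (length_cyc_eq_two hL).1]
        simp [hx, b2]
      rw [this, hex2 hL]
      linarith
  have hE0 : - M.excess x / marked out τ x ≤ 0 :=
    div_nonpos_of_nonpos_of_nonneg (by linarith [hex0 hL]) hs'.le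
  rcases hleft with ⟨a1, a2⟩ | ⟨a1, a2, a3⟩ | ⟨a1, a2, a3⟩ <;>
  rcases hright with ⟨b1, b2⟩ | ⟨b1, b2, b3⟩ | ⟨b1, b2, b3⟩ <;> rw [a1, b1]
  · obtain hL | hL | hL : (cyc τ x).length = 3 ∨ (cyc τ x).length = 4 ∨ 5 ≤ (cyc τ x).length := by
      omega
    · have e : p = τ (τ x) := τ.injective (hp'.trans (length_cyc_eq_three hL).2.symm)
      rw [← e] at n2 ⊢
      exact ⟨_, .inner_three _ n1 n2, by rw [← hq]; linarith⟩
    all_goals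
      have hpn : τ x ≠ p := by
        rintro rfl
        have := length_cyc_le_two hp'
        omega
      have m3 : (marked out τ x : ℚ) + 2 ≤ (cyc τ x).length := by
        exact_mod_cast marked_lt_lt sn b2 sp a2 hpn
    · obtain ⟨e, hex⟩ := hex4 hL hp'
      refine ⟨_, .inner_four _ _ n1 n2 ?_, ?_⟩
      · have := hface _ (hCf _ snn)
        rw [e] at this
        exact this.symm
      · have h4 : (marked out τ x : ℚ) ≤ 2 := by rw [hL] at m3; push_cast at m3; linarith
        have h5 : 0 ≤ M.excess x / 2 := by linarith [hex0 (by omega)]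
        have h6 : - M.excess x / marked out τ x ≤ - (M.excess x / 2) :=
          neg_div_le hs' h4 h5 (by linarith)
        rw [hk] at hex
        rw [← hq]
        rw [hex] at h6 ⊢
        linarith
    · refine ⟨_, .inner_five _ _ n1 n2, ?_⟩
      have h4 : (marked out τ x : ℚ) ≤ (cyc τ x).length - 2 := by linarith
      have h6 : - M.excess x / marked out τ x ≤ - (1 / 4) :=
        neg_div_le hs' h4 (by norm_num) (by linarith [(hex5 hL fun y hy => hface y (hCf y hy)).1])
      rw [← hq]
      linarith
  · exact ⟨_, .right_pen _ n1, by rw [← hq]; linarith⟩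
  · obtain hL | hL | hL : (cyc τ x).length = 3 ∨ (cyc τ x).length = 4 ∨ 5 ≤ (cyc τ x).length := by
      omega
    · have e : p = τ (τ x) := τ.injective (hp'.trans (length_cyc_eq_three hL).2.symm)
      rw [← e] at b3
      exact ⟨_, .right_three _ n1 b3, by rw [← hq]; linarith⟩
    · obtain ⟨e, hex⟩ := hex4 hL hp'
      refine ⟨_, .right_four _ _ n1 ?_ b3, ?_⟩
      · have := hface _ (hCf _ snn)
        rw [e] at this
        exact this
      · have h4 : (marked out τ x : ℚ) ≤ 3 := by
          have := m2 a2
          rw [hL] at this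
          push_cast at this
          linarith
        have h5 : 0 ≤ M.excess x / 3 := by linarith [hex0 (by omega)]
        have h6 : - M.excess x / marked out τ x ≤ - (M.excess x / 3) :=
          neg_div_le hs' h4 h5 (by linarith)
        rw [hk] at hex
        rw [← hq]
        rw [hex] at h6 ⊢
        linarith
    · refine ⟨_, .right_five _ n1, ?_⟩
      have h4 : (marked out τ x : ℚ) ≤ (cyc τ x).length - 1 := by linarith [m2 a2]
      have h6 : - M.excess x / marked out τ x ≤ - (1 / 5) :=
        neg_div_le hs' h4 (by norm_num) (by linarith [(hex5 hL fun y hy => hface y (hCf y hy)).2])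
      rw [← hq]
      linarith
  · exact ⟨_, .left_pen _ n2, by rw [← hq]; linarith⟩
  · exact ⟨_, .outer, by linarith⟩
  · exact ⟨_, .outer, by linarith⟩
  · obtain hL | hL | hL : (cyc τ x).length = 3 ∨ (cyc τ x).length = 4 ∨ 5 ≤ (cyc τ x).length := by
      omega
    · have e : p = τ (τ x) := τ.injective (hp'.trans (length_cyc_eq_three hL).2.symm)
      rw [e] at a3
      exact ⟨_, .left_three _ n2 a3, by rw [← hq]; linarith⟩
    · obtain ⟨e, hex⟩ := hex4 hL hp'
      refine ⟨_, .left_four _ _ n2 ?_ a3, ?_⟩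
      · have := hface _ (hCf _ snn)
        rw [e] at this
        exact this.symm
      · have h4 : (marked out τ x : ℚ) ≤ 3 := by
          have := m1 b2
          rw [hL] at this
          push_cast at this
          linarith
        have h5 : 0 ≤ M.excess x / 3 := by linarith [hex0 (by omega)]
        have h6 : - M.excess x / marked out τ x ≤ - (M.excess x / 3) :=
          neg_div_le hs' h4 h5 (by linarith)
        rw [hk] at hex
        rw [← hq]
        rw [hex] at h6 ⊢
        linarith
    · refine ⟨_, .left_five _ n2, ?_⟩
      have h4 : (marked out τ x : ℚ) ≤ (cyc τ x).length - 1 := by linarith [m1 b2]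
      have h6 : - M.excess x / marked out τ x ≤ - (1 / 5) :=
        neg_div_le hs' h4 (by norm_num) (by linarith [(hex5 hL fun y hy => hface y (hCf y hy)).2])
      rw [← hq]
      linarith
  · exact ⟨_, .outer, by linarith⟩
  · exact ⟨_, .outer, by linarith⟩

end corner
end Diag
end Corners

section Boundary

open Equiv

variable {F : Type*} [Group F] {D : Type*} [Fintype D] [DecidableEq D]

theorem perm_inv_apply (σ : Perm D) (x : D) : σ⁻¹ (σ x) = x := by simp

theorem sum_comp_perm (f : Perm D) (O : Finset D) (hO : ∀ x, f x ∈ O ↔ x ∈ O) (w : D → ℚ) :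
    ∑ x ∈ O, w (f x) = ∑ x ∈ O, w x :=
  Finset.sum_equiv f (fun x => (hO x).symm) fun _ _ => rfl

theorem sum_map_ite_const (l : List D) (out : D → Prop) [DecidablePred out] (c : ℚ) :
    (l.map fun y => if out y then c else 0).sum = (l.filter fun y => decide (out y)).length * c := by
  induction l with
  | nil => simp
  | cons a l ih =>
    simp only [List.map_cons, List.sum_cons, ih, List.filter_cons]
    by_cases ha : out a
    · simp only [ha, decide_true, if_true, List.length_cons]; push_cast; ring
    · simp [ha]

variable {S : Sys F} {ty : D → Fin 4}

namespace Diag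

variable {M : Diag S ty} {out C : D → Prop} [DecidablePred out] {pos : D → Fin 15}

theorem excess_congr {x y : D} (h : (M.σ⁻¹ * M.φ).SameCycle x y) : M.excess x = M.excess y := by
  rw [excess, excess, (cyc_perm h).length_eq, ((cyc_perm h).map _).sum_eq]

theorem Irred.sum_face_le (h : M.Irred out C pos) {x : D} (hx : C x) :
    ((cyc (M.σ⁻¹ * M.φ) x).map fun y =>
      2 / ((cyc (M.σ⁻¹ * M.φ) y).length : ℚ) + (M.angle y - 1)).sum ≤
    ((cyc (M.σ⁻¹ * M.φ) x).map fun y =>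
      if out y then - M.excess y / marked out (M.σ⁻¹ * M.φ) y else 0).sum := by
  have e : (cyc (M.σ⁻¹ * M.φ) x).map (fun y =>
      if out y then - M.excess y / (marked out (M.σ⁻¹ * M.φ) y : ℚ) else 0) =
      (cyc (M.σ⁻¹ * M.φ) x).map fun y =>
      if out y then - M.excess x / (marked out (M.σ⁻¹ * M.φ) x : ℚ) else 0 := by
    refine List.map_congr_left fun y hy => ?_
    rw [← excess_congr (mem_cyc.1 hy), ← marked_congr (mem_cyc.1 hy)]
  rw [sum_cyc_weight (g := fun y => M.angle y - 1), sum_map_sub_one, e, sum_map_ite_const]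
  change _ ≤ (marked out (M.σ⁻¹ * M.φ) x : ℚ) * _
  have e2 : 2 + (((cyc (M.σ⁻¹ * M.φ) x).map M.angle).sum - (cyc (M.σ⁻¹ * M.φ) x).length) =
      - M.excess x := by rw [excess]; ring
  rw [e2]
  by_cases hm : marked out (M.σ⁻¹ * M.φ) x = 0
  · have hno : ∀ y, (M.σ⁻¹ * M.φ).SameCycle x y → ¬ out y := fun y hy ho => by
      have := marked_pos (f := M.σ⁻¹ * M.φ) ho
      rw [← marked_congr hy] at this
      omega
    have h1 := length_cyc_pos (M.σ⁻¹ * M.φ) x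
    have h2 : (cyc (M.σ⁻¹ * M.φ) x).length ≠ 1 := fun e =>
      h.ty_face_ne hx (by rw [length_cyc_eq_one e])
    have h3 : (cyc (M.σ⁻¹ * M.φ) x).length ≠ 2 := fun e =>
      (h.two x hx e).elim (hno _ (Perm.SameCycle.refl _ _)) (hno _ (sameCycle_apply _ _))
    have := M.excess_nonneg (x := x) (by omega)
    rw [hm]
    push_cast
    linarith
  · have : (marked out (M.σ⁻¹ * M.φ) x : ℚ) ≠ 0 := by exact_mod_cast hm
    rw [mul_div_cancel₀ _ this]

theorem Irred.sum_vertex_le (h : M.Irred out C pos) {x : D} (hx : C x) :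
    ((cyc M.σ x).map fun y => 2 / ((cyc M.σ y).length : ℚ) + -1).sum ≤
    ((cyc M.σ x).map fun y => (if out y then M.penalty out y (M.σ y) else 0) +
      if out (M.σ y) then M.penalty out (M.σ y) (M.σ⁻¹ (M.σ y)) else 0).sum := by
  have h2 := h.two_le hx
  have hl : ∀ y, M.σ.SameCycle x y → (cyc M.σ y).length = (cyc M.σ x).length := fun y hy =>
    (cyc_perm hy).length_eq.symm
  have hpt : ∀ y, M.σ.SameCycle x y →
      ((if out y then M.penalty out y (M.σ y) else 0) +
        if out (M.σ y) then M.penalty out (M.σ y) (M.σ⁻¹ (M.σ y)) else 0) =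
      if 3 ≤ (cyc M.σ x).length ∧ ¬ (out y ↔ out (M.σ y)) then -1 / 2 else 0 := fun y hy => by
    simp only [penalty, hl y hy, hl _ (hy.trans (sameCycle_apply _ _)), perm_inv_apply]
    by_cases a : out y <;> by_cases b : out (M.σ y) <;> simp [a, b]
  have e : (cyc M.σ x).map (fun y => (if out y then M.penalty out y (M.σ y) else 0) +
      if out (M.σ y) then M.penalty out (M.σ y) (M.σ⁻¹ (M.σ y)) else 0) = (cyc M.σ x).map fun y =>
      if 3 ≤ (cyc M.σ x).length ∧ ¬ (out y ↔ out (M.σ y)) then (-1 / 2 : ℚ) else 0 :=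
    List.map_congr_left fun y hy => hpt y (mem_cyc.1 hy)
  rw [e]
  obtain h3 | h3 | h3 : (cyc M.σ x).length = 2 ∨ (cyc M.σ x).length = 3 ∨
    4 ≤ (cyc M.σ x).length := by omega
  · refine List.sum_le_sum fun y hy => ?_
    rw [hl y (mem_cyc.1 hy), h3, if_neg (by omega)]
    norm_num
  · obtain ⟨h4, h5⟩ := length_cyc_eq_three h3
    rw [sum_cyc_weight (g := fun _ => -1), h3, h4]
    simp only [List.map_cons, List.map_nil, List.sum_cons, List.sum_nil, h5, le_refl, true_and]
    by_cases a : out x <;> by_cases b : out (M.σ x) <;> by_cases c : out (M.σ (M.σ x)) <;>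
      simp only [a, b, c] <;> norm_num
  · refine List.sum_le_sum fun y hy => ?_
    rw [hl y (mem_cyc.1 hy)]
    have h4 : (4 : ℚ) ≤ (cyc M.σ x).length := by exact_mod_cast h3
    have h5 : 2 / ((cyc M.σ x).length : ℚ) ≤ 1 / 2 := by
      rw [div_le_div_iff₀ (by linarith) (by norm_num)]; linarith
    split_ifs <;> linarith

theorem Irred.sum_node_le (h : M.Irred out C pos) {x : D} (hx : C x) :
    ((cyc M.φ x).map fun y => 2 / ((cyc M.φ y).length : ℚ) + - M.angle y).sum ≤
    ((cyc M.φ x).map fun y =>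
      if out y then 2 / ((cyc M.φ y).length : ℚ) + - M.angle y else 0).sum := by
  have hout : ∀ {y}, M.φ.SameCycle x y → (out y ↔ out x) := fun {y} hy =>
    ⟨fun ho => sameCycle_induction (P := out) (f := M.φ) (fun z => (h.out_φ z).2) hy.symm ho,
      fun ho => sameCycle_induction (P := out) (f := M.φ) (fun z => (h.out_φ z).2) hy ho⟩
  by_cases hd : out x
  · refine le_of_eq (congrArg _ (List.map_congr_left fun y hy => ?_))
    rw [if_pos ((hout (mem_cyc.1 hy)).2 hd)]
  · have hcy : ∀ y, M.φ.SameCycle x y → C y := fun y hy =>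
      sameCycle_induction (P := C) (f := M.φ) (fun z => (h.C_φ z).2) hy hx
    have := (h.good x hx hd).two_le_sum_angle (fun y hy => h.val_ne y (hcy y hy)) fun y hy =>
      (h.ty_ne y (hcy y hy)).symm
    rw [sum_cyc_weight (g := fun y => - M.angle y), sum_map_neg]
    refine le_trans (by linarith) (le_of_eq (Eq.symm (List.sum_eq_zero ?_)))
    simp only [List.mem_map, forall_exists_index, and_imp]
    rintro _ y hy rfl
    rw [if_neg fun h => hd ((hout (mem_cyc.1 hy)).1 h)]

theorem Irred.false {d₀ : D} (h : M.Irred (M.φ.SameCycle d₀) (comp M.φ M.σ d₀) pos) (c : Fin 3)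
    (hq : ∀ i j, 360 * S.q i j = halfDegrees c i j) : False := by
  classical
  let O : Finset D := Finset.univ.filter fun x => comp M.φ M.σ d₀ x
  have hO : ∀ x, x ∈ O ↔ comp M.φ M.σ d₀ x := by simp [O]
  have hcl : ∀ x y, comp M.φ M.σ x y → x ∈ O → y ∈ O := fun x y h hx =>
    (hO y).2 ((comp _ _).trans ((hO x).1 hx) h)
  have hOφ : ∀ x, M.φ x ∈ O ↔ x ∈ O := fun x => by rw [hO, hO, h.C_φ]
  have hOσ : ∀ x, M.σ x ∈ O ↔ x ∈ O := fun x => by rw [hO, hO, h.C_σ]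
  have gb := M.planar.gauss_bonnet d₀ M.angle O hO
  have hn := sum_le_sum_of_cyc M.φ O (fun x y h => hcl x y (comp_of_left h)) _ _
    fun x hx => h.sum_node_le ((hO x).1 hx)
  have hv := sum_le_sum_of_cyc M.σ O (fun x y h => hcl x y (comp_of_right h)) _ _
    fun x hx => h.sum_vertex_le ((hO x).1 hx)
  have hf := sum_le_sum_of_cyc (M.σ⁻¹ * M.φ) O (fun x y h => hcl x y (orb_face_le _ _ h)) _ _
    fun x hx => h.sum_face_le ((hO x).1 hx)
  rw [sum_special M.φ d₀ O (fun x hx => (hO x).2 (comp_of_left hx)) fun x => - M.angle x] at hn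
  rw [Finset.sum_add_distrib (f := fun x => if M.φ.SameCycle d₀ x then
      M.penalty (M.φ.SameCycle d₀) x (M.σ x) else 0), sum_comp_perm M.σ O hOσ fun y =>
      if M.φ.SameCycle d₀ y then M.penalty (M.φ.SameCycle d₀) y (M.σ⁻¹ y) else 0,
    ← sum_comp_perm M.φ O hOφ fun y =>
      if M.φ.SameCycle d₀ y then M.penalty (M.φ.SameCycle d₀) y (M.σ⁻¹ y) else 0] at hv
  let P : D → ℚ := fun x => if M.φ.SameCycle d₀ x then
    (potential c (pos x) (M.state (M.φ.SameCycle d₀) x) : ℚ) / 360 else 0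
  have hP := sum_comp_perm M.φ O hOφ P
  have key : ∑ x ∈ O, ((if M.φ.SameCycle d₀ x then - M.angle x else 0) +
      ((if M.φ.SameCycle d₀ x then M.penalty (M.φ.SameCycle d₀) x (M.σ x) else 0) +
        (if M.φ.SameCycle d₀ (M.φ x) then
          M.penalty (M.φ.SameCycle d₀) (M.φ x) (M.σ⁻¹ (M.φ x)) else 0)) +
      (if M.φ.SameCycle d₀ x then
        - M.excess x / marked (M.φ.SameCycle d₀) (M.σ⁻¹ * M.φ) x else 0)) ≤
      ∑ x ∈ O, (P (M.φ x) - P x) := by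
    refine Finset.sum_le_sum fun x hx => ?_
    by_cases ho : M.φ.SameCycle d₀ x
    · have ho' := (h.out_φ x).2 ho
      obtain ⟨w, hw, hle⟩ := h.corner_bound ho
      simp only [P, if_pos ho, if_pos ho']
      rw [h.ty_pos x ho, h.ty_pos _ ho', funext₂ hq] at hw
      have := hw.le (h.edge x ho)
      rw [Perm.mul_apply] at hle
      linarith
    · have ho' : ¬ M.φ.SameCycle d₀ (M.φ x) := fun h' => ho ((h.out_φ x).1 h')
      simp only [P, if_neg ho, if_neg ho']
      norm_num
  rw [Finset.sum_sub_distrib, hP, sub_self, Finset.sum_add_distrib, Finset.sum_add_distrib,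
    Finset.sum_add_distrib] at key
  linarith

/-- No diagram has a boundary that is a closed walk spelling a cyclic word in `t` and `u`. -/
theorem not_badFree (c : Fin 3) (hq : ∀ i j, 360 * S.q i j = halfDegrees c i j)
    (pos : D → Fin 15) (d₀ : D) : ∀ (n : ℕ) (M : Diag S ty), M.size d₀ = n → M.BadFree d₀ →
      (∀ x, M.φ.SameCycle d₀ x → ty x = posType (pos x) ∧ PosEdge (pos x) (pos (M.φ x)) ∧
        M.val x ≠ 1) → False := by
  intro n
  induction n using Nat.strong_induction_on with
  | _ n ih =>
  intro M hn hB hW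
  have hyp := hyp_all S ty (M.size d₀)
  have hS : ¬ M.Smaller d₀ := by
    rintro ⟨M', h1, h2, h3, h4⟩
    have hmem : ∀ x, M'.φ.SameCycle d₀ x ↔ M.φ.SameCycle d₀ x := fun x => by
      rw [← mem_cyc, ← mem_cyc, h3]
    have hφ : ∀ x ∈ cyc M.φ d₀, M'.φ x = M.φ x := by
      have e1 := (isCyc_cyc M'.φ d₀).2
      rw [h3, ← (isCyc_cyc M.φ d₀).2] at e1
      exact fun x hx => List.map_inj_left.1 e1 x hx
    refine ih _ (hn ▸ h1) M' rfl h2 fun x hx => ?_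
    have hx' := (hmem x).1 hx
    rw [hφ x (mem_cyc.2 hx'), h4 x hx']
    exact hW x hx'
  have hval : ∀ x, comp M.φ M.σ d₀ x → M.val x ≠ 1 := fun x hx h1 => by
    by_cases hs : M.φ.SameCycle d₀ x
    · exact (hW x hs).2.2 h1
    · exact hS ((reduces_of_val_eq_one hyp hB h1 hx).1 hs)
  have hout : ∀ x, M.φ.SameCycle d₀ (M.φ x) ↔ M.φ.SameCycle d₀ x := fun x =>
    Perm.sameCycle_apply_right
  have hty : ∀ x, comp M.φ M.σ d₀ x → ty x ≠ ty (M.φ x) := fun x hx ht => by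
    by_cases hs : M.φ.SameCycle d₀ x
    · have := (hW x hs).2.1.allowed.1
      rw [← (hW x hs).1, ← (hW _ ((hout x).2 hs)).1] at this
      exact this ht
    · exact hS ((reduces_of_ty_eq hyp hB ((hB x hx hs).apply_ne (hval x hx)) ht.symm hx).1 hs)
  have hC : ∀ {x y}, comp M.φ M.σ x y → (comp M.φ M.σ d₀ y ↔ comp M.φ M.σ d₀ x) := fun h =>
    ⟨fun h' => (comp _ _).trans h' ((comp _ _).symm h), fun h' => (comp _ _).trans h' h⟩
  refine Irred.false (M := M) (d₀ := d₀) (pos := pos)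
    ⟨hout, fun x => comp_of_left, fun x => hC (comp_apply_left _ _ x),
      fun x => hC (comp_apply_right _ _ x), hB, hval, hty, ?_, fun x hx => (hW x hx).1,
      fun x hx => (hW x hx).2.1⟩ c hq
  intro x hx h2
  obtain ⟨-, h3, h4⟩ := length_cyc_eq_two h2
  by_contra! hno
  set l' := (M.σ⁻¹ * M.φ) x with hl'
  have e1 : M.φ x = M.σ l' := by rw [hl', Perm.mul_apply, perm_apply_inv]
  have e2 : M.φ l' = M.σ x := by
    rw [← h4, Perm.mul_apply, perm_apply_inv]
  exact hS ((reduces_of_bigon hyp hB h3.symm e1 e2 (hty x hx).symm (apply_vertex_ne (hval x hx))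
    hx).1 hno.1 hno.2)

end Diag
end Boundary

section Angles

variable {A B : Type*} [Group A] [Group B]

/-- An element of one of the two factors. -/
def IsLetter (w : Coprod A B) : Prop :=
  (∃ a : A, Coprod.inl a = w) ∨ ∃ b : B, Coprod.inr b = w

theorem exists_letters (x : Coprod A B) :
    ∃ l : List (Coprod A B), l.prod = x ∧ ∀ w ∈ l, IsLetter w := by
  induction x using Coprod.induction_on with
  | inl a => exact ⟨[Coprod.inl a], by simp, by simp [IsLetter]⟩
  | inr b => exact ⟨[Coprod.inr b], by simp, by simp [IsLetter]⟩
  | mul x y hx hy =>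
    obtain ⟨l, rfl, h1⟩ := hx
    obtain ⟨l', rfl, h2⟩ := hy
    refine ⟨l ++ l', by simp, fun w hw => ?_⟩
    exact (List.mem_append.1 hw).elim (h1 w) (h2 w)

theorem fpLength_le {l : List (Coprod A B)} (hl : ∀ w ∈ l, IsLetter w) :
    fpLength l.prod ≤ l.length :=
  Nat.sInf_le ⟨l, rfl, rfl, hl⟩

theorem exists_fpLength (x : Coprod A B) :
    ∃ l : List (Coprod A B), l.length = fpLength x ∧ l.prod = x ∧ ∀ w ∈ l, IsLetter w := by
  obtain ⟨l, h1, h2⟩ := exists_letters x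
  exact Nat.sInf_mem (s := {n | ∃ l : List (Coprod A B), l.length = n ∧ l.prod = x ∧
    ∀ w ∈ l, (∃ a : A, Coprod.inl a = w) ∨ (∃ b : B, Coprod.inr b = w)}) ⟨l.length, l, rfl, h1, h2⟩

theorem minRelLength_le {N : Subgroup (Coprod A B)} {l : List (Coprod A B)}
    (hl : ∀ w ∈ l, IsLetter w) (hN : l.prod ∈ N) (h1 : l.prod ≠ 1) :
    minRelLength N ≤ l.length :=
  have h : l.prod ∈ {x | x ∈ N ∧ x ≠ 1} := ⟨hN, h1⟩
  (Nat.sInf_le (Set.mem_image_of_mem fpLength h)).trans (fpLength_le hl)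

theorem exists_minRelLength {N : Subgroup (Coprod A B)} (h : ∃ x ∈ N, x ≠ 1) :
    ∃ l : List (Coprod A B), l.length = minRelLength N ∧ l.prod ∈ N ∧ l.prod ≠ 1 ∧
      ∀ w ∈ l, IsLetter w := by
  obtain ⟨x, hx, h1⟩ := h
  obtain ⟨y, hy, e⟩ := Nat.sInf_mem (s := fpLength '' {x | x ∈ N ∧ x ≠ 1}) ⟨_, x, ⟨hx, h1⟩, rfl⟩
  obtain ⟨l, h2, rfl, h3⟩ := exists_fpLength y
  exact ⟨l, h2.trans e, hy.1, hy.2, h3⟩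

theorem gsAngle_eq_zero {N : Subgroup (Coprod A B)} (h : ¬ ∃ x ∈ N, x ≠ 1) : gsAngle N = 0 := by
  rw [gsAngle, if_neg h]

theorem gsAngle_eq {N : Subgroup (Coprod A B)} (h : ∃ x ∈ N, x ≠ 1) :
    gsAngle N = 2 * Real.pi / minRelLength N := by
  rw [gsAngle, if_pos h]

theorem minRelLength_pos {N : Subgroup (Coprod A B)} (h : ∃ x ∈ N, x ≠ 1) :
    0 < minRelLength N := by
  obtain ⟨l, h1, -, h2, -⟩ := exists_minRelLength h
  rw [← h1]
  exact List.length_pos_of_ne_nil (by rintro rfl; exact h2 rfl)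

/-- A short relation forces a large angle. -/
theorem two_le_mul_gsAngle {N : Subgroup (Coprod A B)} {l : List (Coprod A B)}
    (hl : ∀ w ∈ l, IsLetter w) (hN : l.prod ∈ N) (h1 : l.prod ≠ 1) :
    2 * Real.pi ≤ l.length * gsAngle N := by
  have h := minRelLength_le hl hN h1
  have hex : ∃ x ∈ N, x ≠ 1 := ⟨_, hN, h1⟩
  have h0 : (0 : ℝ) < minRelLength N := by exact_mod_cast minRelLength_pos hex
  have h' : (minRelLength N : ℝ) ≤ l.length := by exact_mod_cast h
  rw [gsAngle_eq hex, mul_div_assoc', le_div_iff₀ h0, mul_comm]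
  exact mul_le_mul_of_nonneg_right h' (by positivity)

/-- The two letters are in the same factor. -/
def SameFactor (x y : Coprod A B) : Prop :=
  ((∃ a : A, Coprod.inl a = x) ∧ ∃ a : A, Coprod.inl a = y) ∨
    ((∃ b : B, Coprod.inr b = x) ∧ ∃ b : B, Coprod.inr b = y)

theorem SameFactor.isLetter_mul {x y : Coprod A B} (h : SameFactor x y) : IsLetter (x * y) := by
  rcases h with ⟨⟨a, rfl⟩, b, rfl⟩ | ⟨⟨a, rfl⟩, b, rfl⟩
  · exact Or.inl ⟨a * b, map_mul _ _ _⟩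
  · exact Or.inr ⟨a * b, map_mul _ _ _⟩

theorem minRelLength_le_four {N : Subgroup (Coprod A B)} {a b c d e : Coprod A B}
    (hab : SameFactor a b) (hc : IsLetter c) (hd : IsLetter d) (he : IsLetter e)
    (hN : a * b * c * d * e ∈ N) (h1 : a * b * c * d * e ≠ 1) : minRelLength N ≤ 4 := by
  have e1 : [a * b, c, d, e].prod = a * b * c * d * e := by simp [mul_assoc]
  have := minRelLength_le (N := N) (l := [a * b, c, d, e]) ?_ (e1 ▸ hN) (e1 ▸ h1)
  · exact this
  · simp only [List.mem_cons, List.not_mem_nil, or_false]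
    rintro w (rfl | rfl | rfl | rfl)
    exacts [hab.isLetter_mul, hc, hd, he]

theorem minRelLength_ne_five {N : Subgroup (Coprod A B)} [hN : N.Normal] (h : ∃ x ∈ N, x ≠ 1) :
    minRelLength N ≠ 5 := by
  intro h5
  obtain ⟨l, h1, h2, h3, h4⟩ := exists_minRelLength h
  rw [h5] at h1
  match l, h1 with
  | [a, b, c, d, e], _ =>
    simp only [List.mem_cons, List.not_mem_nil, or_false, forall_eq_or_imp, forall_eq] at h4
    obtain ⟨ha, hb, hc, hd, he⟩ := h4
    have hw : a * b * c * d * e ∈ N := by simpa [mul_assoc] using h2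
    have hw1 : a * b * c * d * e ≠ 1 := by simpa [mul_assoc] using h3
    have rot : ∀ {a b c d e : Coprod A B}, a * b * c * d * e ∈ N → a * b * c * d * e ≠ 1 →
        b * c * d * e * a ∈ N ∧ b * c * d * e * a ≠ 1 := by
      intro a b c d e h h'
      refine ⟨?_, fun h1 => h' ?_⟩
      · have := hN.mem_comm (a := a) (b := b * c * d * e) (by simpa only [mul_assoc] using h)
        simpa only [mul_assoc] using this
      · have := eq_inv_of_mul_eq_one_left h1
        have : b * c * d * e = a⁻¹ := this
        simp only [mul_assoc] at this ⊢
        rw [this, mul_inv_cancel]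
    obtain ⟨r1, r1'⟩ := rot hw hw1
    obtain ⟨r2, r2'⟩ := rot r1 r1'
    obtain ⟨r3, r3'⟩ := rot r2 r2'
    obtain ⟨r4, r4'⟩ := rot r3 r3'
    have : SameFactor a b ∨ SameFactor b c ∨ SameFactor c d ∨ SameFactor d e ∨ SameFactor e a := by
      rcases ha with ha | ha <;> rcases hb with hb | hb <;> rcases hc with hc | hc <;>
        rcases hd with hd | hd <;> rcases he with he | he <;> simp [SameFactor, ha, hb, hc, hd, he]
    have : minRelLength N ≤ 4 := by
      rcases this with h | h | h | h | h
      · exact minRelLength_le_four h hc hd he hw hw1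
      · exact minRelLength_le_four h hd he ha r1 r1'
      · exact minRelLength_le_four h he ha hb r2 r2'
      · exact minRelLength_le_four h ha hb hc r3 r3'
      · exact minRelLength_le_four h hb hc hd r4 r4'
    omega

theorem gsAngle_cases {N : Subgroup (Coprod A B)} [N.Normal] (h : gsAngle N ≤ Real.pi / 2) :
    gsAngle N = 0 ∨ ∃ m : ℕ, 4 ≤ m ∧ m ≠ 5 ∧ gsAngle N = Real.pi * (2 / m) := by
  by_cases hex : ∃ x ∈ N, x ≠ 1
  · refine Or.inr ⟨minRelLength N, ?_, minRelLength_ne_five hex, ?_⟩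
    · rw [gsAngle_eq hex] at h
      have h0 : (0 : ℝ) < minRelLength N := by exact_mod_cast minRelLength_pos hex
      rw [div_le_div_iff₀ h0 (by norm_num)] at h
      have : (4 : ℝ) ≤ minRelLength N := by nlinarith [Real.pi_pos]
      exact_mod_cast this
    · rw [gsAngle_eq hex]; ring
  · exact Or.inl (gsAngle_eq_zero hex)

theorem angle_arith {t a b : ℝ} (ht : t = 0 ∨ ∃ m : ℕ, 4 ≤ m ∧ m ≠ 5 ∧ t = 2 / m)
    (ha : a = 0 ∨ ∃ m : ℕ, 4 ≤ m ∧ m ≠ 5 ∧ a = 2 / m)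
    (hb : b = 0 ∨ ∃ m : ℕ, 4 ≤ m ∧ m ≠ 5 ∧ b = 2 / m)
    (hsum : t + a + b = 1) (hba : b ≤ a) (hat : a ≤ t) (hne : ¬ (t = 1 / 2 ∧ a = 1 / 2)) :
    (t = 1 / 3 ∧ a = 1 / 3 ∧ b = 1 / 3) ∨ (t = 1 / 2 ∧ a = 1 / 4 ∧ b = 1 / 4) ∨
      (t = 1 / 2 ∧ a = 1 / 3 ∧ b = 1 / 6) := by
  have bound : ∀ {m k : ℕ} {s : ℝ}, 4 ≤ m → s = 2 / m → 2 / (k : ℝ) ≤ s → 0 < k → m ≤ k := by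
    intro m k s hm hs h hk
    have h1 : (0 : ℝ) < m := by exact_mod_cast (by omega : 0 < m)
    have h2 : (0 : ℝ) < k := by exact_mod_cast hk
    rw [hs, div_le_div_iff₀ h2 h1] at h
    have : (m : ℝ) ≤ k := by linarith
    exact_mod_cast this
  obtain ht | ⟨m, hm4, hm5, hm⟩ := ht
  · exfalso; linarith
  have hm6 : m ≤ 6 := bound (k := 6) hm4 hm (by norm_num; linarith) (by norm_num)
  have ht' : t = 1 / 2 ∨ t = 1 / 3 := by
    have : m = 4 ∨ m = 6 := by omega
    rcases this with rfl | rfl <;> norm_num at hm <;> norm_num [hm]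
  obtain ha | ⟨n, hn4, hn5, hn⟩ := ha
  · exfalso; rcases ht' with h | h <;> linarith
  have hn8 : n ≤ 8 := bound (k := 8) hn4 hn (by norm_num; rcases ht' with h | h <;> linarith)
    (by norm_num)
  have ha' : a = 1 / 2 ∨ a = 1 / 3 ∨ a = 2 / 7 ∨ a = 1 / 4 := by
    have : n = 4 ∨ n = 6 ∨ n = 7 ∨ n = 8 := by omega
    rcases this with rfl | rfl | rfl | rfl <;> norm_num at hn <;> norm_num [hn]
  rcases ht' with rfl | rfl <;> rcases ha' with rfl | rfl | rfl | rfl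
  · exact absurd ⟨rfl, rfl⟩ hne
  · exact Or.inr (Or.inr ⟨rfl, rfl, by linarith⟩)
  · exfalso
    have hb' : b = 3 / 14 := by linarith
    obtain hb | ⟨k, hk4, -, hk⟩ := hb
    · norm_num [hb'] at hb
    · have h1 : (0 : ℝ) < k := by exact_mod_cast (by omega : 0 < k)
      rw [hb', eq_div_iff h1.ne'] at hk
      have : 3 * k = 28 := by
        have : (3 * k : ℝ) = 28 := by linarith
        exact_mod_cast this
      omega
  · exact Or.inr (Or.inl ⟨rfl, rfl, by linarith⟩)
  · exfalso; linarith
  · exact Or.inl ⟨rfl, rfl, by linarith⟩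
  · exfalso; linarith
  · exfalso; linarith

end Angles

section FreeProduct

theorem coprodI_prod_ne_one {ι : Type*} {G : ι → Type*} [∀ i, Group (G i)]
    {l : List (ι × CoprodI G)} (hl : l ≠ [])
    (h : ∀ x ∈ l, x.2 ∈ (CoprodI.of : G x.1 →* CoprodI G).range ∧ x.2 ≠ 1)
    (hc : (l.map Prod.fst).IsChain (· ≠ ·)) : (l.map Prod.snd).prod ≠ 1 := by
  classical
  have : ∃ l' : List (Σ i, G i), l'.map (fun s => (s.1, (CoprodI.of s.2 : CoprodI G))) = l := by
    have e : l ∈ Set.range (List.map fun s : Σ i, G i => (s.1, (CoprodI.of s.2 : CoprodI G))) := by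
      rw [Set.range_list_map]
      rintro ⟨i, x⟩ hx
      obtain ⟨⟨g, hg⟩, -⟩ := h _ hx
      exact ⟨⟨i, g⟩, by simpa using hg⟩
    exact e
  obtain ⟨l', rfl⟩ := this
  let w : CoprodI.Word G := ⟨l', fun s hs h1 => ?_, ?_⟩
  · have hw : (l'.map fun s => (CoprodI.of s.2 : CoprodI G)).prod = w.prod := rfl
    rw [List.map_map]
    change (l'.map fun s => (CoprodI.of s.2 : CoprodI G)).prod ≠ 1
    rw [hw, ← CoprodI.Word.prod_empty]
    intro e
    have := CoprodI.Word.equiv.symm.injective (a₁ := w) (a₂ := CoprodI.Word.empty) e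
    apply hl
    have : l' = [] := congrArg CoprodI.Word.toList this
    rw [this, List.map_nil]
  · have := (h (s.1, CoprodI.of s.2) (List.mem_map.2 ⟨s, hs, rfl⟩)).2
    exact this (by simp [h1])
  · rw [List.map_map, List.isChain_map] at hc
    exact hc

variable {ι : Type*} [DecidableEq ι] (G : ι → Type*) [∀ i, Group (G i)]

/-- The retraction of the free product onto the free product of two factors. -/
def edgeProj (i j : ι) : CoprodI G →* Coprod (G i) (G j) :=
  CoprodI.lift fun k =>
    if h : k = i then Coprod.inl.comp (h ▸ MonoidHom.id (G k))
    else if h : k = j then Coprod.inr.comp (h ▸ MonoidHom.id (G k)) else 1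

theorem edgeProj_left (i j : ι) (g : G i) : edgeProj G i j (CoprodI.of g) = Coprod.inl g := by
  simp [edgeProj]

theorem edgeProj_right {i j : ι} (h : i ≠ j) (g : G j) :
    edgeProj G i j (CoprodI.of g) = Coprod.inr g := by
  simp [edgeProj, h.symm]

theorem edgeProj_edgeEmb {i j : ι} (h : i ≠ j) (x : Coprod (G i) (G j)) :
    edgeProj G i j (edgeEmb G i j x) = x := by
  have : (edgeProj G i j).comp (edgeEmb G i j) = MonoidHom.id _ := by
    apply Coprod.hom_ext <;> ext g <;> simp [edgeEmb, edgeProj_left, edgeProj_right G h]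
  exact DFunLike.congr_fun this x

theorem edgeEmb_inl (i j : ι) (g : G i) : edgeEmb G i j (Coprod.inl g) = CoprodI.of g := by
  simp [edgeEmb]

theorem edgeEmb_inr (i j : ι) (g : G j) : edgeEmb G i j (Coprod.inr g) = CoprodI.of g := by
  simp [edgeEmb]

theorem swap_edgeProj {i j : ι} (h : i ≠ j) (x : CoprodI G) :
    Coprod.swap _ _ (edgeProj G i j x) = edgeProj G j i x := by
  have : (Coprod.swap _ _).comp (edgeProj G i j) = edgeProj G j i := by
    apply CoprodI.ext_hom
    intro k
    ext g
    by_cases hi : k = i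
    · subst hi
      simp [edgeProj_left, edgeProj_right G h.symm]
    · by_cases hj : k = j
      · subst hj
        simp [edgeProj_left, edgeProj_right G h]
      · simp [edgeProj, hi, hj]
  exact DFunLike.congr_fun this x

/-- Either of the two factors. -/
theorem edge_letter {i j : ι} (h : i ≠ j) {k : ι} (hk : k = i ∨ k = j) {x : CoprodI G}
    (hx : x ∈ (CoprodI.of : G k →* CoprodI G).range) :
    IsLetter (edgeProj G i j x) ∧ edgeEmb G i j (edgeProj G i j x) = x := by
  obtain ⟨g, rfl⟩ := hx
  rcases hk with rfl | rfl
  · rw [edgeProj_left, edgeEmb_inl]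
    exact ⟨Or.inl ⟨g, rfl⟩, rfl⟩
  · rw [edgeProj_right G h, edgeEmb_inr]
    exact ⟨Or.inr ⟨g, rfl⟩, rfl⟩

end FreeProduct

section PrideSys

variable {G : Fin 4 → Type*} [∀ i, Group (G i)] (R : ∀ i j : Fin 4, Set (Coprod (G i) (G j)))

/-- The subgroups of the free product given by the edge relations. -/
def edgeSubgroup (i j : Fin 4) : Subgroup (CoprodI G) :=
  (Subgroup.normalClosure (R i j)).comap (edgeProj G i j)

variable {R}

theorem edgeSubgroup_le_symm (hsw : ∀ i j, (Coprod.swap (G i) (G j)) '' R i j = R j i)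
    (i j : Fin 4) : edgeSubgroup R i j ≤ edgeSubgroup R j i := by
  by_cases h : i = j
  · subst h; exact le_rfl
  · intro x hx
    rw [edgeSubgroup, Subgroup.mem_comap] at hx ⊢
    rw [← swap_edgeProj G h, ← hsw i j,
      ← Subgroup.map_normalClosure _ (Coprod.swap (G i) (G j)) Coprod.swap_surjective]
    exact Subgroup.mem_map_of_mem _ hx

/-- The data of a Pride group on four vertices. -/
def prideSys (hsw : ∀ i j, (Coprod.swap (G i) (G j)) '' R i j = R j i) (q : Fin 4 → Fin 4 → ℚ)
    (q_symm : ∀ i j, q i j = q j i) (q_self : ∀ i, q i i = 0) (q_le : ∀ i j, q i j ≤ 1 / 2)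
    (q_tri : ∀ i j k, i ≠ j → j ≠ k → i ≠ k → q i j + q j k + q k i = 1)
    (hang : ∀ i j, i ≠ j → gsAngle (Subgroup.normalClosure (R i j)) = Real.pi * q i j) :
    Sys (CoprodI G) where
  H i := (CoprodI.of : G i →* CoprodI G).range
  K := edgeSubgroup R
  q := q
  normal i j := Subgroup.normal_comap _
  symm i j := le_antisymm (edgeSubgroup_le_symm hsw i j) (edgeSubgroup_le_symm hsw j i)
  inf i j hij x hx hK := by
    by_contra h1
    obtain ⟨h2, h3⟩ := edge_letter G hij (Or.inl rfl) hx
    have hN : edgeProj G i j x ∈ Subgroup.normalClosure (R i j) := hK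
    have hne : edgeProj G i j x ≠ 1 := fun e => h1 (by rw [← h3, e, map_one])
    have := two_le_mul_gsAngle (l := [edgeProj G i j x]) (by simpa using h2) (by simpa using hN)
      (by simpa using hne)
    rw [hang i j hij] at this
    have hq : (q i j : ℝ) ≤ 1 / 2 := by
      have : ((q i j : ℚ) : ℝ) ≤ ((1 / 2 : ℚ) : ℝ) := by exact_mod_cast q_le i j
      simpa using this
    simp only [List.length_singleton, Nat.cast_one, one_mul] at this
    nlinarith [Real.pi_pos]
  q_symm := q_symm
  q_self := q_self
  q_le := q_le
  q_tri := q_tri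
  length i j hij l hl h hc hK := by
    have h1 := coprodI_prod_ne_one hl (fun x hx => (h x hx).2) hc
    have hlet := fun x hx => edge_letter G hij (h x hx).1 (h x hx).2.1
    have e : (l.map fun x => edgeProj G i j x.2).prod = edgeProj G i j (l.map Prod.snd).prod := by
      rw [map_list_prod, List.map_map]
      rfl
    have e2 : edgeEmb G i j (l.map fun x => edgeProj G i j x.2).prod = (l.map Prod.snd).prod := by
      rw [map_list_prod, List.map_map]
      exact congrArg _ (List.map_congr_left fun x hx => (hlet x hx).2)
    have := two_le_mul_gsAngle (N := Subgroup.normalClosure (R i j))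
      (l := l.map fun x => edgeProj G i j x.2) ?_ ?_ ?_
    · rw [hang i j hij, List.length_map] at this
      have h2 : (2 : ℝ) ≤ l.length * q i j := by
        have := Real.pi_pos
        nlinarith
      exact_mod_cast h2
    · intro w hw
      obtain ⟨x, hx, rfl⟩ := List.mem_map.1 hw
      exact (hlet x hx).1
    · rw [e]; exact hK
    · intro h3
      rw [h3, map_one] at e2
      exact h1 e2.symm

/-- Each relator is a product of letters of two types forming an edge relation. -/
theorem exists_letters_of_mem_prideRels (h0 : ∀ i, R i i = ∅) {r : CoprodI G}
    (hr : r ∈ prideRels G R) : ∃ (i j : Fin 4) (l : List (Fin 4 × CoprodI G)), i ≠ j ∧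
      (∀ x ∈ l, (x.1 = i ∨ x.1 = j) ∧ x.2 ∈ (CoprodI.of : G x.1 →* CoprodI G).range) ∧
      (l.map Prod.snd).prod = r ∧ r ∈ edgeSubgroup R i j := by
  simp only [prideRels, Set.mem_iUnion] at hr
  obtain ⟨i, j, w, hw, rfl⟩ := hr
  have hij : i ≠ j := by
    rintro rfl
    rw [h0] at hw
    exact hw
  have key : ∀ w : Coprod (G i) (G j), ∃ l : List (Fin 4 × CoprodI G),
      (∀ x ∈ l, (x.1 = i ∨ x.1 = j) ∧ x.2 ∈ (CoprodI.of : G x.1 →* CoprodI G).range) ∧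
      (l.map Prod.snd).prod = edgeEmb G i j w := by
    intro w
    induction w using Coprod.induction_on with
    | inl a => exact ⟨[(i, CoprodI.of a)], by simp, by simp [edgeEmb_inl]⟩
    | inr b => exact ⟨[(j, CoprodI.of b)], by simp, by simp [edgeEmb_inr]⟩
    | mul x y hx hy =>
      obtain ⟨l, h1, h2⟩ := hx
      obtain ⟨l', h3, h4⟩ := hy
      refine ⟨l ++ l', fun x hx => (List.mem_append.1 hx).elim (h1 x) (h3 x), ?_⟩
      rw [List.map_append, List.prod_append, h2, h4, map_mul]
  obtain ⟨l, h1, h2⟩ := key w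
  refine ⟨i, j, l, hij, h1, h2, ?_⟩
  rw [edgeSubgroup, Subgroup.mem_comap, edgeProj_edgeEmb G hij]
  exact Subgroup.subset_normalClosure hw

end PrideSys

section Existence

open Equiv

variable {F : Type*} [Group F] {D : Type*} [Fintype D] [DecidableEq D]

theorem planar_one : Planar (1 : Perm D) 1 := by
  have : comp (1 : Perm D) 1 = orb 1 := sup_idem _
  rw [Planar, this, inv_one, one_mul]
  have h : cnt (orb (1 : Perm D)) = Nat.card D :=
    (Nat.card_congr (Equiv.ofBijective (Quotient.mk (orb (1 : Perm D)))
      ⟨fun a b h => orb_one_apply.1 (Quotient.exact h), Quotient.mk_surjective⟩)).symm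
  rw [h]
  omega

theorem insert_apply_of_ne (f : Perm D) {a b x : D} (ha : x ≠ a) (hb : x ≠ b) :
    (f * swap a b) x = f x := by
  rw [Perm.mul_apply, swap_apply_of_ne_of_ne ha hb]

theorem IsCyc.insert {f : Perm D} {a b : D} {A : List D} (h : IsCyc f (a :: A)) (hb : f b = b)
    (hab : a ≠ b) : IsCyc (f * swap a b) (a :: b :: A) := by
  have hbA : b ∉ A := by
    intro hb'
    have : f.SameCycle b a := h.sameCycle (List.mem_cons_of_mem _ hb') List.mem_cons_self
    exact hab (eq_of_sameCycle_fixed hb this).symm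
  obtain ⟨h1, h2⟩ := h
  rw [List.nodup_cons] at h1
  refine ⟨?_, ?_⟩
  · simp only [List.nodup_cons, List.mem_cons, not_or]
    exact ⟨⟨hab, h1.1⟩, hbA, h1.2⟩
  · have e : A.map (f * swap a b) = A.map f := List.map_congr_left fun x hx =>
      insert_apply_of_ne f (fun e => h1.1 (e ▸ hx)) fun e => hbA (e ▸ hx)
    rw [List.map_cons, List.map_cons, e, Perm.mul_apply, Perm.mul_apply, swap_apply_left,
      swap_apply_right, hb]
    simpa using h2

theorem insert_eq (f : Perm D) {a b : D} (hb : f b = b) : f * swap a b = swap (f a) b * f := by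
  rw [Equiv.mul_swap_eq_swap_mul, hb]

theorem word_insert {f : Perm D} {a b : D} {v v' : D → F} (hb : f b = b) (hab : a ≠ b)
    (ha : v' a = v a * v b) (hv : ∀ x, x ≠ a → x ≠ b → v' x = v x) :
    word v (f * swap a b) a = word v' f a := by
  obtain ⟨A, hA⟩ := exists_cyc_eq_cons f a
  have h : IsCyc f (a :: A) := hA ▸ isCyc_cyc f a
  have h' := h.insert hb hab
  have hn := h'.1
  simp only [List.nodup_cons, List.mem_cons, not_or] at hn
  rw [word, word, h'.cyc_eq, hA]
  simp only [List.map_cons, List.prod_cons]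
  rw [ha, mul_assoc]
  congr 3
  exact List.map_congr_left fun x hx =>
    (hv x (fun e => hn.1.2 (e ▸ hx)) fun e => hn.2.1 (e ▸ hx)).symm

theorem word_insert_of_not {f : Perm D} {a b x : D} {v v' : D → F} (hb : f b = b)
    (hv : ∀ x, x ≠ a → x ≠ b → v' x = v x) (hx : ¬ f.SameCycle x a) (hxb : x ≠ b) :
    word v (f * swap a b) x = word v' f x := by
  have hb' : ¬ f.SameCycle x b := fun h => hxb (eq_of_sameCycle_fixed hb h.symm).symm
  have hc : cyc (f * swap a b) x = cyc f x := by
    rw [insert_eq f hb]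
    exact cyc_swap_mul_of_not (fun h => hx (Perm.sameCycle_apply_right.1 h)) hb'
  refine word_congr hc fun y hy => (hv y ?_ ?_).symm
  · rintro rfl; exact hx hy
  · rintro rfl; exact hb' hy

theorem sameCycle_insert {f : Perm D} {a b : D} (hb : f b = b) :
    (f * swap a b).SameCycle a b := by
  have : (f * swap a b) a = b := by rw [Perm.mul_apply, swap_apply_left, hb]
  have h := sameCycle_apply (f * swap a b) a
  rwa [this] at h

theorem word_insert_all {f : Perm D} {a b : D} {v v' : D → F} (hb : f b = b) (hab : a ≠ b)
    (ha : v' a = v a * v b) (hv : ∀ x, x ≠ a → x ≠ b → v' x = v x)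
    (h : ∀ x, x ≠ b → word v' f x = 1) (x : D) : word v (f * swap a b) x = 1 := by
  have h1 : word v (f * swap a b) a = 1 := by rw [word_insert hb hab ha hv, h a hab]
  by_cases hxb : x = b
  · rw [hxb, ← word_eq_one_iff v (sameCycle_insert hb), h1]
  by_cases hx : f.SameCycle x a
  · obtain ⟨A, hA⟩ := exists_cyc_eq_cons f a
    have hc : IsCyc f (a :: A) := hA ▸ isCyc_cyc f a
    have h' := hc.insert hb hab
    have hxA : x ∈ a :: A := by rw [← hA, mem_cyc]; exact hx.symm
    have : (f * swap a b).SameCycle a x := h'.sameCycle List.mem_cons_self (by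
      rcases List.mem_cons.1 hxA with h | h <;> simp [h])
    rw [← word_eq_one_iff v this, h1]
  · rw [word_insert_of_not hb hv hx hxb, h x hxb]

theorem word_of_insert {f : Perm D} {a b : D} {v v' : D → F} (hb : f b = b) (hab : a ≠ b)
    (ha : v' a = v a * v b) (hv : ∀ x, x ≠ a → x ≠ b → v' x = v x)
    (h : ∀ x, word v (f * swap a b) x = 1) {x : D} (hxb : x ≠ b) : word v' f x = 1 := by
  by_cases hx : f.SameCycle x a
  · rw [word_eq_one_iff v' hx, ← word_insert hb hab ha hv, h]
  · rw [← word_insert_of_not hb hv hx hxb, h]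

/-- If all nodes read the trivial element of a free product, the nodes can be filled with
planar vertices. -/
theorem exists_vertices (H : Fin 4 → Subgroup F)
    (hF : ∀ l : List (Fin 4 × F), l ≠ [] → (∀ x ∈ l, x.2 ∈ H x.1 ∧ x.2 ≠ 1) →
      (l.map Prod.fst).IsChain (· ≠ ·) → (l.map Prod.snd).prod ≠ 1) (ty : D → Fin 4) :
    ∀ (n : ℕ) (φ : Perm D) (v : D → F), φ.support.card = n → (∀ d, v d ∈ H (ty d)) →
      (∀ d, word v φ d = 1) → ∃ σ : Perm D, Planar φ σ ∧ orb σ ≤ orb φ ∧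
        (∀ d, ty (σ d) = ty d) ∧ ∀ d, word v σ d = 1 := by
  intro n
  induction n using Nat.strong_induction_on with
  | _ n ih =>
  intro φ v hn hv hw
  by_cases hφ : φ = 1
  · subst hφ
    exact ⟨1, planar_one, le_rfl, fun _ => rfl, hw⟩
  obtain ⟨d, hd⟩ : ∃ d, φ d ≠ d := by
    by_contra! h
    exact hφ (Equiv.ext h)
  have step : ∃ a b, φ a = b ∧ a ≠ b ∧ (v b = 1 ∨ ty a = ty b) := by
    by_contra! h
    have hne : ∀ x, φ.SameCycle d x → v x ≠ 1 := by
      intro x hx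
      have hfx : φ x ≠ x := fun e => by
        have := eq_of_sameCycle_fixed e hx.symm
        subst this
        exact hd e
      refine (h (φ⁻¹ x) x (perm_apply_inv φ x) ?_).1
      intro e
      apply hfx
      rw [← e, perm_apply_inv, e]
    refine hF ((cyc φ d).map fun x => (ty x, v x)) ?_ ?_ ?_ ?_
    · simp [cyc]
    · intro y hy
      obtain ⟨x, hx, rfl⟩ := List.mem_map.1 hy
      exact ⟨hv x, hne x (mem_cyc.1 hx)⟩
    · rw [List.map_map, List.isChain_map, List.isChain_iff_getElem]
      intro i hi
      obtain ⟨hnd, hrot⟩ := isCyc_cyc φ d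
      have e : φ (cyc φ d)[i] = (cyc φ d)[i + 1] := by
        have h1 : ((cyc φ d).map φ)[i]'(by simp; omega) =
            ((cyc φ d).rotate 1)[i]'(by simp; omega) := by simp only [hrot]
        rw [List.getElem_map, List.getElem_rotate] at h1
        rw [h1]
        congr 1
        exact Nat.mod_eq_of_lt hi
      refine (h _ _ e ?_).2
      intro e'
      have := (hnd.getElem_inj_iff).1 e'
      omega
    · rw [List.map_map]
      exact hw d
  obtain ⟨a, b, hab, hne, hor⟩ := step
  have hbb : φ b ≠ b := fun e => hne (φ.injective (hab.trans e.symm))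
  obtain ⟨φ', rfl⟩ : ∃ φ', φ = φ' * swap a b := ⟨φ * swap a b, by rw [mul_assoc, swap_mul_self, mul_one]⟩
  have hb : φ' b = b := by rwa [Perm.mul_apply, swap_apply_left] at hab
  have hlt : φ'.support.card < n := by
    rw [← hn]
    refine Finset.card_lt_card (Finset.ssubset_iff_of_subset ?_ |>.2
      ⟨b, Perm.mem_support.2 hbb, by simp [hb]⟩)
    intro x hx
    rw [Perm.mem_support] at hx ⊢
    by_cases hxa : x = a
    · rw [hxa, hab]; exact hne.symm
    · rwa [insert_apply_of_ne _ hxa fun e => hx (e ▸ hb)]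
  have sc : (φ' * swap a b).SameCycle a b := sameCycle_insert hb
  have hsub : ∀ σ : Perm D, orb σ ≤ orb φ' → σ b = b := by
    intro σ h
    exact (eq_of_sameCycle_fixed hb (h (sameCycle_apply σ b))).symm
  have hle : orb φ' ≤ orb (φ' * swap a b) := by
    apply orb_le
    intro x
    by_cases hxa : x = a
    · have := sameCycle_apply (φ' * swap a b) b
      rw [Perm.mul_apply, swap_apply_right] at this
      rw [hxa]
      exact sc.trans this
    · by_cases hxb : x = b
      · rw [hxb, hb]
      · rw [← insert_apply_of_ne φ' hxa hxb]
        exact sameCycle_apply _ x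
  have hpl : ∀ σ : Perm D, Planar φ' σ → orb σ ≤ orb φ' → Planar (φ' * swap a b) σ := by
    intro σ hσ hσ'
    rw [insert_eq φ' hb]
    apply hσ.merge_comp
    intro hc
    have : b = φ' a := sameCycle_of_comp_apply ((comp _ _).symm hc) hb (hsub σ hσ')
    exact hne (φ'.injective (by rw [hb, ← this]))
  rcases hor with h1 | hty
  · obtain ⟨σ, h2, h3, h4, h5⟩ := ih _ hlt φ' v rfl hv fun x => by
      by_cases hxb : x = b
      · rw [hxb, word_of_fixed v hb, h1]
      · exact word_of_insert (v := v) hb hne (by rw [h1, mul_one]) (fun _ _ _ => rfl) hw hxb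
    exact ⟨σ, hpl σ h2 h3, h3.trans hle, h4, h5⟩
  · let v' : D → F := fun x => if x = a then v a * v b else if x = b then 1 else v x
    have ha' : v' a = v a * v b := if_pos rfl
    have hb' : v' b = 1 := by simp only [v', if_neg hne.symm, if_pos]
    have hx' : ∀ x, x ≠ a → x ≠ b → v' x = v x := fun x h1 h2 => by
      simp only [v', if_neg h1, if_neg h2]
    obtain ⟨σ, h2, h3, h4, h5⟩ := ih _ hlt φ' v' rfl (fun x => by
      by_cases hxa : x = a
      · rw [hxa, ha']
        exact mul_mem (hv a) (hty ▸ hv b)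
      · by_cases hxb : x = b
        · rw [hxb, hb']; exact one_mem _
        · rw [hx' x hxa hxb]; exact hv x) fun x => by
      by_cases hxb : x = b
      · rw [hxb, word_of_fixed v' hb, hb']
      · exact word_of_insert hb hne ha' hx' hw hxb
    have hσb := hsub σ h3
    refine ⟨σ * swap a b, ?_, ?_, fun x => ?_,
      word_insert_all hσb hne ha' hx' fun x _ => h5 x⟩
    · rw [insert_eq σ hσb]
      refine ((hpl σ h2 h3).symm.merge_face ?_ ?_).symm
      · intro h
        have := eq_of_sameCycle_fixed hσb h.symm
        exact hne (σ.injective (by rw [hσb, ← this]))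
      · have e : (φ' * swap a b)⁻¹ b = a := by
          exact Perm.inv_eq_iff_eq.2 hab.symm
        rw [e]
        exact (sameCycle_apply ((φ' * swap a b)⁻¹ * σ) a).symm
    · apply orb_le
      intro x
      by_cases hxa : x = a
      · rw [hxa, Perm.mul_apply, swap_apply_left, hσb]; exact sc
      · by_cases hxb : x = b
        · rw [hxb, Perm.mul_apply, swap_apply_right]
          exact sc.symm.trans (hle (h3 (sameCycle_apply σ a)))
        · rw [insert_apply_of_ne _ hxa hxb]
          exact hle (h3 (sameCycle_apply σ x))
    · by_cases hxa : x = a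
      · rw [hxa, Perm.mul_apply, swap_apply_left, hσb, hty]
      · by_cases hxb : x = b
        · rw [hxb, Perm.mul_apply, swap_apply_right, h4, hty]
        · rw [insert_apply_of_ne _ hxa hxb, h4]

end Existence

section Null

open Equiv

variable {F : Type*} [Group F]

/-- Products of letters built by nesting the edge relations. -/
inductive Null (S : Sys F) : List (Fin 4 × F) → Prop
  | nil : Null S []
  | ins (P L Q : List (Fin 4 × F)) (i j : Fin 4) (hij : i ≠ j)
      (hL : ∀ x ∈ L, x.1 = i ∨ x.1 = j) (hK : (L.map Prod.snd).prod ∈ S.K i j)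
      (h : Null S (P ++ Q)) : Null S (P ++ L ++ Q)

/-- The formal inverse of a list of letters. -/
def linv (L : List (Fin 4 × F)) : List (Fin 4 × F) := (L.map fun x => (x.1, x.2⁻¹)).reverse

theorem linv_append (L L' : List (Fin 4 × F)) : linv (L ++ L') = linv L' ++ linv L := by
  simp [linv]

theorem mem_linv {L : List (Fin 4 × F)} {x : Fin 4 × F} : x ∈ linv L ↔ (x.1, x.2⁻¹) ∈ L := by
  simp only [linv, List.mem_reverse, List.mem_map]
  constructor
  · rintro ⟨y, hy, rfl⟩
    simpa using hy
  · intro h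
    exact ⟨_, h, by simp⟩

theorem prod_linv (L : List (Fin 4 × F)) :
    ((linv L).map Prod.snd).prod = ((L.map Prod.snd).prod)⁻¹ := by
  rw [List.prod_inv_reverse, linv, List.map_reverse, List.map_map, List.map_map]
  rfl

variable {S : Sys F}

theorem Null.append {L L' : List (Fin 4 × F)} (h : Null S L) (h' : Null S L') :
    Null S (L ++ L') := by
  induction h' with
  | nil => simpa using h
  | ins P M Q i j hij hM hK _ ih =>
    have := Null.ins (L ++ P) M Q i j hij hM hK (by simpa using ih)
    simpa using this

theorem Null.inv {L : List (Fin 4 × F)} (h : Null S L) : Null S (linv L) := by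
  induction h with
  | nil => exact Null.nil
  | ins P M Q i j hij hM hK _ ih =>
    rw [linv_append] at ih ⊢
    rw [linv_append, ← List.append_assoc]
    refine Null.ins _ _ _ i j hij (fun x hx => hM (x.1, x.2⁻¹) (mem_linv.1 hx)) ?_ ih
    rw [prod_linv]
    exact inv_mem hK

theorem Null.conj_single {L : List (Fin 4 × F)} (h : Null S L) (x : Fin 4 × F) :
    Null S ([x] ++ L ++ [(x.1, x.2⁻¹)]) := by
  have base : Null S [x, (x.1, x.2⁻¹)] := by
    have := Null.ins (S := S) [] [x, (x.1, x.2⁻¹)] [] x.1 (x.1 + 1) (by simp) (by simp)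
      (by simp [one_mem]) Null.nil
    simpa using this
  induction h with
  | nil => exact base
  | ins P M Q i j hij hM hK _ ih =>
    have := Null.ins (x :: P) M (Q ++ [(x.1, x.2⁻¹)]) i j hij hM hK (by simpa using ih)
    simpa using this

theorem Null.conj {L : List (Fin 4 × F)} (h : Null S L) (C : List (Fin 4 × F)) :
    Null S (C ++ L ++ linv C) := by
  induction C with
  | nil => simpa [linv] using h
  | cons x C ih =>
    have := ih.conj_single x
    have e : linv (x :: C) = linv C ++ [(x.1, x.2⁻¹)] := by simp [linv]
    rw [e]
    simpa using this

theorem Null.of_relation {L : List (Fin 4 × F)} {i j : Fin 4} (hij : i ≠ j)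
    (hL : ∀ x ∈ L, x.1 = i ∨ x.1 = j) (hK : (L.map Prod.snd).prod ∈ S.K i j) : Null S L := by
  have := Null.ins (S := S) [] L [] i j hij hL hK Null.nil
  simpa using this

/-- The elements of the group represented by null products. -/
def nullSubgroup (S : Sys F) : Subgroup F where
  carrier := {g | ∃ L, Null S L ∧ (∀ x ∈ L, x.2 ∈ S.H x.1) ∧ (L.map Prod.snd).prod = g}
  one_mem' := ⟨[], Null.nil, by simp, by simp⟩
  mul_mem' := by
    rintro _ _ ⟨L, h1, h2, rfl⟩ ⟨L', h1', h2', rfl⟩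
    exact ⟨L ++ L', h1.append h1', fun x hx => (List.mem_append.1 hx).elim (h2 x) (h2' x),
      by simp⟩
  inv_mem' := by
    rintro _ ⟨L, h1, h2, rfl⟩
    exact ⟨linv L, h1.inv, fun x hx => by simpa using inv_mem (h2 _ (mem_linv.1 hx)),
      prod_linv L⟩

theorem nullSubgroup_normal
    (hgen : ∀ g : F, ∃ C : List (Fin 4 × F), (∀ x ∈ C, x.2 ∈ S.H x.1) ∧
      (C.map Prod.snd).prod = g) : (nullSubgroup S).Normal := by
  refine ⟨?_⟩
  rintro _ ⟨L, h1, h2, rfl⟩ g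
  obtain ⟨C, h3, rfl⟩ := hgen g
  refine ⟨C ++ L ++ linv C, h1.conj C, fun x hx => ?_, ?_⟩
  · simp only [List.mem_append] at hx
    rcases hx with (hx | hx) | hx
    · exact h3 x hx
    · exact h2 x hx
    · simpa using inv_mem (h3 _ (mem_linv.1 hx))
  · rw [List.map_append, List.map_append, List.prod_append, List.prod_append, prod_linv]

variable {D : Type*} [Fintype D] [DecidableEq D] {ty : D → Fin 4}

theorem IsCyc.not_mem_split {f : Perm D} {a b d : D} {P Q : List D}
    (h : IsCyc f (a :: P ++ b :: Q)) (hd : d ∉ a :: P ++ b :: Q) :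
    cyc (swap a b * f) d = cyc f d := by
  refine cyc_swap_mul_of_not ?_ ?_ <;> intro hs <;> apply hd
  · exact (h.mem_iff (by simp)).2 hs.symm
  · exact (h.mem_iff (by simp)).2 hs.symm

/-- Cut the relations of a null product out of the boundary of a diagram. -/
theorem Diag.exists_cut {L' : List (Fin 4 × F)} (hL : Null S L') :
    ∀ (M : Diag S ty) (A L : List D), A ≠ [] → IsCyc M.φ (A ++ L) →
      L.map (fun d => (ty d, M.val d)) = L' → (∀ d, d ∉ A ++ L → M.NodeGood d) →
      ∃ M' : Diag S ty, M'.val = M.val ∧ IsCyc M'.φ A ∧ ∀ d, d ∉ A → M'.NodeGood d := by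
  induction hL with
  | nil =>
    intro M A L _ hc hm hg
    rw [List.map_eq_nil_iff] at hm
    subst hm
    rw [List.append_nil] at hc hg
    exact ⟨M, rfl, hc, hg⟩
  | ins P R Q i j hij hR hK _ ih =>
    intro M A L hA hc hm hg
    obtain ⟨L₁, Q', rfl, h1, rfl⟩ := List.map_eq_append_iff.1 hm
    obtain ⟨P', R', rfl, rfl, rfl⟩ := List.map_eq_append_iff.1 h1
    cases R' with
    | nil => exact ih M A (P' ++ Q') hA (by simpa using hc) (by simp) (by simpa using hg)
    | cons s R' =>
      obtain ⟨b, B, hB⟩ : ∃ b B, Q' ++ (A ++ P') = b :: B := by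
        apply List.exists_cons_of_ne_nil
        simp [hA]
      have hc1 : IsCyc M.φ (s :: R' ++ b :: B) := by
        rw [← hB]
        have : IsCyc M.φ ((A ++ P') ++ (s :: R' ++ Q')) := by simpa using hc
        simpa using this.swap_append
      have hsb : s ≠ b := by
        have := hc1.1
        simp only [List.cons_append, List.nodup_cons, List.mem_append, List.mem_cons,
          not_or] at this
        exact this.1.2.1
      have hs : M.φ.SameCycle s b := hc1.sameCycle (by simp) (by simp)
      let M' : Diag S ty := { M with
        φ := swap s b * M.φ
        planar := (M.planar.split hsb hs).1 }
      have hl := hc1.split_left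
      have hr := hc1.split_right
      have hmem : ∀ d, d ∈ A ++ (P' ++ s :: R' ++ Q') ↔ d ∈ s :: R' ++ b :: B := by
        intro d
        rw [← hB]
        simp only [List.mem_append, List.mem_cons]
        tauto
      refine ih M' A (P' ++ Q') hA ?_ ?_ ?_
      · have : IsCyc M'.φ (Q' ++ (A ++ P')) := by rw [hB]; exact hr
        simpa using this.swap_append
      · simp [M']
      · intro d hd
        by_cases hd' : d ∈ s :: R' ++ b :: B
        · have hdl : d ∈ s :: R' := by
            rcases List.mem_append.1 hd' with h | h
            · exact h
            · rw [← hB] at h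
              simp only [List.mem_append] at h hd
              tauto
          have hsd : M'.φ.SameCycle s d := hl.sameCycle (by simp) hdl
          refine (Diag.nodeGood_congr hsd).1 ⟨i, j, hij, fun x hx => ?_, ?_⟩
          · have hx' : x ∈ s :: R' := (hl.mem_iff (by simp)).2 hx
            exact hR _ (List.mem_map.2 ⟨x, hx', rfl⟩)
          · rw [Diag.Good, word, hl.cyc_eq]
            rw [List.map_map] at hK
            exact hK
        · have hcyc : cyc M'.φ d = cyc M.φ d := hc1.not_mem_split hd'
          obtain ⟨i', j', hij', hT, hG⟩ := hg d (fun h => hd' ((hmem d).1 h))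
          refine ⟨i', j', hij', fun x hx => hT x ?_, ?_⟩
          · rw [← mem_cyc, ← hcyc, mem_cyc]; exact hx
          · rw [Diag.Good, word, hcyc]; exact hG

/-- The cyclic permutation of `Fin (n + 1)`. -/
theorem isCyc_finRotate (n : ℕ) : IsCyc (finRotate (n + 1)) (List.finRange (n + 1)) := by
  refine ⟨List.nodup_finRange _, ?_⟩
  apply List.ext_getElem
  · simp
  · intro i h1 h2
    rw [List.getElem_map, List.getElem_rotate]
    simp only [List.getElem_finRange, finRotate_apply, List.length_finRange]
    ext
    simp [Fin.val_add]

/-- Every relation of the quotient group is read by a diagram all of whose nodes, except the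
one reading the relation, are good. -/
theorem exists_diag (hF : ∀ l : List (Fin 4 × F), l ≠ [] → (∀ x ∈ l, x.2 ∈ S.H x.1 ∧ x.2 ≠ 1) →
      (l.map Prod.fst).IsChain (· ≠ ·) → (l.map Prod.snd).prod ≠ 1)
    {w : List (Fin 4 × F)} (hw : w ≠ []) (hH : ∀ x ∈ w, x.2 ∈ S.H x.1)
    (hN : (w.map Prod.snd).prod ∈ nullSubgroup S) :
    ∃ (n : ℕ) (ty : Fin n → Fin 4) (M : Diag S ty) (A : List (Fin n)), IsCyc M.φ A ∧
      A.map (fun d => (ty d, M.val d)) = w ∧ ∀ d, d ∉ A → M.NodeGood d := by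
  obtain ⟨L, hL, hLH, hLw⟩ := inv_mem hN
  obtain ⟨n, hn⟩ : ∃ n, (w ++ L).length = n + 1 := ⟨(w ++ L).length - 1, by
    have := List.length_pos_of_ne_nil hw
    rw [List.length_append]; omega⟩
  let f : Fin (n + 1) → Fin 4 × F := fun d => (w ++ L)[d]'(by omega)
  have hf : (List.finRange (n + 1)).map f = w ++ L := by
    apply List.ext_getElem
    · simp only [List.length_map, List.length_finRange, hn]
    · intro i h1 h2
      simp [f]
  have hfin := isCyc_finRotate n
  have hH' : ∀ d, (f d).2 ∈ S.H (f d).1 := by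
    intro d
    have : f d ∈ w ++ L := by rw [← hf]; exact List.mem_map.2 ⟨d, List.mem_finRange d, rfl⟩
    exact (List.mem_append.1 this).elim (hH _) (hLH _)
  have hword : ∀ d, word (fun d => (f d).2) (finRotate (n + 1)) d = 1 := by
    intro d
    obtain ⟨A, hA⟩ : ∃ A, List.finRange (n + 1) = 0 :: A := ⟨_, List.finRange_succ ..⟩
    rw [← word_eq_one_iff _ (hfin.sameCycle (x := 0) (List.mem_finRange _) (List.mem_finRange d))]
    rw [hA] at hfin
    rw [word, hfin.cyc_eq, ← hA]
    change ((List.finRange (n + 1)).map (Prod.snd ∘ f)).prod = 1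
    rw [← List.map_map, hf, List.map_append, List.prod_append, hLw, mul_inv_cancel]
  obtain ⟨σ, h1, -, h2, h3⟩ := exists_vertices S.H hF (fun d => (f d).1) _ (finRotate (n + 1))
    (fun d => (f d).2) rfl hH' hword
  obtain ⟨A, B, hAB, hA, hB⟩ := List.map_eq_append_iff.1 hf
  let M : Diag S (fun d => (f d).1) := ⟨finRotate (n + 1), σ, fun d => (f d).2, h1, h2, hH', h3⟩
  obtain ⟨M', h4, h5, h6⟩ := Diag.exists_cut hL M A B
    (by rintro rfl; exact hw hA.symm) (hAB ▸ hfin) hB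
    (fun d hd => absurd (hAB ▸ List.mem_finRange d) hd)
  exact ⟨n + 1, _, M', A, h5, by rw [h4]; exact hA, h6⟩

end Null

section Walks

variable {F : Type*} [Group F] {S : Sys F}

/-- The free products of the vertex groups have no relations. -/
def Sys.IsFree (S : Sys F) : Prop :=
  ∀ l : List (Fin 4 × F), l ≠ [] → (∀ x ∈ l, x.2 ∈ S.H x.1 ∧ x.2 ≠ 1) →
    (l.map Prod.fst).IsChain (· ≠ ·) → (l.map Prod.snd).prod ≠ 1

/-- The vertex groups embed in the quotient. -/
theorem eq_one_of_mem_nullSubgroup (hF : S.IsFree) {i : Fin 4} {x : F} (hx : x ∈ S.H i)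
    (hN : x ∈ nullSubgroup S) : x = 1 := by
  obtain ⟨n, ty, M, A, h1, h2, h3⟩ := exists_diag hF (w := [(i, x)]) (by simp) (by simpa using hx)
    (by simpa using hN)
  obtain ⟨d, rfl, hd⟩ := List.map_eq_singleton_iff.1 h2
  rw [Prod.mk.injEq] at hd
  have hfix : M.φ d = d := by simpa using h1.2
  have hB : M.BadFree d := fun d' _ hn => h3 d' fun hmem => hn (by
    rw [List.mem_singleton.1 hmem])
  have hij : i ≠ i + 1 := by simp
  have hG := Diag.hyp_all S ty (M.size d + 1) M d i (i + 1) (Nat.lt_succ_self _) hij hB fun y hy => by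
    rw [← eq_of_sameCycle_fixed hfix hy]
    exact Or.inl hd.1
  rw [Diag.Good, word_of_fixed _ hfix, hd.2] at hG
  exact S.inf i (i + 1) hij x hx hG

/-- No closed walk in `t` and `u` is a relation. -/
theorem no_closed_walk (hF : S.IsFree) (c : Fin 3)
    (hq : ∀ i j, 360 * S.q i j = halfDegrees c i j) {p : Fin 15 × F} {W : List (Fin 15 × F)}
    (hW : ∀ x ∈ p :: W, x.2 ∈ S.H (posType x.1) ∧ x.2 ≠ 1)
    (hc : ((p :: W) ++ [p]).IsChain fun x y => PosEdge x.1 y.1)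
    (hN : ((p :: W).map Prod.snd).prod ∈ nullSubgroup S) : False := by
  obtain ⟨n, ty, M, A, h1, h2, h3⟩ := exists_diag hF
    (w := (p :: W).map fun x => (posType x.1, x.2)) (by simp)
    (by
      intro x hx
      obtain ⟨y, hy, rfl⟩ := List.mem_map.1 hx
      exact (hW y hy).1)
    (by rw [List.map_map]; exact hN)
  have hlen : A.length = (p :: W).length := by simpa using congrArg List.length h2
  obtain ⟨d₀, A', rfl⟩ : ∃ d A', A = d :: A' := List.exists_cons_of_ne_nil (by
    rintro rfl; simp at hlen)
  have hval : ∀ (i : ℕ) (h : i < (d₀ :: A').length) (h' : i < (p :: W).length),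
      ty (d₀ :: A')[i] = posType (p :: W)[i].1 ∧ M.val (d₀ :: A')[i] = (p :: W)[i].2 := by
    intro i h h'
    have := List.getElem_of_eq h2 (i := i) (by simpa using h)
    simpa only [List.getElem_map, Prod.mk.injEq] using this
  let pos : Fin n → Fin 15 := fun d => ((p :: W).getD ((d₀ :: A').idxOf d) p).1
  have hpos : ∀ (i : ℕ) (h : i < (d₀ :: A').length) (h' : i < (p :: W).length),
      pos (d₀ :: A')[i] = (p :: W)[i].1 := by
    intro i h h'
    simp only [pos]
    rw [h1.1.idxOf_getElem, List.getD_eq_getElem _ _ h']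
  refine Diag.not_badFree c hq pos d₀ (M.size d₀) M rfl (fun d _ hn => h3 d fun hmem => hn
    ((h1.mem_iff List.mem_cons_self).1 hmem)) fun x hx => ?_
  have hxA : x ∈ d₀ :: A' := (h1.mem_iff List.mem_cons_self).2 hx
  obtain ⟨i, hi, rfl⟩ := List.getElem_of_mem hxA
  have hi' : i < (p :: W).length := hlen ▸ hi
  rw [hpos i hi hi', (hval i hi hi').1, (hval i hi hi').2]
  refine ⟨rfl, ?_, (hW _ (List.getElem_mem _)).2⟩
  have hrot := List.getElem_of_eq h1.2 (i := i) (by simpa using hi)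
  rw [List.getElem_map, List.getElem_rotate] at hrot
  rw [hrot]
  have hm : (i + 1) % (d₀ :: A').length < (d₀ :: A').length := Nat.mod_lt _ (by simp)
  rw [hpos _ hm (hlen ▸ hm)]
  rw [List.isChain_iff_getElem] at hc
  have := hc i (by simp only [List.length_append, List.length_singleton]; omega)
  rw [List.getElem_append_left hi'] at this
  by_cases hlast : i + 1 < (p :: W).length
  · rw [List.getElem_append_left hlast] at this
    simpa only [hlen, Nat.mod_eq_of_lt hlast] using this
  · have e : i + 1 = (p :: W).length := by omega
    have e2 : (i + 1) % (d₀ :: A').length = 0 := by rw [hlen, e, Nat.mod_self]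
    simp only [e2, List.getElem_cons_zero]
    rw [List.getElem_append_right (by omega)] at this
    simpa only [List.getElem_singleton] using this

end Walks

section Coproduct

variable {Q : Type*} [Group Q] (A B : Subgroup Q)

/-- A letter of the free product of two subgroups. -/
def coprodLetter : A ⊕ B → Coprod A B := Sum.elim Coprod.inl Coprod.inr

/-- The value of a letter in the ambient group. -/
def letterVal : A ⊕ B → Q := Sum.elim (fun a => a) fun b => b

variable {A B}

theorem lift_prod_letters (l : List (A ⊕ B)) :
    Coprod.lift A.subtype B.subtype (l.map (coprodLetter A B)).prod =
      (l.map (letterVal A B)).prod := by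
  rw [map_list_prod, List.map_map]
  refine congrArg _ (List.map_congr_left fun x _ => ?_)
  rcases x with a | b <;> simp [coprodLetter, letterVal]

theorem exists_letters_prod (x : Coprod A B) :
    ∃ l : List (A ⊕ B), (l.map (coprodLetter A B)).prod = x := by
  induction x using Coprod.induction_on with
  | inl a => exact ⟨[Sum.inl a], by simp [coprodLetter]⟩
  | inr b => exact ⟨[Sum.inr b], by simp [coprodLetter]⟩
  | mul x y hx hy =>
    obtain ⟨l, rfl⟩ := hx
    obtain ⟨l', rfl⟩ := hy
    exact ⟨l ++ l', by simp⟩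

/-- Two subgroups generate their free product if no cyclically reduced word in them is trivial. -/
theorem coprod_lift_injective
    (h : ∀ l : List (A ⊕ B), l ≠ [] → (∀ s ∈ l, letterVal A B s ≠ 1) →
      (l ++ l).IsChain (fun s s' => s.isLeft ≠ s'.isLeft) → (l.map (letterVal A B)).prod ≠ 1) :
    Function.Injective (Coprod.lift A.subtype B.subtype) := by
  rw [injective_iff_map_eq_one]
  intro x hx
  by_contra hx1
  let P : List (A ⊕ B) → Prop := fun l =>
    (l.map (coprodLetter A B)).prod ≠ 1 ∧ (l.map (letterVal A B)).prod = 1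
  have hex : ∃ n, ∃ l, P l ∧ l.length = n := by
    obtain ⟨l, rfl⟩ := exists_letters_prod x
    exact ⟨_, l, ⟨hx1, by rwa [← lift_prod_letters]⟩, rfl⟩
  classical
  obtain ⟨l, hl, hlen⟩ := Nat.find_spec hex
  have hmin : ∀ l', P l' → l.length ≤ l'.length := fun l' h' =>
    hlen ▸ Nat.find_min' hex ⟨l', h', rfl⟩
  have rot : ∀ X Y, P (X ++ Y) → P (Y ++ X) := by
    rintro X Y ⟨h1, h2⟩
    rw [List.map_append, List.prod_append] at h1 h2
    refine ⟨fun e => h1 ?_, ?_⟩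
    · rw [List.map_append, List.prod_append] at e
      rw [mul_eq_one_iff_inv_eq] at e
      rw [← e, inv_mul_cancel]
    · rw [List.map_append, List.prod_append]
      rw [mul_eq_one_iff_inv_eq] at h2
      rw [← h2, inv_mul_cancel]
  have two : ∀ a b r, P (a :: b :: r) → r.length + 2 ≤ l.length → a.isLeft ≠ b.isLeft := by
    rintro a b r ⟨h1, h2⟩ hr e
    suffices ∃ d, P (d :: r) by
      obtain ⟨d, hd⟩ := this
      have := hmin _ hd
      simp at this
      omega
    rcases a with a | a <;> rcases b with b | b
    · exact ⟨Sum.inl (a * b), by simpa [coprodLetter, mul_assoc] using h1,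
        by simpa [letterVal, mul_assoc] using h2⟩
    · simp at e
    · simp at e
    · exact ⟨Sum.inr (a * b), by simpa [coprodLetter, mul_assoc] using h1,
        by simpa [letterVal, mul_assoc] using h2⟩
  have one : ∀ a r, P (a :: r) → r.length < l.length → letterVal A B a ≠ 1 := by
    rintro a r ⟨h1, h2⟩ hr e
    have e' : coprodLetter A B a = 1 := by
      rcases a with a | a
      · have : a = 1 := Subtype.ext e
        simp [coprodLetter, this]
      · have : a = 1 := Subtype.ext e
        simp [coprodLetter, this]
    have := hmin r ⟨by simpa [e'] using h1, by simpa [e] using h2⟩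
    omega
  have hne : l ≠ [] := by
    rintro rfl
    exact hl.1 rfl
  have hval : ∀ s ∈ l, letterVal A B s ≠ 1 := by
    intro s hs
    obtain ⟨X, Y, rfl⟩ := List.append_of_mem hs
    exact one s (Y ++ X) (rot X (s :: Y) hl) (by simp; omega)
  refine h l hne hval ?_ hl.2
  have hch : l.IsChain (fun s s' => s.isLeft ≠ s'.isLeft) := by
    rw [List.isChain_iff_forall_rel_of_append_cons_cons]
    rintro a b X Y rfl
    exact two a b (Y ++ X) (rot X (a :: b :: Y) hl) (by simp; omega)
  refine List.isChain_append.2 ⟨hch, hch, fun a ha b hb => ?_⟩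
  obtain ⟨r, rfl⟩ : ∃ r, l = b :: r := by
    cases l with
    | nil => exact absurd rfl hne
    | cons c r => exact ⟨r, by simpa using hb⟩
  rcases List.eq_nil_or_concat r with rfl | ⟨r', c, rfl⟩
  · exfalso
    refine hval b List.mem_cons_self ?_
    simpa using hl.2
  · obtain rfl : c = a := by
      rw [List.concat_eq_append, ← List.cons_append, List.getLast?_append] at ha
      simpa using ha
    refine two c b r' (rot (b :: r') [c] ?_) (by simp)
    simpa using hl

end Coproduct

section FreeSubgroup

/-- A free product with an infinite cyclic group contains a free group of rank two. -/
theorem exists_freeGroup_coprod {A B : Type*} [Group A] [Group B] [Nontrivial A]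
    (e : B ≃* Multiplicative ℤ) :
    ∃ f : FreeGroup (Fin 2) →* Coprod A B, Function.Injective f := by
  obtain ⟨a, ha⟩ := exists_ne (1 : A)
  let b : B := e.symm (Multiplicative.ofAdd 1)
  let act : A →* MulAut (FreeGroup A) :=
    { toFun := fun g => FreeGroup.freeGroupCongr (Equiv.mulLeft g)
      map_one' := by
        ext x
        simp
      map_mul' := fun g h => by
        apply MulEquiv.toMonoidHom_injective
        ext x
        simp [mul_assoc] }
  let p : Coprod A B →* FreeGroup A ⋊[act] A :=
    Coprod.lift SemidirectProduct.inr
      ((zpowersHom _ (SemidirectProduct.inl (FreeGroup.of 1))).comp e.toMonoidHom)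
  let f : FreeGroup (Fin 2) →* Coprod A B :=
    FreeGroup.lift ![Coprod.inr b, Coprod.inl a * Coprod.inr b * (Coprod.inl a)⁻¹]
  let g : Fin 2 → A := ![1, a]
  have hb : p (Coprod.inr b) = SemidirectProduct.inl (FreeGroup.of 1) := by
    simp [p, b]
  have hpf : p.comp f = SemidirectProduct.inl.comp (FreeGroup.map g) := by
    refine FreeGroup.ext_hom _ _ fun i => ?_
    fin_cases i
    · simp [f, g, hb]
    · have e1 : p (Coprod.inl a) = SemidirectProduct.inr a := by simp [p]
      have e2 : act a (FreeGroup.of 1) = FreeGroup.of a := by simp [act]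
      have e3 := SemidirectProduct.inl_aut (φ := act) a (FreeGroup.of 1)
      rw [e2, map_inv] at e3
      simp [f, g, hb, e1, e3]
  have hg : Function.Injective g := by
    intro i j
    fin_cases i <;> fin_cases j <;> simp [g, ha, ha.symm]
  refine ⟨f, Function.Injective.of_comp (f := p) ?_⟩
  have : p ∘ f = ⇑(SemidirectProduct.inl.comp (FreeGroup.map g)) := by
    rw [← hpf]; rfl
  rw [this]
  exact SemidirectProduct.inl_injective.comp (FreeGroup.map_injective hg)

end FreeSubgroup

section Segments

variable {F : Type*} [Group F] {S : Sys F}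

/-- The powers of an element of infinite order form an infinite cyclic group. -/
noncomputable def zpowersEquivInt {Q : Type*} [Group Q] {g : Q} (hg : ¬ IsOfFinOrder g) :
    Subgroup.zpowers g ≃* Multiplicative ℤ :=
  (MulEquiv.ofBijective (zpowersHom _ (⟨g, Subgroup.mem_zpowers g⟩ : Subgroup.zpowers g)) (by
    constructor
    · intro a b h
      exact injective_zpow_iff_not_isOfFinOrder.2 hg (congrArg Subtype.val h)
    · rintro ⟨_, k, rfl⟩
      exact ⟨Multiplicative.ofAdd k, rfl⟩)).symm

/-- Two consecutive segments of a closed walk in `t` and `u`. -/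
def Meets (L L' : List (Fin 15 × F)) : Prop :=
  ∀ᵉ (x ∈ L.getLast?) (y ∈ L'.head?), PosEdge x.1 y.1

/-- A nonempty walk along the letters of words in `t` and `u`. -/
structure IsSegment (S : Sys F) (L : List (Fin 15 × F)) : Prop where
  ne_nil : L ≠ []
  letter : ∀ x ∈ L, x.2 ∈ S.H (posType x.1) ∧ x.2 ≠ 1
  chain : L.IsChain fun x y => PosEdge x.1 y.1

theorem IsSegment.prod_notMem (hF : S.IsFree) (c : Fin 3)
    (hq : ∀ i j, 360 * S.q i j = halfDegrees c i j) {L : List (Fin 15 × F)}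
    (h : IsSegment S L) (hm : Meets L L) : (L.map Prod.snd).prod ∉ nullSubgroup S := by
  intro hN
  obtain ⟨p, W, rfl⟩ := List.exists_cons_of_ne_nil h.ne_nil
  refine no_closed_walk hF c hq h.letter (List.isChain_append.2 ⟨h.chain, by simp, ?_⟩) hN
  intro x hx y hy
  exact hm x hx y (by simpa using hy)

theorem IsSegment.flatten {Ls : List (List (Fin 15 × F))} (hne : Ls ≠ [])
    (h : ∀ L ∈ Ls, IsSegment S L) (hc : Ls.IsChain Meets) : IsSegment S Ls.flatten := by
  refine ⟨?_, ?_, ?_⟩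
  · obtain ⟨L, hL⟩ := List.exists_mem_of_ne_nil _ hne
    intro e
    exact (h L hL).ne_nil (List.flatten_eq_nil_iff.1 e L hL)
  · intro x hx
    obtain ⟨L, hL, hx⟩ := List.mem_flatten.1 hx
    exact (h L hL).letter x hx
  · exact (List.isChain_flatten fun hn => (h _ hn).ne_nil rfl).2 ⟨fun L hL => (h L hL).chain, hc⟩

theorem meets_flatten {Ls : List (List (Fin 15 × F))} (h : ∀ L ∈ Ls, IsSegment S L)
    (hc : (Ls ++ Ls).IsChain Meets) : Meets Ls.flatten Ls.flatten := by
  have h' := (List.isChain_flatten (R := fun x y : Fin 15 × F => PosEdge x.1 y.1)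
    (L := Ls ++ Ls) fun hn => (h [] (by simpa using hn)).ne_nil rfl).2
      ⟨fun L hL => (h L (by simpa using hL)).chain, hc⟩
  rw [List.flatten_append] at h'
  exact (List.isChain_append.1 h').2.2

/-- The letters of `u`. -/
def ublock (x y z t : F) : List (Fin 15 × F) :=
  [(1, x), (2, y), (3, z), (4, t), (5, x), (6, y), (7, z)]

/-- The letters of the inverse of `u`. -/
def vblock (x y z t : F) : List (Fin 15 × F) :=
  [(8, z⁻¹), (9, y⁻¹), (10, x⁻¹), (11, t⁻¹), (12, z⁻¹), (13, y⁻¹), (14, x⁻¹)]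

variable {x y z t : F} (hx : x ∈ S.H 0 ∧ x ≠ 1) (hy : y ∈ S.H 1 ∧ y ≠ 1)
  (hz : z ∈ S.H 2 ∧ z ≠ 1) (ht : t ∈ S.H 3 ∧ t ≠ 1)

theorem prod_ublock :
    ((ublock x y z t).map Prod.snd).prod = x * y * z * t * x * y * z := by
  simp [ublock, mul_assoc]

theorem prod_vblock :
    ((vblock x y z t).map Prod.snd).prod = (x * y * z * t * x * y * z)⁻¹ := by
  simp [vblock, mul_assoc]

include hx hy hz ht in
theorem isSegment_ublock : IsSegment S (ublock x y z t) := by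
  refine ⟨by simp [ublock], ?_, ?_⟩
  · simp only [ublock, List.mem_cons, List.not_mem_nil, or_false]
    rintro _ (rfl | rfl | rfl | rfl | rfl | rfl | rfl)
    exacts [hx, hy, hz, ht, hx, hy, hz]
  · simp only [ublock, List.isChain_cons_cons, List.isChain_singleton]
    decide

include hx hy hz ht in
theorem isSegment_vblock : IsSegment S (vblock x y z t) := by
  refine ⟨by simp [vblock], ?_, ?_⟩
  · have inv : ∀ {i : Fin 4} {g : F}, g ∈ S.H i ∧ g ≠ 1 → g⁻¹ ∈ S.H i ∧ g⁻¹ ≠ 1 :=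
      fun h => ⟨inv_mem h.1, inv_ne_one.2 h.2⟩
    simp only [vblock, List.mem_cons, List.not_mem_nil, or_false]
    rintro _ (rfl | rfl | rfl | rfl | rfl | rfl | rfl)
    exacts [inv hz, inv hy, inv hx, inv ht, inv hz, inv hy, inv hx]
  · simp only [vblock, List.isChain_cons_cons, List.isChain_singleton]
    decide

theorem meets_ublock : Meets (ublock x y z t) (ublock x y z t) := by
  intro a ha b hb
  simp only [ublock, List.getLast?_cons_cons, List.getLast?_singleton, List.head?_cons,
    Option.mem_def, Option.some.injEq] at ha hb
  subst ha hb
  simp only [PosEdge]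
  decide

theorem meets_vblock : Meets (vblock x y z t) (vblock x y z t) := by
  intro a ha b hb
  simp only [vblock, List.getLast?_cons_cons, List.getLast?_singleton, List.head?_cons,
    Option.mem_def, Option.some.injEq] at ha hb
  subst ha hb
  simp only [PosEdge]
  decide

theorem isChain_replicate {B : List (Fin 15 × F)} (h : Meets B B) (n : ℕ) :
    (List.replicate n B).IsChain Meets :=
  List.isChain_replicate_of_rel n h

theorem IsSegment.replicate {B : List (Fin 15 × F)} (h : IsSegment S B) (hm : Meets B B) {n : ℕ}
    (hn : n ≠ 0) : IsSegment S (List.replicate n B).flatten :=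
  IsSegment.flatten (by simpa using hn) (fun L hL => by rwa [List.eq_of_mem_replicate hL])
    (isChain_replicate hm n)

theorem prod_replicate (B : List (Fin 15 × F)) (n : ℕ) :
    ((List.replicate n B).flatten.map Prod.snd).prod = (B.map Prod.snd).prod ^ n := by
  induction n with
  | zero => simp
  | succ n ih => rw [List.replicate_succ, List.flatten_cons, List.map_append, List.prod_append, ih,
      pow_succ']

/-- The first and last positions of a segment spelling a power of `t` or of `u`. -/
def SegmentEnds (isT : Bool) (L : List (Fin 15 × F)) : Prop :=
  (∀ y ∈ L.head?, if isT then y.1 = 0 else y.1 = 1 ∨ y.1 = 8) ∧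
    ∀ y ∈ L.getLast?, if isT then y.1 = 0 else y.1 = 7 ∨ y.1 = 14

theorem SegmentEnds.meets {b b' : Bool} {L L' : List (Fin 15 × F)} (h : SegmentEnds b L)
    (h' : SegmentEnds b' L') (hb : b ≠ b') : Meets L L' := by
  intro x hx y hy
  have h1 := h.2 x hx
  have h2 := h'.1 y hy
  cases b <;> cases b'
  · exact absurd rfl hb
  · simp only [Bool.false_eq_true, if_false, if_true] at h1 h2
    rcases h1 with h1 | h1 <;> rw [h1, h2] <;> decide
  · simp only [Bool.false_eq_true, if_false, if_true] at h1 h2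
    rcases h2 with h2 | h2 <;> rw [h1, h2] <;> decide
  · exact absurd rfl hb

theorem SegmentEnds.replicate {b : Bool} {B : List (Fin 15 × F)} (h : SegmentEnds b B) {n : ℕ}
    (hn : n ≠ 0) : SegmentEnds b (List.replicate n B).flatten := by
  refine ⟨fun y hy => h.1 y ?_, fun y hy => h.2 y ?_⟩
  · rwa [List.head?_flatten_replicate hn] at hy
  · rwa [List.getLast?_flatten_replicate hn] at hy

theorem segmentEnds_ublock : SegmentEnds false (ublock x y z t) := by
  simp [SegmentEnds, ublock]

theorem segmentEnds_vblock : SegmentEnds false (vblock x y z t) := by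
  simp [SegmentEnds, vblock]

variable {N : Subgroup F} [N.Normal]

include ht in
theorem exists_segment_left {g : F ⧸ N}
    (hg : g ∈ Subgroup.zpowers (QuotientGroup.mk' N t)) (hg1 : g ≠ 1) :
    ∃ L, IsSegment S L ∧ SegmentEnds true L ∧ QuotientGroup.mk' N (L.map Prod.snd).prod = g := by
  obtain ⟨k, rfl⟩ := hg
  refine ⟨[(0, t ^ k)], ⟨by simp, ?_, by simp⟩, by simp [SegmentEnds], by simp⟩
  simp only [List.mem_singleton, forall_eq]
  exact ⟨zpow_mem ht.1 k, fun e => hg1 (by simp only [← map_zpow, e, map_one])⟩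

include hx hy hz ht in
theorem exists_segment_right {g : F ⧸ N}
    (hg : g ∈ Subgroup.zpowers (QuotientGroup.mk' N (x * y * z * t * x * y * z))) (hg1 : g ≠ 1) :
    ∃ L, IsSegment S L ∧ SegmentEnds false L ∧ QuotientGroup.mk' N (L.map Prod.snd).prod = g := by
  obtain ⟨k, rfl⟩ := hg
  have hk : k.natAbs ≠ 0 := by
    intro e
    rw [Int.natAbs_eq_zero] at e
    exact hg1 (by simp [e])
  rcases Int.natAbs_eq k with e | e
  · refine ⟨_, (isSegment_ublock hx hy hz ht).replicate meets_ublock hk,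
      segmentEnds_ublock.replicate hk, ?_⟩
    rw [prod_replicate, prod_ublock, map_pow, ← zpow_natCast, ← e]
  · refine ⟨_, (isSegment_vblock hx hy hz ht).replicate meets_vblock hk,
      segmentEnds_vblock.replicate hk, ?_⟩
    rw [prod_replicate, prod_vblock, map_pow, map_inv, inv_pow, ← zpow_natCast, ← zpow_neg, ← e]

variable (hF : S.IsFree) (c : Fin 3) (hq : ∀ i j, 360 * S.q i j = halfDegrees c i j)
  (hN : N ≤ nullSubgroup S)

include hx hy hz ht hF hq hN

theorem pow_ne_one_of_le_nullSubgroup (n : ℕ) (hn : n ≠ 0) :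
    (QuotientGroup.mk' N (x * y * z * t * x * y * z)) ^ n ≠ 1 := by
  intro e
  rw [← map_pow, ← prod_ublock, ← prod_replicate, QuotientGroup.mk'_apply,
    QuotientGroup.eq_one_iff] at e
  have h := isSegment_ublock hx hy hz ht
  refine (h.replicate meets_ublock hn).prod_notMem hF c hq (meets_flatten (S := S)
    (fun L hL => ?_) ?_) (hN e)
  · rwa [List.eq_of_mem_replicate hL]
  · rw [List.replicate_append_replicate]
    exact isChain_replicate meets_ublock _

theorem lift_injective_of_le_nullSubgroup :
    Function.Injective (Coprod.lift
      (Subgroup.zpowers (QuotientGroup.mk' N t)).subtype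
      (Subgroup.zpowers (QuotientGroup.mk' N (x * y * z * t * x * y * z))).subtype) := by
  refine coprod_lift_injective fun l hl hval hc hprod => ?_
  have hseg : ∀ s : Subgroup.zpowers (QuotientGroup.mk' N t) ⊕
      Subgroup.zpowers (QuotientGroup.mk' N (x * y * z * t * x * y * z)), ∃ L : List (Fin 15 × F),
      letterVal _ _ s ≠ 1 → IsSegment S L ∧ SegmentEnds s.isLeft L ∧
        QuotientGroup.mk' N (L.map Prod.snd).prod = letterVal _ _ s := by
    intro s
    by_cases h1 : letterVal _ _ s = 1
    · exact ⟨[], fun h => absurd h1 h⟩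
    · rcases s with s | s
      · obtain ⟨L, hL⟩ := exists_segment_left (S := S) ht s.2 h1
        exact ⟨L, fun _ => hL⟩
      · obtain ⟨L, hL⟩ := exists_segment_right (S := S) hx hy hz ht s.2 h1
        exact ⟨L, fun _ => hL⟩
  choose seg hs using hseg
  have hsegs : ∀ L ∈ l.map seg, IsSegment S L := by
    intro L hL
    obtain ⟨s, h1, rfl⟩ := List.mem_map.1 hL
    exact (hs s (hval s h1)).1
  have hchain : (l.map seg ++ l.map seg).IsChain Meets := by
    rw [← List.map_append, List.isChain_map]
    refine List.IsChain.imp_of_mem_imp ?_ hc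
    intro s s' h1 h2 h3
    exact (hs s (hval s ((List.mem_append.1 h1).elim id id))).2.1.meets
      (hs s' (hval s' ((List.mem_append.1 h2).elim id id))).2.1 h3
  have hall := IsSegment.flatten (mt List.map_eq_nil_iff.1 hl) hsegs
    (List.isChain_append.1 hchain).1
  refine hall.prod_notMem hF c hq (meets_flatten hsegs hchain) (hN ?_)
  rw [← QuotientGroup.eq_one_iff, ← QuotientGroup.mk'_apply, ← hprod, List.map_flatten,
    List.prod_flatten, map_list_prod, List.map_map, List.map_map, List.map_map]
  exact congrArg _ (List.map_congr_left fun s h => (hs s (hval s h)).2.2)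

theorem exists_freeGroup_of_le_nullSubgroup :
    ∃ f : FreeGroup (Fin 2) →* F ⧸ N, Function.Injective f := by
  have ht1 : QuotientGroup.mk' N t ≠ 1 := by
    rw [QuotientGroup.mk'_apply, Ne, QuotientGroup.eq_one_iff]
    exact fun h => ht.2 (eq_one_of_mem_nullSubgroup hF ht.1 (hN h))
  have hnt : Nontrivial (Subgroup.zpowers (QuotientGroup.mk' N t)) :=
    ⟨⟨⟨_, Subgroup.mem_zpowers _⟩, 1, fun e => ht1 (congrArg Subtype.val e)⟩⟩
  have hinf : ¬ IsOfFinOrder (QuotientGroup.mk' N (x * y * z * t * x * y * z)) := by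
    rw [isOfFinOrder_iff_pow_eq_one]
    rintro ⟨n, hn, e⟩
    exact pow_ne_one_of_le_nullSubgroup hx hy hz ht hF c hq hN n hn.ne' e
  obtain ⟨f, hf⟩ := exists_freeGroup_coprod (A := Subgroup.zpowers (QuotientGroup.mk' N t))
    (zpowersEquivInt hinf)
  exact ⟨(Coprod.lift (Subgroup.subtype _) (Subgroup.subtype _)).comp f,
    (lift_injective_of_le_nullSubgroup hx hy hz ht hF c hq hN).comp hf⟩

end Segments

section Assembly

variable {G : Fin 4 → Type*} [∀ i, Group (G i)] {R : ∀ i j : Fin 4, Set (Coprod (G i) (G j))}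

theorem exists_letters_coprodI (g : CoprodI G) : ∃ C : List (Fin 4 × CoprodI G),
    (∀ x ∈ C, x.2 ∈ (CoprodI.of : G x.1 →* CoprodI G).range) ∧ (C.map Prod.snd).prod = g := by
  induction g using CoprodI.induction_on with
  | one => exact ⟨[], by simp, by simp⟩
  | of i g => exact ⟨[(i, CoprodI.of g)], by simp, by simp⟩
  | mul x y hx hy =>
    obtain ⟨C, h1, rfl⟩ := hx
    obtain ⟨C', h2, rfl⟩ := hy
    exact ⟨C ++ C', fun x hx => (List.mem_append.1 hx).elim (h1 x) (h2 x), by simp⟩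

theorem normalClosure_prideRels_le (h0 : ∀ i, R i i = ∅) {S : Sys (CoprodI G)}
    (hH : ∀ i, S.H i = (CoprodI.of : G i →* CoprodI G).range)
    (hK : S.K = edgeSubgroup R) : Subgroup.normalClosure (prideRels G R) ≤ nullSubgroup S := by
  have := nullSubgroup_normal (S := S) (by simpa only [hH] using exists_letters_coprodI)
  refine Subgroup.normalClosure_le_normal fun r hr => ?_
  obtain ⟨i, j, l, hij, h1, h2, h3⟩ := exists_letters_of_mem_prideRels h0 hr
  exact ⟨l, Null.of_relation hij (fun x hx => (h1 x hx).1) (by rw [hK, h2]; exact h3),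
    fun x hx => by rw [hH]; exact (h1 x hx).2, h2⟩

/-- The three possible systems of angles, as fractions of `π`. -/
def angleFraction (c : Fin 3) (i j : Fin 4) : ℚ := halfDegrees c i j / 360

theorem halfDegrees_symm : ∀ (c : Fin 3) (i j : Fin 4), halfDegrees c i j = halfDegrees c j i := by
  decide

theorem halfDegrees_self : ∀ (c : Fin 3) (i : Fin 4), halfDegrees c i i = 0 := by
  decide

theorem halfDegrees_le : ∀ (c : Fin 3) (i j : Fin 4), halfDegrees c i j ≤ 180 := by
  decide

theorem halfDegrees_triangle : ∀ (c : Fin 3) (i j k : Fin 4), i ≠ j → j ≠ k → i ≠ k →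
    halfDegrees c i j + halfDegrees c j k + halfDegrees c k i = 360 := by
  decide

theorem halfDegrees_opposite : ∀ c : Fin 3, halfDegrees c 1 3 = halfDegrees c 0 2 ∧
    halfDegrees c 2 3 = halfDegrees c 0 1 ∧ halfDegrees c 0 3 = halfDegrees c 1 2 := by
  decide

theorem mul_angleFraction {s : ℝ} {c : Fin 3} {i j : Fin 4} {k : ℕ} (h : halfDegrees c i j = k)
    (hs : 360 * s = k * Real.pi) : s = Real.pi * angleFraction c i j := by
  rw [angleFraction, h]
  push_cast
  linarith

/-- The angles of a Euclidean tetrahedron are one of three systems. -/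
theorem exists_angleFraction {a : Fin 4 → Fin 4 → ℝ}
    (hcase : ∀ i j, i ≠ j →
      a i j = 0 ∨ ∃ m : ℕ, 4 ≤ m ∧ m ≠ 5 ∧ a i j = Real.pi * (2 / m))
    (hEq : ∀ i j k : Fin 4, i ≠ j → j ≠ k → i ≠ k → a i j + a j k + a i k = Real.pi)
    {θ α β : ℝ} (hθ : a 0 2 = θ ∧ a 1 3 = θ) (hα : a 0 1 = α ∧ a 2 3 = α)
    (hβ : a 1 2 = β ∧ a 0 3 = β) (hord : β ≤ α ∧ α ≤ θ)
    (hne : (θ, α, β) ≠ (Real.pi / 2, Real.pi / 2, 0)) :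
    ∃ c : Fin 3, ∀ i j, i ≠ j → a i j = Real.pi * angleFraction c i j := by
  have hπ := Real.pi_pos
  have symm : ∀ i j, i ≠ j → a i j = a j i := by
    intro i j hij
    obtain ⟨k, hi, hj⟩ : ∃ k, k ≠ i ∧ k ≠ j := by
      revert i j; decide
    have h1 := hEq k i j hi hij hj
    have h2 := hEq k j i hj hij.symm hi
    linarith
  have frac : ∀ i j, i ≠ j →
      a i j / Real.pi = 0 ∨ ∃ m : ℕ, 4 ≤ m ∧ m ≠ 5 ∧ a i j / Real.pi = 2 / m := by
    intro i j hij
    rcases hcase i j hij with h | ⟨m, h1, h2, h⟩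
    · exact Or.inl (by rw [h, zero_div])
    · exact Or.inr ⟨m, h1, h2, by rw [h, mul_div_cancel_left₀ _ hπ.ne']⟩
  have hsum := hEq 0 1 2 (by decide) (by decide) (by decide)
  have main := angle_arith (frac 0 2 (by decide)) (frac 0 1 (by decide)) (frac 1 2 (by decide))
    (by rw [← add_div, ← add_div, div_eq_one_iff_eq hπ.ne']; linarith)
    (by rw [hβ.1, hα.1]; exact div_le_div_of_nonneg_right hord.1 hπ.le)
    (by rw [hθ.1, hα.1]; exact div_le_div_of_nonneg_right hord.2 hπ.le) (by
      rintro ⟨h1, h2⟩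
      rw [div_eq_iff hπ.ne'] at h1 h2
      refine hne ?_
      rw [← hθ.1, ← hα.1, ← hβ.1]
      simp only [Prod.mk.injEq]
      refine ⟨by linarith, by linarith, by linarith⟩)
  rw [hθ.1, hα.1, hβ.1] at main
  simp only [div_eq_iff hπ.ne'] at main
  have key : ∀ c : Fin 3, θ = Real.pi * angleFraction c 0 2 → α = Real.pi * angleFraction c 0 1 →
      β = Real.pi * angleFraction c 1 2 → (∀ i j, i ≠ j → a i j = Real.pi * angleFraction c i j) := by
    intro c h1 h2 h3
    have lt : ∀ i j : Fin 4, i < j → a i j = Real.pi * angleFraction c i j := by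
      obtain ⟨e1, e2, e3⟩ := halfDegrees_opposite c
      have hh : a 0 2 = Real.pi * angleFraction c 0 2 ∧ a 1 3 = Real.pi * angleFraction c 1 3 ∧
          a 0 1 = Real.pi * angleFraction c 0 1 ∧ a 2 3 = Real.pi * angleFraction c 2 3 ∧
          a 1 2 = Real.pi * angleFraction c 1 2 ∧ a 0 3 = Real.pi * angleFraction c 0 3 := by
        simp only [angleFraction, e1, e2, e3] at h1 h2 h3 ⊢
        rw [hθ.1, hθ.2, hα.1, hα.2, hβ.1, hβ.2]
        exact ⟨h1, h1, h2, h2, h3, h3⟩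
      obtain ⟨h02, h13, h01, h23, h12, h03⟩ := hh
      intro i j hij
      fin_cases i <;> fin_cases j <;> first | (exact absurd hij (by decide)) | assumption
    intro i j hij
    rcases lt_or_gt_of_ne hij with h | h
    · exact lt i j h
    · rw [symm i j hij, lt j i h, angleFraction, angleFraction, halfDegrees_symm]
  rcases main with ⟨h1, h2, h3⟩ | ⟨h1, h2, h3⟩ | ⟨h1, h2, h3⟩
  · exact ⟨0, key 0 (mul_angleFraction (k := 120) rfl (by push_cast; linarith))
      (mul_angleFraction (k := 120) rfl (by push_cast; linarith))
      (mul_angleFraction (k := 120) rfl (by push_cast; linarith))⟩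
  · exact ⟨1, key 1 (mul_angleFraction (k := 180) rfl (by push_cast; linarith))
      (mul_angleFraction (k := 90) rfl (by push_cast; linarith))
      (mul_angleFraction (k := 90) rfl (by push_cast; linarith))⟩
  · exact ⟨2, key 2 (mul_angleFraction (k := 180) rfl (by push_cast; linarith))
      (mul_angleFraction (k := 120) rfl (by push_cast; linarith))
      (mul_angleFraction (k := 60) rfl (by push_cast; linarith))⟩

/-- The data of a Pride group whose angles form a given system. -/
def angleSys (hsw : ∀ i j, (Coprod.swap (G i) (G j)) '' R i j = R j i) (c : Fin 3)
    (hang : ∀ i j, i ≠ j →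
      gsAngle (Subgroup.normalClosure (R i j)) = Real.pi * angleFraction c i j) :
    Sys (CoprodI G) :=
  prideSys hsw (angleFraction c) (fun i j => by rw [angleFraction, angleFraction, halfDegrees_symm])
    (fun i => by rw [angleFraction, halfDegrees_self]; norm_num)
    (fun i j => by
      have : (halfDegrees c i j : ℚ) ≤ 180 := by exact_mod_cast halfDegrees_le c i j
      rw [angleFraction]; linarith)
    (fun i j k h1 h2 h3 => by
      have : (halfDegrees c i j + halfDegrees c j k + halfDegrees c k i : ℚ) = 360 := by
        exact_mod_cast halfDegrees_triangle c i j k h1 h2 h3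
      simp only [angleFraction]; linarith) hang

end Assembly

end PrideMap

open scoped Real in
/-- Let `G` be a non-spherical Pride group on four vertex groups
`X = G 0`, `Y = G 1`, `Z = G 2`, `T = G 3` in which every triangle of
Gersten–Stallings angles sums to exactly `π`, with opposite edges carrying equal angles
`θ = ∠(X,Z) = ∠(Y,T)`, `α = ∠(X,Y) = ∠(Z,T)`, `β = ∠(Y,Z) = ∠(X,T)`, `θ ≥ α ≥ β`, and
`(θ, α, β) ≠ (π/2, π/2, 0)`.  Then for all nontrivial `x ∈ X`, `y ∈ Y`, `z ∈ Z`,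
`t ∈ T`, the image `u` of `xyztxyz` in `G` has infinite order, the subgroup generated by
`t` and `u` is the free product `⟨t⟩ ∗ ⟨u⟩` of the cyclic subgroups they generate (i.e.
the canonical map `⟨t⟩ ∗ ⟨u⟩ →* G` is injective), and `G` contains a non-abelian free
subgroup. -/
theorem pride_group_four_vertices_free_product_criterion
    (G : Fin 4 → Type*) [∀ i, Group (G i)] (hG : ∀ i, Nontrivial (G i))
    (R : ∀ i j : Fin 4, Set (Coprod (G i) (G j)))
    (hR : IsPrideData G R) (hNS : NonSpherical G R)
    (hEq : ∀ i j k : Fin 4, i ≠ j → j ≠ k → i ≠ k →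
      gsAngle (Subgroup.normalClosure (R i j)) + gsAngle (Subgroup.normalClosure (R j k)) +
        gsAngle (Subgroup.normalClosure (R i k)) = π)
    (θ α β : ℝ)
    (hθ : gsAngle (Subgroup.normalClosure (R 0 2)) = θ ∧
      gsAngle (Subgroup.normalClosure (R 1 3)) = θ)
    (hα : gsAngle (Subgroup.normalClosure (R 0 1)) = α ∧
      gsAngle (Subgroup.normalClosure (R 2 3)) = α)
    (hβ : gsAngle (Subgroup.normalClosure (R 1 2)) = β ∧
      gsAngle (Subgroup.normalClosure (R 0 3)) = β)
    (hord : β ≤ α ∧ α ≤ θ)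
    (hne : (θ, α, β) ≠ (π / 2, π / 2, 0)) :
    ∀ (x : G 0) (y : G 1) (z : G 2) (t : G 3), x ≠ 1 → y ≠ 1 → z ≠ 1 → t ≠ 1 →
      (∀ n : ℕ, n ≠ 0 →
        (QuotientGroup.mk' (Subgroup.normalClosure (prideRels G R))
            (CoprodI.of x * CoprodI.of y * CoprodI.of z * CoprodI.of t *
              CoprodI.of x * CoprodI.of y * CoprodI.of z)) ^ n ≠ 1) ∧
      Function.Injective
        (Coprod.lift
          (Subgroup.zpowers
            (QuotientGroup.mk' (Subgroup.normalClosure (prideRels G R))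
              (CoprodI.of t))).subtype
          (Subgroup.zpowers
            (QuotientGroup.mk' (Subgroup.normalClosure (prideRels G R))
              (CoprodI.of x * CoprodI.of y * CoprodI.of z * CoprodI.of t *
                CoprodI.of x * CoprodI.of y * CoprodI.of z))).subtype) ∧
      ∃ f : FreeGroup (Fin 2) →* PrideGroup G R, Function.Injective f := by
  intro x y z t hx hy hz ht
  obtain ⟨c, hc⟩ := PrideMap.exists_angleFraction
    (fun i j hij => PrideMap.gsAngle_cases (hNS.1 i j hij))
    hEq hθ hα hβ hord hne
  have letter : ∀ {i : Fin 4} {g : G i}, g ≠ 1 →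
      (CoprodI.of g : CoprodI G) ∈ (PrideMap.angleSys hR.2.1 c hc).H i ∧ CoprodI.of g ≠ 1 :=
    fun {i g} h => ⟨⟨g, rfl⟩, fun e => h (CoprodI.of_injective i (e.trans (map_one _).symm))⟩
  have hF : (PrideMap.angleSys hR.2.1 c hc).IsFree := fun l => PrideMap.coprodI_prod_ne_one
  have hq : ∀ i j, 360 * (PrideMap.angleSys hR.2.1 c hc).q i j = PrideMap.halfDegrees c i j :=
    fun i j => mul_div_cancel₀ _ (by norm_num)
  have hN := PrideMap.normalClosure_prideRels_le hR.1 (S := PrideMap.angleSys hR.2.1 c hc)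
    (fun _ => rfl) rfl
  exact ⟨PrideMap.pow_ne_one_of_le_nullSubgroup (letter hx) (letter hy) (letter hz) (letter ht)
      hF c hq hN,
    PrideMap.lift_injective_of_le_nullSubgroup (letter hx) (letter hy) (letter hz) (letter ht)
      hF c hq hN,
    PrideMap.exists_freeGroup_of_le_nullSubgroup (letter hx) (letter hy) (letter hz) (letter ht)
      hF c hq hN⟩
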